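/- arXiv:1907.05003 — 7 statements merged into one kernel-verified Lean document; each statement's English description precedes it below -/
import Mathlib

section
/- Let g be a finite-dimensional solvable complex Lie algebra with trivial center whose Lie bracket is rigid. Then g decomposes as a direct sum of subspaces g = n ⊕ a, where n is the nilradical of g (the largest nilpotent ideal) and a is an abelian subalgebra of g such that for every T ∈ a the endomorphism ad T is semisimple. -/
/-- `A(V)`: an alternating (continuous) bilinear map `μ : V × V → V`. -/
def IsAltBil {V : Type*} [NormedAddCommGroup V] [NormedSpace ℂ V]
    (μ : V →L[ℂ] V →L[ℂ] V) : Prop :=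
  ∀ x : V, μ x x = 0

/-- A Lie bracket on `V`: an alternating bilinear map satisfying the Jacobi identity. -/
def IsLieBracket {V : Type*} [NormedAddCommGroup V] [NormedSpace ℂ V]
    (μ : V →L[ℂ] V →L[ℂ] V) : Prop :=
  IsAltBil μ ∧ ∀ x y z : V, μ (μ x y) z + μ (μ y z) x + μ (μ z x) y = 0

/-- The `GL(V)`-orbit of `μ` under the transport action
`(f · μ)(X,Y) = f⁻¹ (μ (f X) (f Y))`. -/
def transportOrbit {V : Type*} [NormedAddCommGroup V] [NormedSpace ℂ V]
    (μ : V →L[ℂ] V →L[ℂ] V) : Set (V →L[ℂ] V →L[ℂ] V) :=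
  {ν | ∃ f : V ≃L[ℂ] V, ∀ x y : V, ν x y = f.symm (μ (f x) (f y))}

/-- A subspace closed under the bracket `μ` (a subalgebra). -/
def IsSubalg {V : Type*} [NormedAddCommGroup V] [NormedSpace ℂ V]
    (μ : V →L[ℂ] V →L[ℂ] V) (W : Submodule ℂ V) : Prop :=
  ∀ x ∈ W, ∀ y ∈ W, μ x y ∈ W

/-- A subspace on which the bracket `μ` vanishes identically (an abelian subalgebra,
when it is a subalgebra). -/
def IsAbelianSub {V : Type*} [NormedAddCommGroup V] [NormedSpace ℂ V]
    (μ : V →L[ℂ] V →L[ℂ] V) (W : Submodule ℂ V) : Prop :=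
  ∀ x ∈ W, ∀ y ∈ W, μ x y = 0

/-- An ideal for the bracket `μ`. -/
def IsIdealμ {V : Type*} [NormedAddCommGroup V] [NormedSpace ℂ V]
    (μ : V →L[ℂ] V →L[ℂ] V) (I : Submodule ℂ V) : Prop :=
  ∀ x : V, ∀ y ∈ I, μ x y ∈ I

/-- The subspace spanned by all brackets `μ x y` with `x ∈ A`, `y ∈ B`. -/
def bracketSpan {V : Type*} [NormedAddCommGroup V] [NormedSpace ℂ V]
    (μ : V →L[ℂ] V →L[ℂ] V) (A B : Submodule ℂ V) : Submodule ℂ V :=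
  Submodule.span ℂ {z | ∃ x ∈ A, ∃ y ∈ B, z = μ x y}

/-- The derived series of the bracket `μ`. -/
def derivedSeriesμ {V : Type*} [NormedAddCommGroup V] [NormedSpace ℂ V]
    (μ : V →L[ℂ] V →L[ℂ] V) : ℕ → Submodule ℂ V
  | 0 => ⊤
  | k + 1 => bracketSpan μ (derivedSeriesμ μ k) (derivedSeriesμ μ k)

/-- `μ` is a solvable bracket: its derived series reaches `0`. -/
def IsSolvableμ {V : Type*} [NormedAddCommGroup V] [NormedSpace ℂ V]
    (μ : V →L[ℂ] V →L[ℂ] V) : Prop :=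
  ∃ k, derivedSeriesμ μ k = ⊥

/-- The lower central series of a subspace `I` with respect to `μ`. -/
def lcsμ {V : Type*} [NormedAddCommGroup V] [NormedSpace ℂ V]
    (μ : V →L[ℂ] V →L[ℂ] V) (I : Submodule ℂ V) : ℕ → Submodule ℂ V
  | 0 => I
  | k + 1 => bracketSpan μ I (lcsμ μ I k)

/-- `I` is a nilpotent ideal for `μ`. -/
def IsNilpotentIdealμ {V : Type*} [NormedAddCommGroup V] [NormedSpace ℂ V]
    (μ : V →L[ℂ] V →L[ℂ] V) (I : Submodule ℂ V) : Prop :=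
  IsIdealμ μ I ∧ ∃ k, lcsμ μ I k = ⊥

open LieModule in
theorem exists_weights_of_isSolvable {L : Type*} [LieRing L] [LieAlgebra ℂ L]
    [LieAlgebra.IsSolvable L] (d : ℕ) : ∀ (V : Type*) [AddCommGroup V] [Module ℂ V]
    [FiniteDimensional ℂ V] [LieRingModule L V] [LieModule ℂ L V],
    Module.finrank ℂ V = d → ∃ w : Fin d → L →ₗ[ℂ] ℂ, ∀ x,
      (∀ c : ℂ, LinearMap.det (c • (1 : Module.End ℂ V) - toEnd ℂ L V x) = ∏ i, (c - w i x)) ∧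
      ∀ y i, w i ⁅x, y⁆ = 0 := by
  induction d with
  | zero =>
    intro V _ _ _ _ _ hd
    have := Module.finrank_zero_iff.1 hd
    exact ⟨Fin.elim0, fun x => ⟨fun c => by simp [LinearMap.det_eq_one_of_finrank_eq_zero hd], fun y i => i.elim0⟩⟩
  | succ d ih =>
    intro V _ _ _ _ _ hd
    have : Nontrivial V := Module.nontrivial_of_finrank_eq_succ hd
    obtain ⟨χ, hχ⟩ := exists_nontrivial_weightSpace_of_isSolvable ℂ L V
    obtain ⟨⟨v, hv⟩, hv0⟩ := exists_ne (0 : weightSpace V χ)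
    rw [mem_weightSpace] at hv
    replace hv0 : v ≠ 0 := by simpa using hv0
    let N : LieSubmodule ℂ L V :=
      { toSubmodule := Submodule.span ℂ {v}
        lie_mem := by
          intro x m hm
          obtain ⟨a, rfl⟩ := Submodule.mem_span_singleton.1 hm
          refine Submodule.mem_span_singleton.2 ⟨a * χ x, ?_⟩
          rw [lie_smul, hv, smul_smul] }
    have hN : Module.finrank ℂ N = 1 := finrank_span_singleton hv0
    have hq : Module.finrank ℂ (V ⧸ N) = d := by
      have := Submodule.finrank_quotient_add_finrank N.toSubmodule
      have h2 : Module.finrank ℂ N.toSubmodule = 1 := hN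
      have h3 : Module.finrank ℂ (V ⧸ N) = Module.finrank ℂ (V ⧸ N.toSubmodule) := rfl
      omega
    obtain ⟨w, hw⟩ := ih (V ⧸ N) hq
    refine ⟨Fin.cons χ w, fun x => ⟨fun c => ?_, fun y i => ?_⟩⟩
    · have hle : N.toSubmodule ≤
          N.toSubmodule.comap (c • (1 : Module.End ℂ V) - toEnd ℂ L V x) := by
        intro m hm
        exact N.toSubmodule.sub_mem (N.toSubmodule.smul_mem c hm) (N.lie_mem hm)
      rw [LinearMap.det_eq_det_mul_det N.toSubmodule _ hle, Fin.prod_univ_succ]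
      congr 1
      · have : LinearMap.restrict (p := N.toSubmodule) (q := N.toSubmodule)
            (c • (1 : Module.End ℂ V) - toEnd ℂ L V x) hle = (c - χ x) • LinearMap.id := by
          ext ⟨m, hm⟩
          obtain ⟨a, rfl⟩ := Submodule.mem_span_singleton.1 hm
          simp only [LinearMap.restrict_apply, LinearMap.sub_apply, LinearMap.smul_apply,
            Module.End.one_apply, LieModule.toEnd_apply_apply, lie_smul, hv, LinearMap.id_apply,
            Submodule.coe_smul]
          module
        erw [this, LinearMap.det_smul]
        have h2 : Module.finrank ℂ N.toSubmodule = 1 := hN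
        rw [h2]
        simp
      · simp only [Fin.cons_succ]
        rw [← (hw x).1 c]
        congr 1
        ext m
        rfl
    · refine Fin.cases ?_ (fun i => ?_) i
      · have h : χ ⁅x, y⁆ • v = 0 := by
          rw [← hv, lie_lie, hv, hv, lie_smul, lie_smul, hv, hv, smul_smul, smul_smul, mul_comm,
            sub_self]
        simpa [hv0] using h
      · simpa using (hw x).2 y i

/-- A space of endomorphisms with a finite chain of subspaces, each containing the commutators
of the previous one, ending in zero. -/
inductive IsSolvableSpace {V : Type*} [AddCommGroup V] [Module ℂ V] :
    Submodule ℂ (Module.End ℂ V) → Prop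
  | bot : IsSolvableSpace ⊥
  | step (W W' : Submodule ℂ (Module.End ℂ V)) (hle : W' ≤ W)
      (hlie : ∀ A ∈ W, ∀ B ∈ W, A * B - B * A ∈ W') (hW' : IsSolvableSpace W') : IsSolvableSpace W

theorem IsSolvableSpace.commutator_mem {V : Type*} [AddCommGroup V] [Module ℂ V]
    {W : Submodule ℂ (Module.End ℂ V)} (hW : IsSolvableSpace W) {A B : Module.End ℂ V}
    (hA : A ∈ W) (hB : B ∈ W) : A * B - B * A ∈ W := by
  cases hW with
  | bot =>
    rw [Submodule.mem_bot] at hA hB ⊢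
    simp [hA, hB]
  | step W W' hle hlie _ => exact hle (hlie A hA B hB)

/-- The diagonal entries of a simultaneous triangularization of a space of endomorphisms. -/
structure IsWeightSystem {V : Type*} [AddCommGroup V] [Module ℂ V]
    (W : Submodule ℂ (Module.End ℂ V)) (w : Fin (Module.finrank ℂ V) → Module.End ℂ V →ₗ[ℂ] ℂ) : Prop where
  det_eq : ∀ A ∈ W, ∀ c : ℂ, LinearMap.det (c • (1 : Module.End ℂ V) - A) = ∏ i, (c - w i A)
  lie_eq : ∀ A ∈ W, ∀ B ∈ W, ∀ i, w i (A * B - B * A) = 0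

section

attribute [local instance] LieRing.ofAssociativeRing

theorem IsSolvableSpace.isSolvable {V : Type*} [AddCommGroup V] [Module ℂ V]
    {W : Submodule ℂ (Module.End ℂ V)} (hW : IsSolvableSpace W)
    (K : LieSubalgebra ℂ (Module.End ℂ V)) (hK : K.toSubmodule = W) :
    LieAlgebra.IsSolvable K := by
  suffices H : ∀ k, (∀ x ∈ LieAlgebra.derivedSeries ℂ K k, (x : Module.End ℂ V) ∈ W) →
      ∃ m, LieAlgebra.derivedSeries ℂ K m = ⊥ by
    obtain ⟨m, hm⟩ := H 0 (fun x _ => hK ▸ x.2)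
    exact (LieAlgebra.isSolvable_iff ℂ K).2 ⟨m, hm⟩
  clear hK
  induction hW with
  | bot =>
    intro k hk
    refine ⟨k, (LieSubmodule.eq_bot_iff _).2 fun x hx => ?_⟩
    simpa using hk x hx
  | step W W' hle hlie _ ih =>
    intro k hk
    refine ih (k + 1) fun x hx => ?_
    rw [LieAlgebra.derivedSeries_def, LieAlgebra.derivedSeriesOfIdeal_succ,
      ← LieSubmodule.mem_toSubmodule, LieSubmodule.lieIdeal_oper_eq_linear_span'] at hx
    induction hx using Submodule.span_induction with
    | mem x hx =>
      obtain ⟨a, ha, b, hb, rfl⟩ := hx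
      exact hlie _ (hk a ha) _ (hk b hb)
    | zero => exact W'.zero_mem
    | add x y _ _ hx hy => exact W'.add_mem hx hy
    | smul a x _ hx => exact W'.smul_mem a hx

theorem IsSolvableSpace.exists_isWeightSystem {V : Type*} [AddCommGroup V] [Module ℂ V]
    [FiniteDimensional ℂ V] {W : Submodule ℂ (Module.End ℂ V)} (hW : IsSolvableSpace W) :
    ∃ w : Fin (Module.finrank ℂ V) → Module.End ℂ V →ₗ[ℂ] ℂ, IsWeightSystem W w := by
  let K : LieSubalgebra ℂ (Module.End ℂ V) := { W with lie_mem' := fun hA hB => hW.commutator_mem hA hB }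
  have := hW.isSolvable K rfl
  obtain ⟨w, hw⟩ := exists_weights_of_isSolvable (L := K) _ V rfl
  choose w' hw' using fun i => LinearMap.exists_extend (p := W) (w i)
  have key : ∀ i (x : K), w' i x = w i x := fun i x => LinearMap.congr_fun (hw' i) x
  refine ⟨w', fun A hA c => ?_, fun A hA B hB i => ?_⟩
  · have := (hw ⟨A, hA⟩).1 c
    simp only [← key] at this
    exact this
  · have := (hw ⟨A, hA⟩).2 ⟨B, hB⟩ i
    simp only [← key] at this
    exact this

end

theorem IsWeightSystem.isNilpotent_iff {V : Type*} [AddCommGroup V] [Module ℂ V]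
    [FiniteDimensional ℂ V] {W : Submodule ℂ (Module.End ℂ V)}
    {w : Fin (Module.finrank ℂ V) → Module.End ℂ V →ₗ[ℂ] ℂ} (hw : IsWeightSystem W w) {A : Module.End ℂ V}
    (hA : A ∈ W) : IsNilpotent A ↔ ∀ i, w i A = 0 := by
  have heig : ∀ c : ℂ, Module.End.HasEigenvalue A c ↔ ∃ i, c = w i A := by
    intro c
    rw [Module.End.hasEigenvalue_iff_isRoot_charpoly, Polynomial.IsRoot.def,
      LinearMap.eval_charpoly]
    have := hw.det_eq A hA c
    rw [Algebra.algebraMap_eq_smul_one, this, Finset.prod_eq_zero_iff]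
    simp [sub_eq_zero]
  constructor
  · intro hn i
    have := (heig (w i A)).2 ⟨i, rfl⟩
    exact (this.isNilpotent_of_isNilpotent hn).eq_zero
  · intro h
    rw [LinearMap.isNilpotent_iff_charpoly]
    refine Polynomial.funext fun c => ?_
    rw [LinearMap.eval_charpoly, Algebra.algebraMap_eq_smul_one, hw.det_eq A hA c]
    simp [h]

section Intertwining

variable {U W : Type*} [AddCommGroup U] [Module ℂ U] [AddCommGroup W] [Module ℂ W]

theorem aeval_apply_of_intertwining {T : Module.End ℂ U} {S : Module.End ℂ W} {e : U →ₗ[ℂ] W}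
    (h : ∀ u, e (T u) = S (e u)) (p : Polynomial ℂ) (u : U) :
    e (Polynomial.aeval T p u) = Polynomial.aeval S p (e u) := by
  induction p using Polynomial.induction_on' generalizing u with
  | add p q hp hq => simp [hp, hq]
  | monomial n a =>
    have hpow : ∀ u, e ((T ^ n) u) = (S ^ n) (e u) := by
      induction n with
      | zero => simp
      | succ n ih => intro u; rw [pow_succ', pow_succ']; simp [h, ih]
    simp [Polynomial.aeval_monomial, hpow, Algebra.algebraMap_eq_smul_one]

theorem isNilpotent_of_intertwining {ι : Type*} {T : Module.End ℂ U} {S : Module.End ℂ W}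
    (e : ι → U →ₗ[ℂ] W) (he : ∀ u, (∀ i, e i u = 0) → u = 0)
    (h : ∀ i u, e i (T u) = S (e i u)) (hS : IsNilpotent S) : IsNilpotent T := by
  obtain ⟨n, hn⟩ := hS
  refine ⟨n, LinearMap.ext fun u => he _ fun i => ?_⟩
  have := aeval_apply_of_intertwining (h i) (Polynomial.X ^ n) u
  simpa [hn] using this

theorem isSemisimple_of_intertwining [FiniteDimensional ℂ W] {ι : Type*}
    {T : Module.End ℂ U} {S : Module.End ℂ W}
    (e : ι → U →ₗ[ℂ] W) (he : ∀ u, (∀ i, e i u = 0) → u = 0)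
    (h : ∀ i u, e i (T u) = S (e i u)) (hS : S.IsSemisimple) : T.IsSemisimple := by
  refine Module.End.isSemisimple_of_squarefree_aeval_eq_zero hS.minpoly_squarefree
    (LinearMap.ext fun u => he _ fun i => ?_)
  rw [aeval_apply_of_intertwining (h i), minpoly.aeval]
  simp

theorem aeval_apply_of_apply_eq_zero {S : Module.End ℂ W} {v : W} (h : S v = 0)
    (p : Polynomial ℂ) : Polynomial.aeval S p v = p.eval 0 • v := by
  induction p using Polynomial.induction_on' with
  | add p q hp hq => simp [hp, hq, add_smul]
  | monomial n a =>
    rcases n with _ | n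
    · simp [Algebra.algebraMap_eq_smul_one]
    · simp [Polynomial.aeval_monomial, pow_succ, h]

theorem Module.End.IsSemisimple.exists_projection [FiniteDimensional ℂ W] {S : Module.End ℂ W}
    (hS : S.IsSemisimple) :
    ∃ p : Polynomial ℂ, p.eval 0 = 1 ∧ ∀ v, S (Polynomial.aeval S p v) = 0 := by
  obtain ⟨r, hr0, hr⟩ : ∃ r : Polynomial ℂ, r.eval 0 ≠ 0 ∧ minpoly ℂ S ∣ Polynomial.X * r := by
    by_cases h : Polynomial.X ∣ minpoly ℂ S
    · obtain ⟨r, hr⟩ := h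
      refine ⟨r, fun h0 => ?_, hr ▸ dvd_rfl⟩
      have hX : Polynomial.X ∣ r :=
        Polynomial.X_dvd_iff.2 (by rwa [Polynomial.coeff_zero_eq_eval_zero])
      obtain ⟨q, rfl⟩ := hX
      exact Polynomial.not_isUnit_X (hS.minpoly_squarefree Polynomial.X ⟨q, by rw [hr, mul_assoc]⟩)
    · refine ⟨minpoly ℂ S, ?_, Dvd.intro_left _ rfl⟩
      rwa [← Polynomial.coeff_zero_eq_eval_zero, Ne, ← Polynomial.X_dvd_iff]
  refine ⟨Polynomial.C (r.eval 0)⁻¹ * r, by simp [hr0], fun v => ?_⟩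
  obtain ⟨q, hq⟩ := hr
  have h0 : Polynomial.aeval S (Polynomial.X * r) = 0 := by rw [hq]; simp
  have := LinearMap.congr_fun h0 v
  simp only [map_mul, Polynomial.aeval_X, Module.End.mul_apply, LinearMap.zero_apply] at this
  simp [Algebra.algebraMap_eq_smul_one, this]

theorem Module.End.IsSemisimple.apply_eq_zero_of_pow [FiniteDimensional ℂ W]
    {S : Module.End ℂ W} (hS : S.IsSemisimple) (n : ℕ) {v : W} (h : (S ^ n) v = 0) :
    S v = 0 := by
  obtain ⟨p, hp, hSp⟩ := hS.exists_projection
  induction n generalizing v with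
  | zero => simp_all
  | succ n ih =>
    have h1 : S (S v) = 0 := ih (by rwa [pow_succ, Module.End.mul_apply] at h)
    have h2 := aeval_apply_of_apply_eq_zero h1 p
    rw [hp, one_smul] at h2
    rw [← h2, ← aeval_apply_of_intertwining (e := S) (fun _ => rfl)]
    exact hSp v

theorem Module.End.IsSemisimple.apply_eq_zero_of_add [FiniteDimensional ℂ W]
    {S N : Module.End ℂ W} (hS : S.IsSemisimple) (hN : IsNilpotent N) (hc : Commute S N) {v : W}
    (h : S v + N v = 0) : S v = 0 := by
  obtain ⟨n, hn⟩ := hN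
  have hpow : ∀ k, (S ^ k) v = ((-N) ^ k) v := by
    intro k
    induction k with
    | zero => simp
    | succ k ih =>
      rw [pow_succ, Module.End.mul_apply, eq_neg_of_add_eq_zero_left h, map_neg,
        ← Module.End.mul_apply, (hc.pow_left k).eq, Module.End.mul_apply, ih, pow_succ',
        Module.End.mul_apply, LinearMap.neg_apply]
  refine hS.apply_eq_zero_of_pow n ?_
  rw [hpow, neg_pow, hn]
  simp

theorem isNilpotent_sub_of_commute {S T : Module.End ℂ U} (h : Commute S T) (hS : IsNilpotent S)
    (hT : IsNilpotent T) : IsNilpotent (S - T) :=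
  h.isNilpotent_sub hS hT

end Intertwining

section Bilinear

variable {V : Type*} [AddCommGroup V] [Module ℂ V]

/-- The infinitesimal action of an endomorphism on bilinear maps. -/
def bilAct (S : Module.End ℂ V) : Module.End ℂ (V →ₗ[ℂ] V →ₗ[ℂ] V) where
  toFun β := β.compr₂ S - β ∘ₗ S - β.compl₂ S
  map_add' β γ := by ext; simp; abel
  map_smul' a β := by ext; simp [smul_sub]

@[simp] theorem bilAct_apply (S : Module.End ℂ V) (β : V →ₗ[ℂ] V →ₗ[ℂ] V) (x y : V) :
    bilAct S β x y = S (β x y) - β (S x) y - β x (S y) := rfl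

/-- The coboundary of an endomorphism, with respect to a bilinear map. -/
def coboundary (B : V →ₗ[ℂ] V →ₗ[ℂ] V) : Module.End ℂ V →ₗ[ℂ] V →ₗ[ℂ] V →ₗ[ℂ] V where
  toFun f := - bilAct f B
  map_add' f g := by ext; simp; abel
  map_smul' a f := by ext; simp [smul_sub]

theorem coboundary_apply (B : V →ₗ[ℂ] V →ₗ[ℂ] V) (f : Module.End ℂ V) (x y : V) :
    coboundary B f x y = B (f x) y + B x (f y) - f (B x y) := by
  simp only [coboundary, LinearMap.coe_mk, AddHom.coe_mk, LinearMap.neg_apply, bilAct_apply]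
  abel

theorem isSemisimple_mulLeft [FiniteDimensional ℂ V] {S : Module.End ℂ V} (hS : S.IsSemisimple) :
    Module.End.IsSemisimple (LinearMap.mulLeft ℂ S) :=
  isSemisimple_of_intertwining (fun x : V => LinearMap.applyₗ x)
    (fun _ h => LinearMap.ext h) (fun _ _ => rfl) hS

theorem mulRight_aeval (S : Module.End ℂ V) (p : Polynomial ℂ) (A : Module.End ℂ V) :
    Polynomial.aeval (LinearMap.mulRight ℂ S : Module.End ℂ (Module.End ℂ V)) p A
      = A * Polynomial.aeval S p := by
  induction p using Polynomial.induction_on' with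
  | add p q hp hq => simp [hp, hq, mul_add]
  | monomial n a =>
    simp [Polynomial.aeval_monomial, Algebra.algebraMap_eq_smul_one, LinearMap.pow_mulRight]

theorem isSemisimple_mulRight [FiniteDimensional ℂ V] {S : Module.End ℂ V} (hS : S.IsSemisimple) :
    Module.End.IsSemisimple (LinearMap.mulRight ℂ S) := by
  refine Module.End.isSemisimple_of_squarefree_aeval_eq_zero hS.minpoly_squarefree
    (LinearMap.ext fun A => ?_)
  rw [mulRight_aeval, minpoly.aeval]
  simp

theorem isSemisimple_mulLeft_sub_mulRight [FiniteDimensional ℂ V] {S : Module.End ℂ V}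
    (hS : S.IsSemisimple) :
    Module.End.IsSemisimple
      (LinearMap.mulLeft ℂ S - LinearMap.mulRight ℂ S : Module.End ℂ (Module.End ℂ V)) :=
  (isSemisimple_mulLeft hS).sub_of_commute (LinearMap.commute_mulLeft_right ..)
    (isSemisimple_mulRight hS)

theorem bilAct_commute {S T : Module.End ℂ V} (h : Commute S T) :
    Commute (bilAct S) (bilAct T) := by
  have h' : ∀ v, S (T v) = T (S v) := LinearMap.congr_fun h.eq
  ext β x y
  simp only [Module.End.mul_apply, bilAct_apply, map_sub, h']
  abel

/-- Fixing the second argument of a bilinear map. -/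
def flipApply (y : V) : (V →ₗ[ℂ] V →ₗ[ℂ] V) →ₗ[ℂ] Module.End ℂ V where
  toFun β := β.flip y
  map_add' β γ := by ext; simp
  map_smul' a β := by ext; simp

theorem exists_bilAct_decomp (S : Module.End ℂ V) :
    ∃ P Q R : Module.End ℂ (V →ₗ[ℂ] V →ₗ[ℂ] V), bilAct S = P - Q - R ∧ Commute P Q ∧
      Commute (P - Q) R ∧ (∀ β x y, P β x y = S (β x y)) ∧
      (∀ β x y, Q β x y = β (S x) y) ∧ (∀ β x y, R β x y = β x (S y)) := by
  let P : Module.End ℂ (V →ₗ[ℂ] V →ₗ[ℂ] V) :=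
    { toFun := fun β => β.compr₂ S
      map_add' := fun β γ => by ext; simp
      map_smul' := fun a β => by ext; simp }
  let Q : Module.End ℂ (V →ₗ[ℂ] V →ₗ[ℂ] V) :=
    { toFun := fun β => β ∘ₗ S
      map_add' := fun β γ => by ext; simp
      map_smul' := fun a β => by ext; simp }
  let R : Module.End ℂ (V →ₗ[ℂ] V →ₗ[ℂ] V) :=
    { toFun := fun β => β.compl₂ S
      map_add' := fun β γ => by ext; simp
      map_smul' := fun a β => by ext; simp }
  exact ⟨P, Q, R, rfl, rfl, rfl, fun _ _ _ => rfl, fun _ _ _ => rfl, fun _ _ _ => rfl⟩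

theorem isSemisimple_bilAct [FiniteDimensional ℂ V] {S : Module.End ℂ V} (hS : S.IsSemisimple) :
    Module.End.IsSemisimple (bilAct S) := by
  obtain ⟨P, Q, R, h, hPQ, hc, hP, hQ, hR⟩ := exists_bilAct_decomp S
  have sP : P.IsSemisimple := isSemisimple_of_intertwining
    (fun i : V × V => LinearMap.applyₗ i.2 ∘ₗ LinearMap.applyₗ i.1)
    (fun β hβ => LinearMap.ext₂ fun x y => hβ (x, y)) (fun i β => hP β i.1 i.2) hS
  have sQ : Q.IsSemisimple := isSemisimple_of_intertwining
    (S := LinearMap.mulRight ℂ S) (fun y : V => flipApply y)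
    (fun β hβ => LinearMap.ext₂ fun x y => LinearMap.congr_fun (hβ y) x)
    (fun y β => LinearMap.ext fun x => hQ β x y) (isSemisimple_mulRight hS)
  have sR : R.IsSemisimple := isSemisimple_of_intertwining
    (S := LinearMap.mulRight ℂ S) (fun x : V => LinearMap.applyₗ x)
    (fun β hβ => LinearMap.ext fun x => hβ x)
    (fun x β => LinearMap.ext fun y => hR β x y) (isSemisimple_mulRight hS)
  rw [h]
  exact (sP.sub_of_commute hPQ sQ).sub_of_commute hc sR

theorem isNilpotent_bilAct {S : Module.End ℂ V} (hS : IsNilpotent S) :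
    IsNilpotent (bilAct S) := by
  obtain ⟨P, Q, R, h, hPQ, hc, hP, hQ, hR⟩ := exists_bilAct_decomp S
  have hS' : IsNilpotent (LinearMap.mulRight ℂ S : Module.End ℂ (Module.End ℂ V)) := by
    obtain ⟨n, hn⟩ := hS
    exact ⟨n, by rw [LinearMap.pow_mulRight, hn, LinearMap.mulRight_zero_eq_zero]⟩
  have sP : IsNilpotent P := isNilpotent_of_intertwining
    (fun i : V × V => LinearMap.applyₗ i.2 ∘ₗ LinearMap.applyₗ i.1)
    (fun β hβ => LinearMap.ext₂ fun x y => hβ (x, y)) (fun i β => hP β i.1 i.2) hS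
  have sQ : IsNilpotent Q := isNilpotent_of_intertwining
    (S := LinearMap.mulRight ℂ S) (fun y : V => flipApply y)
    (fun β hβ => LinearMap.ext₂ fun x y => LinearMap.congr_fun (hβ y) x)
    (fun y β => LinearMap.ext fun x => hQ β x y) hS'
  have sR : IsNilpotent R := isNilpotent_of_intertwining
    (S := LinearMap.mulRight ℂ S) (fun x : V => LinearMap.applyₗ x)
    (fun β hβ => LinearMap.ext fun x => hβ x)
    (fun x β => LinearMap.ext fun y => hR β x y) hS'
  have hn : IsNilpotent (P - Q) := isNilpotent_sub_of_commute hPQ sP sQ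
  rw [h]
  exact isNilpotent_sub_of_commute hc hn sR

theorem bilAct_eq_zero_of_add [FiniteDimensional ℂ V] {B : V →ₗ[ℂ] V →ₗ[ℂ] V}
    {S N : Module.End ℂ V} (hS : S.IsSemisimple) (hN : IsNilpotent N) (hc : Commute S N)
    (h : bilAct (S + N) B = 0) : bilAct S B = 0 := by
  refine (isSemisimple_bilAct hS).apply_eq_zero_of_add (isNilpotent_bilAct hN)
    (bilAct_commute hc) ?_
  rw [← h]
  ext x y
  simp
  abel

theorem exists_commuting_coboundary [FiniteDimensional ℂ V] {B φ : V →ₗ[ℂ] V →ₗ[ℂ] V}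
    {S f : Module.End ℂ V} {χ : V →ₗ[ℂ] ℂ} (hS : S.IsSemisimple) (hB : bilAct S B = 0)
    (hφ : bilAct S φ = 0) (hχS : ∀ v, χ (S v) = 0) (hf : coboundary B f = φ)
    (hχf : ∀ v, χ (f v) = 0) :
    ∃ F : Module.End ℂ V, coboundary B F = φ ∧ (∀ v, χ (F v) = 0) ∧ S * F = F * S := by
  set T : Module.End ℂ (Module.End ℂ V) := LinearMap.mulLeft ℂ S - LinearMap.mulRight ℂ S
  obtain ⟨p, hp, hTp⟩ := (isSemisimple_mulLeft_sub_mulRight hS).exists_projection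
  refine ⟨Polynomial.aeval T p f, ?_, fun v => ?_, ?_⟩
  · have hB' : ∀ x y, S (B x y) = B (S x) y + B x (S y) := fun x y => by
      have := LinearMap.congr_fun₂ hB x y
      rw [bilAct_apply, sub_sub, LinearMap.zero_apply, LinearMap.zero_apply, sub_eq_zero] at this
      exact this
    rw [aeval_apply_of_intertwining (S := bilAct S), hf, aeval_apply_of_apply_eq_zero hφ, hp,
      one_smul]
    intro u
    ext x y
    simp only [bilAct_apply, coboundary_apply, T, LinearMap.sub_apply, LinearMap.mulLeft_apply,
      LinearMap.mulRight_apply, Module.End.mul_apply, map_sub, map_add, hB']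
    abel
  · let e : Module.End ℂ V →ₗ[ℂ] V →ₗ[ℂ] ℂ :=
      { toFun := fun f => χ ∘ₗ f
        map_add' := fun f g => by ext; simp
        map_smul' := fun a f => by ext; simp }
    let T' : Module.End ℂ (V →ₗ[ℂ] ℂ) :=
      { toFun := fun ψ => - (ψ ∘ₗ S)
        map_add' := fun f g => by ext; simp; ring
        map_smul' := fun a f => by ext; simp }
    have h1 : e (Polynomial.aeval T p f) = 0 := by
      rw [aeval_apply_of_intertwining (S := T')]
      · rw [show e f = 0 from LinearMap.ext hχf, map_zero]
      · intro u
        ext v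
        simp [e, T', T, hχS]
    exact LinearMap.congr_fun h1 v
  · have := hTp f
    rwa [LinearMap.sub_apply, LinearMap.mulLeft_apply, LinearMap.mulRight_apply, sub_eq_zero]
      at this

end Bilinear

section OpenOrbit

open Topology Filter

variable {V : Type*} [NormedAddCommGroup V] [NormedSpace ℂ V]

/-- The transport of a bilinear map by a pair of endomorphisms. -/
noncomputable def transport (g h : V →L[ℂ] V) (ν : V →L[ℂ] V →L[ℂ] V) : V →L[ℂ] V →L[ℂ] V :=
  (ContinuousLinearMap.compL ℂ V V V g) ∘L ((ν ∘L h).flip ∘L h).flip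

@[simp] theorem transport_apply (g h : V →L[ℂ] V) (ν : V →L[ℂ] V →L[ℂ] V) (x y : V) :
    transport g h ν x y = g (ν (h x) (h y)) := rfl

theorem continuous_transport : Continuous fun p : (V →L[ℂ] V) × (V →L[ℂ] V) ×
    (V →L[ℂ] V →L[ℂ] V) => transport p.1 p.2.1 p.2.2 := by
  have hflip : Continuous (ContinuousLinearMap.flip : (V →L[ℂ] V →L[ℂ] V) → _) :=
    (ContinuousLinearMap.flipₗᵢ ℂ V V V).continuous
  refine ((ContinuousLinearMap.compL ℂ V V V).continuous.comp continuous_fst).clm_comp ?_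
  refine hflip.comp ((hflip.comp ?_).clm_comp (by fun_prop))
  fun_prop

/-- The orbit of a bilinear map, with the action of the group of invertible endomorphisms. -/
def OrbitSpace (μ : V →L[ℂ] V →L[ℂ] V) : Type _ := transportOrbit μ

instance (μ : V →L[ℂ] V →L[ℂ] V) : TopologicalSpace (OrbitSpace μ) :=
  inferInstanceAs (TopologicalSpace (transportOrbit μ))

/-- The bracket as a point of its orbit. -/
def OrbitSpace.base (μ : V →L[ℂ] V →L[ℂ] V) : OrbitSpace μ :=
  ⟨μ, ContinuousLinearEquiv.refl ℂ V, fun _ _ => rfl⟩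

theorem mem_transportOrbit_iff {μ ν : V →L[ℂ] V →L[ℂ] V} :
    ν ∈ transportOrbit μ ↔ ∃ g : (V →L[ℂ] V)ˣ, ν = transport g ↑g⁻¹ μ := by
  constructor
  · rintro ⟨f, hf⟩
    refine ⟨(ContinuousLinearEquiv.unitsEquiv ℂ V).symm f.symm, ?_⟩
    ext x y
    exact hf x y
  · rintro ⟨g, rfl⟩
    exact ⟨ContinuousLinearEquiv.unitsEquiv ℂ V g⁻¹, fun x y => rfl⟩

noncomputable instance (μ : V →L[ℂ] V →L[ℂ] V) : MulAction (V →L[ℂ] V)ˣ (OrbitSpace μ) where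
  smul g ν := ⟨transport g ↑g⁻¹ ν.1, by
    obtain ⟨h, hh⟩ := mem_transportOrbit_iff.1 ν.2
    refine mem_transportOrbit_iff.2 ⟨g * h, ?_⟩
    rw [hh]
    ext x y
    simp⟩
  one_smul ν := Subtype.ext (by ext x y; change transport _ _ _ _ _ = _; simp)
  mul_smul g h ν := Subtype.ext (by
    ext x y
    change transport _ _ _ _ _ = transport _ _ (transport _ _ _) _ _
    simp)

theorem OrbitSpace.coe_smul {μ : V →L[ℂ] V →L[ℂ] V} (g : (V →L[ℂ] V)ˣ) (ν : OrbitSpace μ) :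
    (g • ν).1 = transport g ↑g⁻¹ ν.1 := rfl

instance (μ : V →L[ℂ] V →L[ℂ] V) : ContinuousSMul (V →L[ℂ] V)ˣ (OrbitSpace μ) where
  continuous_smul := by
    have h : Continuous fun p : (V →L[ℂ] V)ˣ × OrbitSpace μ =>
        ((p.1 : V →L[ℂ] V), ((p.1⁻¹ : (V →L[ℂ] V)ˣ) : V →L[ℂ] V), p.2.1) :=
      (Units.continuous_val.comp continuous_fst).prodMk
        ((Units.continuous_val.comp (continuous_inv.comp continuous_fst)).prodMk
          (Continuous.comp (continuous_subtype_val (p := (· ∈ transportOrbit μ)))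
            continuous_snd))
    exact Continuous.subtype_mk (continuous_transport.comp h) _

instance (μ : V →L[ℂ] V →L[ℂ] V) : MulAction.IsPretransitive (V →L[ℂ] V)ˣ (OrbitSpace μ) := by
  refine (MulAction.isPretransitive_iff_base (OrbitSpace.base μ)).2 fun ν => ?_
  obtain ⟨g, hg⟩ := mem_transportOrbit_iff.1 ν.2
  exact ⟨g, Subtype.ext hg.symm⟩

theorem IsLieBracket.transport {μ : V →L[ℂ] V →L[ℂ] V} (hμ : IsLieBracket μ)
    (g : (V →L[ℂ] V)ˣ) : IsLieBracket (transport g ↑g⁻¹ μ) := by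
  have h : ∀ v, (↑g⁻¹ : V →L[ℂ] V) ((g : V →L[ℂ] V) v) = v :=
    DFunLike.congr_fun g.inv_mul
  refine ⟨fun x => by simp [hμ.1 _], fun x y z => ?_⟩
  simp only [transport_apply, h, ← map_add, hμ.2, map_zero]

theorem isClosed_isLieBracket : IsClosed {ν : V →L[ℂ] V →L[ℂ] V | IsLieBracket ν} := by
  simp only [IsLieBracket, IsAltBil, Set.ofPred_and, Set.ofPred_forall]
  refine IsClosed.inter (isClosed_iInter fun x => isClosed_eq (by fun_prop) (by fun_prop)) ?_
  refine isClosed_iInter fun x => isClosed_iInter fun y => isClosed_iInter fun z =>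
    isClosed_eq (by fun_prop) (by fun_prop)

theorem locallyCompactSpace_of_finiteDimensional (W : Type*) [NormedAddCommGroup W]
    [NormedSpace ℂ W] [FiniteDimensional ℂ W] : LocallyCompactSpace W :=
  have := FiniteDimensional.proper ℂ W
  inferInstance

theorem exists_intertwining_of_isOpen_orbit [FiniteDimensional ℂ V] {μ φ : V →L[ℂ] V →L[ℂ] V}
    (hμ : IsLieBracket μ)
    (hrigid : IsOpen {ν : {ν : V →L[ℂ] V →L[ℂ] V // IsLieBracket ν} |
        (ν : V →L[ℂ] V →L[ℂ] V) ∈ transportOrbit μ})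
    (hφ : ∀ t : ℂ, IsLieBracket (μ + t • φ)) {U : Set (V →L[ℂ] V)} (hU : U ∈ 𝓝 1) :
    ∀ᶠ t : ℂ in 𝓝 0, ∃ g : (V →L[ℂ] V)ˣ, ↑g ∈ U ∧
      ∀ x y, (g : V →L[ℂ] V) ((μ + t • φ) x y) = μ ((g : V →L[ℂ] V) x) ((g : V →L[ℂ] V) y) := by
  obtain ⟨O, hO, hOeq⟩ := isOpen_induced_iff.1 hrigid
  have horbit : transportOrbit μ = {ν | IsLieBracket ν} ∩ O := by
    ext ν
    constructor
    · intro h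
      have hν : IsLieBracket ν := by
        obtain ⟨g, rfl⟩ := mem_transportOrbit_iff.1 h
        exact hμ.transport g
      exact ⟨hν, (Set.ext_iff.1 hOeq ⟨ν, hν⟩).2 h⟩
    · rintro ⟨hν, h⟩
      exact (Set.ext_iff.1 hOeq ⟨ν, hν⟩).1 h
  have : LocallyCompactSpace (V →L[ℂ] V →L[ℂ] V) :=
    locallyCompactSpace_of_finiteDimensional (V →L[ℂ] V →L[ℂ] V)
  have : ProperSpace (V →L[ℂ] V) := FiniteDimensional.proper ℂ (V →L[ℂ] V)
  have hlc : LocallyCompactSpace (transportOrbit μ) := by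
    refine IsLocallyClosed.locallyCompactSpace ?_
    rw [horbit]
    exact isClosed_isLieBracket.isLocallyClosed.inter hO.isLocallyClosed
  have : LocallyCompactSpace (OrbitSpace μ) := hlc
  have : T2Space (OrbitSpace μ) := inferInstanceAs (T2Space (transportOrbit μ))
  have : SigmaCompactSpace (V →L[ℂ] V)ᵐᵒᵖ :=
    MulOpposite.opHomeomorph.isClosedEmbedding.sigmaCompactSpace
  have : SigmaCompactSpace (V →L[ℂ] V)ˣ :=
    (Units.isClosedEmbedding_embedProduct (α := V →L[ℂ] V)).sigmaCompactSpace
  have hU' : {g : (V →L[ℂ] V)ˣ | ((g⁻¹ : (V →L[ℂ] V)ˣ) : V →L[ℂ] V) ∈ U} ∈ 𝓝 1 := by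
    refine (Units.continuous_val.comp continuous_inv).continuousAt.preimage_mem_nhds ?_
    simpa using hU
  have hmem := smul_singleton_mem_nhds_of_sigmaCompact hU' (OrbitSpace.base μ)
  obtain ⟨N, hN, hNsub⟩ := mem_nhds_induced _ _ _ |>.1 hmem
  have hcont : Continuous fun t : ℂ => μ + t • φ := by fun_prop
  have h0 : μ + (0 : ℂ) • φ = μ := by ext x y; simp
  filter_upwards [hcont.continuousAt.preimage_mem_nhds (h0.symm ▸ hN),
    hcont.continuousAt.preimage_mem_nhds
      (h0.symm ▸ hO.mem_nhds (horbit.subset (OrbitSpace.base μ).2).2)] with t ht1 ht2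
  have ht3 : μ + t • φ ∈ transportOrbit μ := horbit.symm.subset ⟨hφ t, ht2⟩
  have ht4 := hNsub (show (⟨μ + t • φ, ht3⟩ : OrbitSpace μ) ∈ _ from ht1)
  obtain ⟨g, hg, ν, rfl, hgν⟩ := Set.mem_smul.1 ht4
  refine ⟨g⁻¹, hg, fun x y => ?_⟩
  have h2 : transport g ↑g⁻¹ μ = μ + t • φ := congrArg Subtype.val hgν
  rw [← h2, transport_apply]
  exact DFunLike.congr_fun g.inv_mul _

end OpenOrbit

section Tangent

open Topology Filter

variable {V : Type*} [NormedAddCommGroup V] [NormedSpace ℂ V]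

theorem exp_apply_of_derivation [CompleteSpace V] {μ : V →L[ℂ] V →L[ℂ] V} {d : V →L[ℂ] V}
    (hd : ∀ x y, d (μ x y) = μ (d x) y + μ x (d y)) (x y : V) :
    NormedSpace.exp (-d) (μ (NormedSpace.exp d x) (NormedSpace.exp d y)) = μ x y := by
  have he : ∀ (v : V) (s : ℂ), HasDerivAt (fun s : ℂ => NormedSpace.exp (s • d) v)
      (d (NormedSpace.exp (s • d) v)) s := fun v s =>
    (ContinuousLinearMap.apply ℂ V v).hasFDerivAt.comp_hasDerivAt s
      (hasDerivAt_exp_smul_const' d s)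
  have he' : ∀ s : ℂ, HasDerivAt (fun s : ℂ => NormedSpace.exp (s • -d))
      (NormedSpace.exp (s • -d) * -d) s := fun s => hasDerivAt_exp_smul_const (-d) s
  have hf : ∀ s : ℂ, HasDerivAt (fun s : ℂ => NormedSpace.exp (s • -d)
      (μ (NormedSpace.exp (s • d) x) (NormedSpace.exp (s • d) y))) 0 s := by
    intro s
    have h := (he' s).clm_apply ((μ.hasFDerivAt.comp_hasDerivAt s (he x s)).clm_apply (he y s))
    refine h.congr_deriv ?_
    rw [Function.comp_apply, ← hd]
    simp
  have h := is_const_of_deriv_eq_zero (fun s => (hf s).differentiableAt) (fun s => (hf s).deriv) 1 0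
  simpa using h

/-- The coboundary of an endomorphism, as a continuous linear map. -/
theorem exists_continuous_coboundary [FiniteDimensional ℂ V] (μ : V →L[ℂ] V →L[ℂ] V) :
    ∃ D : (V →L[ℂ] V) →L[ℂ] V →L[ℂ] V →L[ℂ] V,
      ∀ f x y, D f x y = μ (f x) y + μ x (f y) - f (μ x y) := by
  let D : (V →L[ℂ] V) →ₗ[ℂ] V →L[ℂ] V →L[ℂ] V :=
    { toFun := fun f => μ ∘L f + (μ.flip ∘L f).flip - ContinuousLinearMap.compL ℂ V V V f ∘L μ
      map_add' := fun f g => by ext; simp; abel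
      map_smul' := fun a f => by ext; simp [smul_add, smul_sub] }
  exact ⟨LinearMap.toContinuousLinearMap D, fun f x y => rfl⟩

theorem map_nhds_exp_mul {E A : Type*} [NormedAddCommGroup E] [NormedSpace ℂ E] [CompleteSpace E]
    [NormedRing A] [NormedAlgebra ℂ A] [CompleteSpace A] (a b : E →L[ℂ] A)
    (h : Function.Surjective (a + b)) :
    Filter.map (fun p => NormedSpace.exp (a p) * (1 + b p)) (𝓝 0) = 𝓝 1 := by
  have hd : HasStrictFDerivAt (fun p => NormedSpace.exp (a p) * (1 + b p)) (a + b) 0 := by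
    have h0 : HasStrictFDerivAt (NormedSpace.exp : A → A) (1 : A →L[ℂ] A) (a 0) := by
      simpa using hasStrictFDerivAt_exp_zero (𝕂 := ℂ) (𝔸 := A)
    have h1 : HasStrictFDerivAt (fun p => NormedSpace.exp (a p)) ((1 : A →L[ℂ] A) ∘L a) 0 :=
      h0.comp 0 a.hasStrictFDerivAt
    have h2 : HasStrictFDerivAt (fun p => 1 + b p) b 0 := b.hasStrictFDerivAt.const_add 1
    exact (h1.mul' h2).congr_fderiv (by ext p; simp [add_comm])
  rw [hd.map_nhds_eq_of_surj (LinearMap.range_eq_top.2 h)]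
  simp

theorem eventually_exists_exp_mul {A : Type*} [NormedRing A] [NormedAlgebra ℂ A]
    [FiniteDimensional ℂ A] {K C : Submodule ℂ A}
    (h : IsCompl K C) {ε : ℝ} (hε : 0 < ε) : ∀ᶠ g in 𝓝 (1 : A),
      ∃ d ∈ K, ∃ c ∈ C, ‖c‖ < ε ∧ g = NormedSpace.exp d * (1 + c) := by
  have : CompleteSpace A := FiniteDimensional.complete ℂ A
  have : CompleteSpace K := FiniteDimensional.complete ℂ K
  have : CompleteSpace C := FiniteDimensional.complete ℂ C
  have hmap := map_nhds_exp_mul (K.subtypeL ∘L ContinuousLinearMap.fst ℂ K C)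
    (C.subtypeL ∘L ContinuousLinearMap.snd ℂ K C) (fun f => by
      obtain ⟨d, hd, c, hc, rfl⟩ :=
        Submodule.mem_sup.1 (h.sup_eq_top.symm ▸ Submodule.mem_top (x := f))
      exact ⟨(⟨d, hd⟩, ⟨c, hc⟩), rfl⟩)
  rw [← hmap, eventually_map]
  have hc : ∀ᶠ p : K × C in 𝓝 0, ‖p.2‖ < ε := by
    have : Continuous fun p : K × C => ‖p.2‖ := by fun_prop
    exact this.continuousAt.eventually_lt continuousAt_const (by simpa using hε)
  filter_upwards [hc] with p hp
  exact ⟨p.1, p.1.2, p.2, p.2.2, hp, rfl⟩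

theorem exists_isCompl_norm_le {E F : Type*} [NormedAddCommGroup E] [NormedSpace ℂ E]
    [NormedAddCommGroup F] [NormedSpace ℂ F] [FiniteDimensional ℂ E] (D : E →L[ℂ] F) :
    ∃ K C : Submodule ℂ E, IsCompl K C ∧ (∀ d ∈ K, D d = 0) ∧
      ∃ k : ℝ, 0 < k ∧ ∀ c ∈ C, ‖c‖ ≤ k * ‖D c‖ := by
  obtain ⟨C, hC⟩ := Submodule.exists_isCompl (LinearMap.ker (D : E →ₗ[ℂ] F))
  have hker : LinearMap.ker ((D : E →ₗ[ℂ] F) ∘ₗ C.subtype) = ⊥ := by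
    rw [LinearMap.ker_eq_bot']
    intro c hc
    have : (c : E) ∈ (⊥ : Submodule ℂ E) := hC.inf_eq_bot ▸ Submodule.mem_inf.2 ⟨hc, c.2⟩
    simpa using this
  obtain ⟨k, hk0, hk⟩ := LinearMap.exists_antilipschitzWith _ hker
  refine ⟨_, C, hC, fun d hd => LinearMap.mem_ker.1 hd, k, hk0, fun c hc => ?_⟩
  have := hk.le_mul_dist ⟨c, hc⟩ 0
  simpa using this

/-- A curve of approximate solutions of a linear equation, in a complement of the kernel, gives an
exact solution. -/
theorem exists_isCompl_exists_apply_eq {E F : Type*} [NormedAddCommGroup E] [NormedSpace ℂ E]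
    [NormedAddCommGroup F] [NormedSpace ℂ F] [FiniteDimensional ℂ E] [FiniteDimensional ℂ F]
    (D : E →L[ℂ] F) (S : Submodule ℂ E) (φ : F) {a b r : ℝ} (ha : 0 ≤ a) (hb : 0 ≤ b)
    (hr : 0 < r) :
    ∃ K C : Submodule ℂ E, IsCompl K C ∧ (∀ d ∈ K, D d = 0) ∧ ∃ ε, 0 < ε ∧ ε ≤ r ∧
      ((∀ᶠ t : ℂ in 𝓝 0, ∃ c ∈ C, c ∈ S ∧ ‖c‖ < ε ∧
        ‖D c - t • φ‖ ≤ ‖t‖ * ‖c‖ * a + b * ‖c‖ ^ 2) → ∃ f ∈ S, D f = φ) := by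
  obtain ⟨K, C, hC, hKD, k, hk0, hk⟩ := exists_isCompl_norm_le D
  have hpos : 0 < 2 * (k * b + 1) := by positivity
  refine ⟨K, C, hC, hKD, min r (min 1 (1 / (2 * (k * b + 1)))), by positivity, min_le_left _ _,
    fun hev => ?_⟩
  set ε := min r (min 1 (1 / (2 * (k * b + 1))))
  have hε1 : ε ≤ 1 := (min_le_right _ _).trans (min_le_left _ _)
  have hεk : k * b * ε ≤ 1 / 2 := by
    have h1 : ε ≤ 1 / (2 * (k * b + 1)) := (min_le_right _ _).trans (min_le_right _ _)
    have h2 : 0 ≤ k * b := by positivity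
    calc _ ≤ k * b * (1 / (2 * (k * b + 1))) := by gcongr
      _ ≤ 1 / 2 := by
        rw [mul_one_div, div_le_div_iff₀ hpos two_pos]
        linarith
  suffices hmem : φ ∈ S.map (D : E →ₗ[ℂ] F) by
    obtain ⟨f, hf, hfφ⟩ := hmem
    exact ⟨f, hf, hfφ⟩
  set M := 2 * k * (‖φ‖ + a)
  have hM : 0 ≤ M := by positivity
  have key : ∀ᶠ t : ℂ in 𝓝[≠] 0, ∃ f ∈ S, ‖D f - φ‖ ≤ (M * a + b * M ^ 2) * ‖t‖ := by
    filter_upwards [eventually_nhdsWithin_of_eventually_nhds hev, self_mem_nhdsWithin]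
      with t ht1 ht0
    obtain ⟨c, hc, hcS, hcε, hbound⟩ := ht1
    have ht : 0 < ‖t‖ := norm_pos_iff.2 ht0
    have hnc : ‖c‖ ≤ M * ‖t‖ := by
      have h1 : ‖D c‖ ≤ ‖t‖ * ‖φ‖ + (‖t‖ * ‖c‖ * a + b * ‖c‖ ^ 2) := by
        calc ‖D c‖ = ‖t • φ + (D c - t • φ)‖ := by rw [add_sub_cancel]
          _ ≤ ‖t • φ‖ + ‖D c - t • φ‖ := norm_add_le _ _
          _ ≤ _ := by rw [norm_smul]; gcongr
      have h2 := hk c hc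
      have h3 : ‖t‖ * ‖c‖ * a ≤ ‖t‖ * 1 * a := by
        gcongr
        exact hcε.le.trans hε1
      have h4 : k * b * ‖c‖ ≤ 1 / 2 := by
        refine le_trans ?_ hεk
        gcongr
      have h5 : ‖c‖ ≤ k * (‖t‖ * ‖φ‖ + (‖t‖ * 1 * a + b * ‖c‖ ^ 2)) :=
        h2.trans (by gcongr; exact h1.trans (by gcongr))
      have h6 := mul_le_mul_of_nonneg_right h4 (norm_nonneg c)
      have h7 : k * (‖t‖ * ‖φ‖ + (‖t‖ * 1 * a + b * ‖c‖ ^ 2)) =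
          M * ‖t‖ / 2 + k * b * ‖c‖ * ‖c‖ := by simp only [M]; ring
      linarith
    refine ⟨t⁻¹ • c, S.smul_mem _ hcS, ?_⟩
    have e : D (t⁻¹ • c) - φ = t⁻¹ • (D c - t • φ) := by
      rw [map_smul, smul_sub, inv_smul_smul₀ ht0]
    rw [e, norm_smul, norm_inv, inv_mul_le_iff₀ ht]
    calc _ ≤ ‖t‖ * ‖c‖ * a + b * ‖c‖ ^ 2 := hbound
      _ ≤ ‖t‖ * (M * ‖t‖) * a + b * (M * ‖t‖) ^ 2 := by gcongr
      _ = _ := by ring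
  have hclosed : IsClosed (S.map (D : E →ₗ[ℂ] F) : Set F) :=
    Submodule.closed_of_finiteDimensional _
  rw [← SetLike.mem_coe, ← hclosed.closure_eq, Metric.mem_closure_iff]
  intro η hη
  have hlim : ∀ᶠ t : ℂ in 𝓝[≠] 0, (M * a + b * M ^ 2) * ‖t‖ < η := by
    refine eventually_nhdsWithin_of_eventually_nhds ?_
    have hcont : Continuous fun t : ℂ => (M * a + b * M ^ 2) * ‖t‖ := by fun_prop
    exact hcont.continuousAt.eventually_lt continuousAt_const (by simpa using hη)
  obtain ⟨t, ⟨f, hf, hft⟩, ht⟩ := (key.and hlim).exists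
  refine ⟨D f, ⟨f, hf, rfl⟩, ?_⟩
  rw [dist_comm, dist_eq_norm]
  exact hft.trans_lt ht

theorem exp_neg_mul_exp {A : Type*} [NormedRing A] [NormedAlgebra ℂ A] [CompleteSpace A] (d : A) :
    NormedSpace.exp (-d) * NormedSpace.exp d = 1 := by
  have := NormedAlgebra.restrictScalars ℚ ℂ A
  rw [← NormedSpace.exp_add_of_commute (Commute.neg_left (Commute.refl d))]
  simp

theorem exists_coboundary_eq_of_intertwining [FiniteDimensional ℂ V]
    {μ φ : V →L[ℂ] V →L[ℂ] V} (S : Submodule ℂ (V →L[ℂ] V))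
    (hex : ∀ U ∈ 𝓝 (1 : V →L[ℂ] V), ∀ᶠ t : ℂ in 𝓝 0, ∃ g ∈ U,
      ∀ x y, g ((μ + t • φ) x y) = μ (g x) (g y))
    {U : Set (V →L[ℂ] V)} (hU : U ∈ 𝓝 (1 : V →L[ℂ] V))
    (hS : ∀ᶠ t : ℂ in 𝓝 0, ∀ g ∈ U, (∀ x y, g ((μ + t • φ) x y) = μ (g x) (g y)) → g - 1 ∈ S) :
    ∃ f ∈ S, ∀ x y, μ (f x) y + μ x (f y) - f (μ x y) = φ x y := by
  have : CompleteSpace V := FiniteDimensional.complete ℂ V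
  obtain ⟨D, hD⟩ := exists_continuous_coboundary μ
  obtain ⟨r, hr, hrU⟩ := Metric.mem_nhds_iff.1 hU
  obtain ⟨K, C, hC, hKD, ε, hε0, hεr, h⟩ := exists_isCompl_exists_apply_eq
    (E := V →L[ℂ] V) (F := V →L[ℂ] V →L[ℂ] V) D S φ (norm_nonneg φ) (norm_nonneg μ) hr
  suffices hmem : ∃ f ∈ S, D f = φ by
    obtain ⟨f, hf, hfφ⟩ := hmem
    exact ⟨f, hf, fun x y => by rw [← hD, ← hfφ]⟩
  refine h ?_
  filter_upwards [hex _ (eventually_exists_exp_mul hC hε0), hS] with t ht1 ht2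
  obtain ⟨g, ⟨d, hd, c, hc, hcε, rfl⟩, hg⟩ := ht1
  have hder : ∀ x y, d (μ x y) = μ (d x) y + μ x (d y) := fun x y => by
    have h' : D d x y = 0 := DFunLike.congr_fun (DFunLike.congr_fun (hKD d hd) x) y
    rw [hD, sub_eq_zero] at h'
    exact h'.symm
  have hc' : ∀ x y, (1 + c) ((μ + t • φ) x y) = μ ((1 + c) x) ((1 + c) y) := by
    intro x y
    rw [← exp_apply_of_derivation hder]
    refine Eq.trans ?_ (congrArg (fun v => NormedSpace.exp (-d) v) (hg x y))
    exact (DFunLike.congr_fun (exp_neg_mul_exp d) _).symm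
  have hcU : 1 + c ∈ U := hrU (by simpa [dist_eq_norm] using hcε.trans_le hεr)
  refine ⟨c, hc, by simpa using ht2 (1 + c) hcU hc', hcε, ?_⟩
  have hDc : ∀ x y, (D c - t • φ) x y = t • c (φ x y) - μ (c x) (c y) := by
    intro x y
    have h : μ x y + t • φ x y + c (μ x y + t • φ x y) = μ (x + c x) (y + c y) := hc' x y
    simp only [map_add, map_smul, add_apply] at h
    change D c x y - t • φ x y = _
    rw [hD]
    rw [← sub_eq_zero] at h ⊢
    rw [← neg_eq_zero, ← h]
    abel
  refine ContinuousLinearMap.opNorm_le_bound₂ _ (by positivity) fun x y => ?_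
  rw [hDc]
  refine (norm_sub_le _ _).trans ?_
  have e1 : ‖t • c (φ x y)‖ ≤ ‖t‖ * (‖c‖ * (‖φ‖ * ‖x‖ * ‖y‖)) := by
    rw [norm_smul]
    gcongr
    exact (c.le_opNorm _).trans (by gcongr; exact φ.le_opNorm₂ x y)
  have e2 : ‖μ (c x) (c y)‖ ≤ ‖μ‖ * (‖c‖ * ‖x‖) * (‖c‖ * ‖y‖) :=
    (μ.le_opNorm₂ _ _).trans (by gcongr <;> exact c.le_opNorm _)
  calc _ ≤ _ := add_le_add e1 e2
    _ = _ := by ring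

end Tangent

section SolvableSpaces

variable {V : Type*} [AddCommGroup V] [Module ℂ V]

/-- The rank one endomorphisms `v ⊗ χ` with `χ v = 0`. -/
def nilRankOne (χ : V →ₗ[ℂ] ℂ) : Submodule ℂ (Module.End ℂ V) :=
  (LinearMap.ker χ).map (LinearMap.smulRightₗ χ)

theorem smulRight_mem_nilRankOne {χ : V →ₗ[ℂ] ℂ} {v : V} (hv : χ v = 0) :
    χ.smulRight v ∈ nilRankOne χ :=
  ⟨v, hv, rfl⟩

theorem commutator_mem_sup_nilRankOne {χ : V →ₗ[ℂ] ℂ} {K K' : Submodule ℂ (Module.End ℂ V)}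
    (hχ : ∀ A ∈ K, ∀ v, χ (A v) = 0)
    (h : ∀ A ∈ K, ∀ B ∈ K, A * B - B * A ∈ K' ⊔ nilRankOne χ) :
    ∀ A ∈ K ⊔ nilRankOne χ, ∀ B ∈ K ⊔ nilRankOne χ, A * B - B * A ∈ K' ⊔ nilRankOne χ := by
  intro A hA B hB
  obtain ⟨a, ha, _, ⟨u, hu, rfl⟩, rfl⟩ := Submodule.mem_sup.1 hA
  obtain ⟨b, hb, _, ⟨v, hv, rfl⟩, rfl⟩ := Submodule.mem_sup.1 hB
  have hu' : χ u = 0 := hu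
  have hv' : χ v = 0 := hv
  have : (a + LinearMap.smulRightₗ χ u) * (b + LinearMap.smulRightₗ χ v)
      - (b + LinearMap.smulRightₗ χ v) * (a + LinearMap.smulRightₗ χ u)
      = (a * b - b * a) + (χ.smulRight (a v) - χ.smulRight (b u)) := by
    ext x
    simp [hχ a ha, hχ b hb, hu', hv']
    abel
  rw [this]
  refine add_mem (h a ha b hb) (Submodule.mem_sup_right (sub_mem ?_ ?_))
  · exact smulRight_mem_nilRankOne (hχ a ha v)
  · exact smulRight_mem_nilRankOne (hχ b hb u)

theorem commutator_mem_sup_span_singleton {K K' : Submodule ℂ (Module.End ℂ V)}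
    {N : Module.End ℂ V} (h : ∀ A ∈ K, ∀ B ∈ K, A * B - B * A ∈ K')
    (hN : ∀ A ∈ K, N * A - A * N ∈ K') :
    ∀ A ∈ K ⊔ ℂ ∙ N, ∀ B ∈ K ⊔ ℂ ∙ N, A * B - B * A ∈ K' := by
  intro A hA B hB
  obtain ⟨a, ha, _, hx, rfl⟩ := Submodule.mem_sup.1 hA
  obtain ⟨b, hb, _, hy, rfl⟩ := Submodule.mem_sup.1 hB
  obtain ⟨s, rfl⟩ := Submodule.mem_span_singleton.1 hx
  obtain ⟨t, rfl⟩ := Submodule.mem_span_singleton.1 hy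
  have : (a + s • N) * (b + t • N) - (b + t • N) * (a + s • N)
      = (a * b - b * a) + s • (N * b - b * N) - t • (N * a - a * N) := by
    simp only [add_mul, mul_add, smul_mul_assoc, mul_smul_comm]
    module
  rw [this]
  exact sub_mem (add_mem (h a ha b hb) (K'.smul_mem _ (hN b hb))) (K'.smul_mem _ (hN a ha))

theorem isSolvableSpace_nilRankOne (χ : V →ₗ[ℂ] ℂ) : IsSolvableSpace (nilRankOne χ) := by
  refine .step _ _ bot_le ?_ .bot
  rintro _ ⟨u, hu, rfl⟩ _ ⟨v, hv, rfl⟩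
  have hu' : χ u = 0 := hu
  have hv' : χ v = 0 := hv
  rw [Submodule.mem_bot]
  ext x
  simp [hu', hv']

/-- A solvable Lie bracket on a vector space. -/
structure IsSolvableLie (B : V →ₗ[ℂ] V →ₗ[ℂ] V) : Prop where
  alt : ∀ x, B x x = 0
  leibniz : ∀ x y z, B x (B y z) = B (B x y) z + B y (B x z)
  exists_chain : ∃ D : ℕ → Submodule ℂ V, D 0 = ⊤ ∧ (∃ k, D k = ⊥) ∧
    ∀ k, D (k + 1) ≤ D k ∧ ∀ x ∈ D k, ∀ y ∈ D k, B x y ∈ D (k + 1)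

variable {B : V →ₗ[ℂ] V →ₗ[ℂ] V}

theorem IsSolvableLie.skew (hB : IsSolvableLie B) (x y : V) : B x y = - B y x := by
  have := hB.alt (x + y)
  simp only [map_add, LinearMap.add_apply, hB.alt, zero_add, add_zero] at this
  exact eq_neg_of_add_eq_zero_right this

theorem IsSolvableLie.ad_lie (hB : IsSolvableLie B) (x y : V) :
    B (B x y) = B x * B y - B y * B x := by
  ext z
  simp [hB.leibniz x y z]

theorem IsSolvableLie.isSolvableSpace_sup (hB : IsSolvableLie B) {χ : V →ₗ[ℂ] ℂ}
    (hχ : ∀ x y, χ (B x y) = 0) :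
    IsSolvableSpace (LinearMap.range B ⊔ nilRankOne χ) := by
  obtain ⟨D, h0, ⟨k, hk⟩, hD⟩ := hB.exists_chain
  suffices H : ∀ j ≤ k, IsSolvableSpace ((D j).map B ⊔ nilRankOne χ) by
    have := H 0 (Nat.zero_le _)
    rwa [h0, Submodule.map_top] at this
  intro j hj
  induction hj using Nat.decreasingInduction with
  | self => simpa [hk] using isSolvableSpace_nilRankOne χ
  | of_succ j _ ih =>
    refine .step _ _ (sup_le_sup_right (Submodule.map_mono (hD j).1) _) ?_ ih
    refine commutator_mem_sup_nilRankOne ?_ ?_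
    · rintro _ ⟨x, hx, rfl⟩ v
      exact hχ x v
    · rintro _ ⟨x, hx, rfl⟩ _ ⟨y, hy, rfl⟩
      rw [← hB.ad_lie]
      exact Submodule.mem_sup_left ⟨_, (hD j).2 x hx y hy, rfl⟩

theorem IsSolvableLie.isSolvableSpace_range (hB : IsSolvableLie B) :
    IsSolvableSpace (LinearMap.range B) := by
  have := hB.isSolvableSpace_sup (χ := 0) (by simp)
  rwa [show nilRankOne (0 : V →ₗ[ℂ] ℂ) = ⊥ from (Submodule.eq_bot_iff _).2 (by
    rintro _ ⟨u, -, rfl⟩; ext; simp), sup_bot_eq] at this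

theorem IsSolvableLie.isSolvableSpace_sup_derivation (hB : IsSolvableLie B) {χ : V →ₗ[ℂ] ℂ}
    (hχ : ∀ x y, χ (B x y) = 0) {N : Module.End ℂ V} (hχN : ∀ x, χ (N x) = 0)
    (hN : ∀ x, N * B x - B x * N = B (N x)) :
    IsSolvableSpace (LinearMap.range B ⊔ ℂ ∙ N ⊔ nilRankOne χ) := by
  refine .step _ _ (sup_le_sup_right le_sup_left _) ?_ (hB.isSolvableSpace_sup hχ)
  refine commutator_mem_sup_nilRankOne ?_ (commutator_mem_sup_span_singleton ?_ ?_)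
  · intro A hA v
    obtain ⟨_, ⟨x, rfl⟩, _, hs, rfl⟩ := Submodule.mem_sup.1 hA
    obtain ⟨s, rfl⟩ := Submodule.mem_span_singleton.1 hs
    simp [hχ, hχN]
  · rintro _ ⟨x, rfl⟩ _ ⟨y, rfl⟩
    rw [← hB.ad_lie]
    exact Submodule.mem_sup_left ⟨_, rfl⟩
  · rintro _ ⟨x, rfl⟩
    rw [hN]
    exact Submodule.mem_sup_left ⟨_, rfl⟩

theorem IsSolvableLie.isSolvableSpace_sup_twistedDerivation (hB : IsSolvableLie B)
    {χ : V →ₗ[ℂ] ℂ} (hχ : ∀ x y, χ (B x y) = 0) {N F : Module.End ℂ V}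
    (hχN : ∀ x, χ (N x) = 0) (hχF : ∀ x, χ (F x) = 0)
    (hN : ∀ x, N * B x - B x * N = B (N x))
    (hF : ∀ x, F * B x - B x * F = B (F x) - χ x • N + χ.smulRight (N x))
    (hFN : F * N - N * F ∈ LinearMap.range B ⊔ ℂ ∙ N) :
    IsSolvableSpace (LinearMap.range B ⊔ ℂ ∙ N ⊔ ℂ ∙ F ⊔ nilRankOne χ) := by
  refine .step _ _ (sup_le_sup_right le_sup_left _) ?_
    (hB.isSolvableSpace_sup_derivation hχ hχN hN)
  refine commutator_mem_sup_nilRankOne ?_ (commutator_mem_sup_span_singleton ?_ ?_)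
  · intro A hA v
    obtain ⟨_, hA', _, hs, rfl⟩ := Submodule.mem_sup.1 hA
    obtain ⟨_, ⟨x, rfl⟩, _, hr, rfl⟩ := Submodule.mem_sup.1 hA'
    obtain ⟨s, rfl⟩ := Submodule.mem_span_singleton.1 hs
    obtain ⟨r, rfl⟩ := Submodule.mem_span_singleton.1 hr
    simp [hχ, hχN, hχF]
  · intro A hA A' hA'
    exact (hB.isSolvableSpace_sup_derivation hχ hχN hN).commutator_mem
      (Submodule.mem_sup_left hA) (Submodule.mem_sup_left hA')
  · intro A hA
    obtain ⟨_, ⟨x, rfl⟩, _, hr, rfl⟩ := Submodule.mem_sup.1 hA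
    obtain ⟨r, rfl⟩ := Submodule.mem_span_singleton.1 hr
    have : F * (B x + r • N) - (B x + r • N) * F
        = (B (F x) - χ x • N) + r • (F * N - N * F) + χ.smulRight (N x) := by
      rw [add_right_comm, ← hF x, mul_add, add_mul, mul_smul_comm, smul_mul_assoc, smul_sub]
      abel
    rw [this]
    refine add_mem (Submodule.mem_sup_left (add_mem (sub_mem ?_ ?_) (Submodule.smul_mem _ _ hFN)))
      (Submodule.mem_sup_right (smulRight_mem_nilRankOne (hχN x)))
    · exact Submodule.mem_sup_left ⟨_, rfl⟩
    · exact Submodule.mem_sup_right (Submodule.smul_mem _ _ (Submodule.mem_span_singleton_self N))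

end SolvableSpaces

section Weights

variable {V : Type*} [AddCommGroup V] [Module ℂ V]

theorem exists_eq_of_prod_sub_eq {ι : Type*} [Fintype ι] {a b : ι → V →ₗ[ℂ] ℂ}
    (h : ∀ (c : ℂ) (y : V), ∏ i, (c - a i y) = ∏ i, (c - b i y)) (i : ι) : ∃ j, a i = b j := by
  by_contra! hne
  refine Subspace.biUnion_ne_univ_of_top_notMem
    (s := Finset.univ.image fun j => LinearMap.ker (a i - b j)) ?_ ?_
  · simp only [Finset.mem_image, Finset.mem_univ, true_and, not_exists, LinearMap.ker_eq_top,
      sub_eq_zero]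
    exact hne
  · refine Set.eq_univ_of_forall fun y => ?_
    have h0 : ∏ j, (a i y - b j y) = 0 := by
      rw [← h]
      exact Finset.prod_eq_zero (Finset.mem_univ i) (sub_self _)
    obtain ⟨j, -, hj⟩ := Finset.prod_eq_zero_iff.1 h0
    simp only [Finset.mem_image, Finset.mem_univ, true_and, Set.iUnion_exists,
      Set.iUnion_iUnion_eq', Set.mem_iUnion, SetLike.mem_coe, LinearMap.mem_ker]
    exact ⟨j, hj⟩

theorem det_sub_eq_of_intertwining {g A A' : Module.End ℂ V} (hg : IsUnit g)
    (h : g * A = A' * g) (c : ℂ) :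
    LinearMap.det (c • (1 : Module.End ℂ V) - A) = LinearMap.det (c • (1 : Module.End ℂ V) - A') := by
  have h1 : g * (c • (1 : Module.End ℂ V) - A) = (c • (1 : Module.End ℂ V) - A') * g := by
    simp [mul_sub, sub_mul, h]
  have h2 := congrArg LinearMap.det h1
  rw [map_mul, map_mul, mul_comm] at h2
  exact (hg.map LinearMap.det).mul_right_cancel h2

theorem IsWeightSystem.exists_eq_of_intertwining [FiniteDimensional ℂ V]
    {M : Submodule ℂ (Module.End ℂ V)}
    {w : Fin (Module.finrank ℂ V) → Module.End ℂ V →ₗ[ℂ] ℂ} (hw : IsWeightSystem M w)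
    {B : V →ₗ[ℂ] V →ₗ[ℂ] V} {F : Module.End ℂ V} {χ : V →ₗ[ℂ] ℂ} (hχF : ∀ x, χ (F x) = 0)
    (hB : LinearMap.range B ≤ M) (hF : F ∈ M) (hR : nilRankOne χ ≤ M)
    {g : Module.End ℂ V} (hg : IsUnit g) {t : ℂ}
    (h : ∀ x y, g (B x y + t • (χ x • F y - χ y • F x)) = B (g x) (g y)) (i) :
    ∃ j, w i ∘ₗ B + (t * w i F) • χ = w j ∘ₗ B ∘ₗ g := by
  refine exists_eq_of_prod_sub_eq (a := fun i => w i ∘ₗ B + (t * w i F) • χ)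
    (b := fun j => w j ∘ₗ B ∘ₗ g) (fun c y => ?_) i
  have hRy : χ.smulRight (F y) ∈ M := hR (smulRight_mem_nilRankOne (hχF y))
  have hA : B y + t • (χ y • F - χ.smulRight (F y)) ∈ M :=
    add_mem (hB ⟨y, rfl⟩) (M.smul_mem _ (sub_mem (M.smul_mem _ hF) hRy))
  have hw0 : ∀ i, w i (χ.smulRight (F y)) = 0 := by
    refine (hw.isNilpotent_iff hRy).1 ⟨2, ?_⟩
    ext x
    simp [pow_two, hχF]
  have := det_sub_eq_of_intertwining hg (A := B y + t • (χ y • F - χ.smulRight (F y)))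
    (A' := B (g y)) (LinearMap.ext fun x => by simpa using h y x) c
  rw [hw.det_eq _ hA, hw.det_eq _ (hB ⟨_, rfl⟩)] at this
  simpa [hw0, mul_assoc, mul_comm, mul_left_comm] using this

end Weights

section Deformation

open Topology Filter

variable {V : Type*} [NormedAddCommGroup V] [NormedSpace ℂ V]

/-- The adjoint representation of a continuous bilinear bracket, as a linear map. -/
noncomputable def adLinear (μ : V →L[ℂ] V →L[ℂ] V) : V →ₗ[ℂ] V →ₗ[ℂ] V :=
  ContinuousLinearMap.coeLM ℂ ∘ₗ (μ : V →ₗ[ℂ] V →L[ℂ] V)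

@[simp] theorem adLinear_apply (μ : V →L[ℂ] V →L[ℂ] V) (x y : V) : adLinear μ x y = μ x y := rfl

variable [FiniteDimensional ℂ V]

theorem eventually_separated {ι : Type*} [Finite ι] (a : ι → V →ₗ[ℂ] ℂ) (b : ι → V →ₗ[ℂ] ℂ) :
    ∀ᶠ p : ℂ × (V →L[ℂ] V) in 𝓝 (0, 1), ∀ i j, a i ≠ a j →
      a i + p.1 • b i ≠ a j ∘ₗ (p.2 : V →ₗ[ℂ] V) := by
  simp only [eventually_all]
  intro i j hij
  obtain ⟨y, hy⟩ : ∃ y, a i y ≠ a j y := by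
    by_contra! h
    exact hij (LinearMap.ext h)
  have hc : Continuous (a j) := (a j).continuous_of_finiteDimensional
  have : Continuous fun p : ℂ × (V →L[ℂ] V) => a i y + p.1 * b i y - a j (p.2 y) := by
    fun_prop
  have h0 := this.continuousAt (x := (0, 1)) |>.eventually_ne (y := 0) (by simpa [sub_eq_zero])
  filter_upwards [h0] with p hp h
  exact hp (sub_eq_zero.2 (LinearMap.congr_fun h y))

theorem IsWeightSystem.exists_nhds_apply_eq {M : Submodule ℂ (Module.End ℂ V)}
    {w : Fin (Module.finrank ℂ V) → Module.End ℂ V →ₗ[ℂ] ℂ} (hw : IsWeightSystem M w)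
    {μ φ : V →L[ℂ] V →L[ℂ] V} {F : Module.End ℂ V} {χ : V →ₗ[ℂ] ℂ} (hχF : ∀ x, χ (F x) = 0)
    (hφ : ∀ x y, φ x y = χ x • F y - χ y • F x)
    (hB : LinearMap.range (adLinear μ) ≤ M) (hF : F ∈ M) (hR : nilRankOne χ ≤ M) :
    ∃ U ∈ 𝓝 (1 : V →L[ℂ] V), ∀ᶠ t : ℂ in 𝓝 0, ∀ g ∈ U,
      (∀ x y, g ((μ + t • φ) x y) = μ (g x) (g y)) →
      ∀ i y, w i (adLinear μ (g y)) = w i (adLinear μ y) + t * w i F * χ y := by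
  have : CompleteSpace V := FiniteDimensional.complete ℂ V
  have h0 := eventually_separated (fun i => w i ∘ₗ adLinear μ) (fun i => w i F • χ)
  rw [nhds_prod_eq, eventually_prod_iff] at h0
  obtain ⟨P, hP, Q, hQ, hPQ⟩ := h0
  refine ⟨{g | Q g} ∩ {g | IsUnit g}, inter_mem hQ (Units.isOpen.mem_nhds isUnit_one), ?_⟩
  filter_upwards [hP] with t ht g ⟨hgQ, hgU⟩ hg i y
  have hgU' : IsUnit (g : V →ₗ[ℂ] V) := hgU.map (ContinuousLinearMap.toLinearMapRingHom)
  obtain ⟨j, hj⟩ := hw.exists_eq_of_intertwining hχF hB hF hR hgU' (t := t) (fun x y => by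
    have := hg x y
    simp only [add_apply, smul_apply, hφ] at this
    exact this) i
  have hij : w i ∘ₗ adLinear μ = w j ∘ₗ adLinear μ := by
    by_contra hne
    refine hPQ ht hgQ i j hne ?_
    rw [smul_smul]
    exact hj
  have h1 := LinearMap.congr_fun hj y
  have h2 := LinearMap.congr_fun hij (g y)
  simp only [LinearMap.add_apply, LinearMap.comp_apply, LinearMap.smul_apply, smul_eq_mul,
    ContinuousLinearMap.coe_coe] at h1 h2
  rw [h2, ← h1]

end Deformation

section InnerSemisimple

variable {V : Type*} [AddCommGroup V] [Module ℂ V] {B : V →ₗ[ℂ] V →ₗ[ℂ] V}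

theorem isNilpotent_mulRight_sub_mulLeft {m : Module.End ℂ V} (hm : IsNilpotent m) :
    IsNilpotent (LinearMap.mulRight ℂ m - LinearMap.mulLeft ℂ m : Module.End ℂ (Module.End ℂ V)) := by
  obtain ⟨n, hn⟩ := hm
  refine isNilpotent_sub_of_commute (LinearMap.commute_mulLeft_right ..).symm ?_ ?_
  · exact ⟨n, by rw [LinearMap.pow_mulRight, hn, LinearMap.mulRight_zero_eq_zero]⟩
  · exact ⟨n, by rw [LinearMap.pow_mulLeft, hn, LinearMap.mulLeft_zero_eq_zero]⟩

theorem exists_apply_eq_on_ker {N m : Module.End ℂ V} {χ : V →ₗ[ℂ] ℂ} {z₁ : V}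
    (hχm : ∀ x, χ (m x) = 0) (hm : IsNilpotent m) (hz₁ : χ z₁ = 0)
    (hN : N = B z₁ + (N * m - m * N))
    (hder : ∀ x y, χ x = 0 → χ y = 0 → m (B x y) = B (m x) y + B x (m y)) :
    ∃ z, χ z = 0 ∧ ∀ y, χ y = 0 → N y = B z y := by
  set R : Module.End ℂ (Module.End ℂ V) := LinearMap.mulRight ℂ m - LinearMap.mulLeft ℂ m with hR
  have hstep : ∀ k : ℕ, ∃ z, χ z = 0 ∧ ∀ y, χ y = 0 → N y = B z y + (R ^ k) N y := by
    intro k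
    induction k with
    | zero => exact ⟨0, by simp, by simp⟩
    | succ k ih =>
      obtain ⟨z, hz, h⟩ := ih
      refine ⟨z₁ - m z, by rw [map_sub, hz₁, hχm, sub_zero], fun y hy => ?_⟩
      have h1 := LinearMap.congr_fun hN y
      simp only [LinearMap.add_apply, LinearMap.sub_apply, Module.End.mul_apply] at h1
      rw [h1, h (m y) (hχm y), h y hy, pow_succ', map_add, hder z y hz hy]
      simp only [hR, map_sub, LinearMap.sub_apply, Module.End.mul_apply, LinearMap.mulRight_apply,
        LinearMap.mulLeft_apply]
      abel
  obtain ⟨k, hk⟩ := isNilpotent_mulRight_sub_mulLeft hm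
  obtain ⟨z, hz, h⟩ := hstep k
  refine ⟨z, hz, fun y hy => ?_⟩
  rw [h y hy, hR, hk]
  simp

theorem IsSolvableLie.exists_ad_eq [FiniteDimensional ℂ V] (hB : IsSolvableLie B)
    (hcenter : ∀ x, B x = 0 → x = 0) {S N : Module.End ℂ V} {χ : V →ₗ[ℂ] ℂ} {x₀ z : V}
    (hX : B x₀ = S + N) (hSN : Commute S N) (hS₀ : S x₀ = 0)
    (hχ₀ : χ x₀ = 1) (hχB : ∀ x y, χ (B x y) = 0)
    (hN : ∀ y, χ y = 0 → N y = B z y) : ∃ u, B u = S := by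
  let Z : Submodule ℂ V :=
    { carrier := {v | χ v = 0 ∧ ∀ y, χ y = 0 → B v y = 0}
      add_mem' := fun {a b} ha hb => ⟨by simp [ha.1, hb.1], fun y hy => by simp [ha.2 y hy, hb.2 y hy]⟩
      zero_mem' := by simp
      smul_mem' := fun c a ha => ⟨by simp [ha.1], fun y hy => by simp [ha.2 y hy]⟩ }
  have hdec : ∀ A A' : Module.End ℂ V, A x₀ = A' x₀ → (∀ y, χ y = 0 → A y = A' y) → A = A' := by
    intro A A' h0 h
    ext y
    have h1 := h (y - χ y • x₀) (by simp [hχ₀])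
    rw [map_sub, map_sub, map_smul, map_smul, h0] at h1
    exact sub_left_inj.1 h1
  have hZ : ∀ v ∈ Z, B x₀ v ∈ Z := by
    refine fun v hv => ⟨hχB _ _, fun y hy => ?_⟩
    have := hB.leibniz x₀ v y
    rw [hv.2 y hy, hv.2 _ (hχB _ _), map_zero, add_zero] at this
    exact this.symm
  have hinj : Function.Injective ((B x₀).restrict hZ) := by
    rw [← LinearMap.ker_eq_bot, LinearMap.ker_eq_bot']
    rintro ⟨v, hv⟩ h
    have h' : B x₀ v = 0 := congrArg Subtype.val h
    refine Subtype.ext (hcenter v (hdec _ _ ?_ ?_))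
    · rw [hB.skew, h', neg_zero, LinearMap.zero_apply]
    · exact fun y hy => hv.2 y hy
  have hv : B x₀ z ∈ Z := by
    refine ⟨hχB _ _, fun y hy => ?_⟩
    have h1 := hB.leibniz x₀ z y
    have hc : B x₀ (N y) = N (B x₀ y) := by
      have : Commute (B x₀) N := hX ▸ hSN.add_left (Commute.refl N)
      exact LinearMap.congr_fun this.eq y
    rw [← hN y hy, ← hN _ (hχB _ _), hc] at h1
    exact left_eq_add.1 (h1.trans (add_comm _ _))
  obtain ⟨⟨z', hz'⟩, h⟩ := LinearMap.injective_iff_surjective.1 hinj ⟨_, hv⟩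
  have h' : B x₀ z' = B x₀ z := congrArg Subtype.val h
  refine ⟨x₀ - z + z', hdec _ _ ?_ fun y hy => ?_⟩
  · rw [hS₀, map_add, map_sub, LinearMap.add_apply, LinearMap.sub_apply, hB.alt, hB.skew z,
      hB.skew z', h']
    abel
  · rw [map_add, map_sub, LinearMap.add_apply, LinearMap.sub_apply, hz'.2 y hy, ← hN y hy, hX]
    simp

end InnerSemisimple

section Rigid

open Topology Filter

variable {V : Type*} [NormedAddCommGroup V] [NormedSpace ℂ V]

theorem IsLieBracket.deform {μ φ : V →L[ℂ] V →L[ℂ] V} (hμ : IsLieBracket μ) {χ : V →ₗ[ℂ] ℂ}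
    {F θ : Module.End ℂ V} (hχ : ∀ x y, χ (μ x y) = 0) (hχF : ∀ x, χ (F x) = 0)
    (hφ : ∀ x y, φ x y = χ x • F y - χ y • F x)
    (hF : ∀ x y, coboundary (adLinear μ) F x y = χ x • θ y - χ y • θ x) (t : ℂ) :
    IsLieBracket (μ + t • φ) := by
  have halt : ∀ x, μ x x = 0 := hμ.1
  have hskew : ∀ x y, μ x y = - μ y x := fun x y => by
    have := halt (x + y)
    simp only [map_add, add_apply, halt, zero_add, add_zero] at this
    exact eq_neg_of_add_eq_zero_right this
  have hF' : ∀ x y, F (μ x y) = μ (F x) y - μ (F y) x - χ x • θ y + χ y • θ x := fun x y => by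
    have := hF x y
    rw [coboundary_apply, adLinear_apply, adLinear_apply, adLinear_apply, hskew x (F y)] at this
    linear_combination (norm := module) -this
  refine ⟨fun x => by simp [hφ, hμ.1 x], fun x y z => ?_⟩
  have hJ := hμ.2 x y z
  simp only [add_apply, smul_apply, hφ, map_add, map_sub, map_smul, hF', hχ, hχF,
    smul_add, smul_sub, zero_smul, zero_sub, sub_apply] at hJ ⊢
  linear_combination (norm := module) hJ

theorem exists_wedge [FiniteDimensional ℂ V] (χ : V →ₗ[ℂ] ℂ) (F : Module.End ℂ V) :
    ∃ φ : V →L[ℂ] V →L[ℂ] V, ∀ x y, φ x y = χ x • F y - χ y • F x := by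
  let F' : V →L[ℂ] V := LinearMap.toContinuousLinearMap F
  let χ' : V →L[ℂ] ℂ := LinearMap.toContinuousLinearMap χ
  let ψ : V →L[ℂ] V →L[ℂ] V := χ'.smulRight F'
  exact ⟨ψ - ψ.flip, fun x y => rfl⟩

variable [FiniteDimensional ℂ V] {μ : V →L[ℂ] V →L[ℂ] V}

theorem exists_coboundary_eq_wedge (hμ : IsLieBracket μ) (hB : IsSolvableLie (adLinear μ))
    (hrigid : IsOpen {ν : {ν : V →L[ℂ] V →L[ℂ] V // IsLieBracket ν} |
        (ν : V →L[ℂ] V →L[ℂ] V) ∈ transportOrbit μ})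
    {N : Module.End ℂ V} {χ : V →ₗ[ℂ] ℂ} (hχ : ∀ x, IsNilpotent (adLinear μ x) → χ x = 0)
    (hχB : ∀ x y, χ (adLinear μ x y) = 0) (hNn : IsNilpotent N) (hχN : ∀ x, χ (N x) = 0)
    (hN : coboundary (adLinear μ) N = 0) :
    ∃ f : Module.End ℂ V, (∀ v, χ (f v) = 0) ∧
      ∀ x y, coboundary (adLinear μ) f x y = χ x • N y - χ y • N x := by
  obtain ⟨φ, hφ⟩ := exists_wedge χ N
  have hN' : ∀ x, N * adLinear μ x - adLinear μ x * N = adLinear μ (N x) := fun x => by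
    ext y
    have := LinearMap.congr_fun₂ hN x y
    rw [coboundary_apply, LinearMap.zero_apply, LinearMap.zero_apply, sub_eq_zero] at this
    rw [LinearMap.sub_apply, Module.End.mul_apply, ← this, Module.End.mul_apply, add_sub_cancel_right]
  have hM := hB.isSolvableSpace_sup_derivation hχB hχN hN'
  obtain ⟨w, hw⟩ := hM.exists_isWeightSystem
  have hle : LinearMap.range (adLinear μ) ≤
      LinearMap.range (adLinear μ) ⊔ ℂ ∙ N ⊔ nilRankOne χ := le_sup_left.trans le_sup_left
  have hNM : N ∈ LinearMap.range (adLinear μ) ⊔ ℂ ∙ N ⊔ nilRankOne χ :=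
    Submodule.mem_sup_left (Submodule.mem_sup_right (Submodule.mem_span_singleton_self N))
  obtain ⟨U, hU, hUw⟩ := hw.exists_nhds_apply_eq hχN hφ hle hNM le_sup_right
  have hwN := (hw.isNilpotent_iff hNM).1 hNn
  let T : Submodule ℂ (V →L[ℂ] V) :=
    { carrier := {f | ∀ v i, w i (adLinear μ (f v)) = 0}
      add_mem' := fun {f g} hf hg v i => by simp [hf v i, hg v i]
      zero_mem' := by simp
      smul_mem' := fun c f hf v i => by simp [hf v i] }
  obtain ⟨f, hfT, hf⟩ := exists_coboundary_eq_of_intertwining (μ := μ) (φ := φ) T (fun U hU => by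
      have := exists_intertwining_of_isOpen_orbit hμ hrigid
        (fun t => hμ.deform (θ := 0) hχB hχN hφ (by simp [hN]) t) hU
      filter_upwards [this] with t ⟨g, hg, h⟩
      exact ⟨g, hg, h⟩) hU (by
      filter_upwards [hUw] with t ht g hg h v i
      have := ht g hg h i v
      rw [hwN, mul_zero, zero_mul, add_zero] at this
      simp [this])
  refine ⟨f, fun v => hχ _ ((hw.isNilpotent_iff (hle ⟨_, rfl⟩)).2 (hfT v)), fun x y => ?_⟩
  rw [← hφ, ← hf, coboundary_apply]
  rfl

theorem exists_isNilpotent_sub_ad (hμ : IsLieBracket μ) (hB : IsSolvableLie (adLinear μ))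
    (hrigid : IsOpen {ν : {ν : V →L[ℂ] V →L[ℂ] V // IsLieBracket ν} |
        (ν : V →L[ℂ] V →L[ℂ] V) ∈ transportOrbit μ})
    {N F : Module.End ℂ V} {χ : V →ₗ[ℂ] ℂ} {x₀ : V} (hχ₀ : χ x₀ = 1)
    (hχB : ∀ x y, χ (adLinear μ x y) = 0) (hχN : ∀ x, χ (N x) = 0) (hχF : ∀ x, χ (F x) = 0)
    (hN : coboundary (adLinear μ) N = 0)
    (hF : ∀ x y, coboundary (adLinear μ) F x y = χ x • N y - χ y • N x)
    (hFN : F * N - N * F ∈ LinearMap.range (adLinear μ) ⊔ ℂ ∙ N) :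
    ∃ w, IsNilpotent (F - adLinear μ w) := by
  obtain ⟨φ, hφ⟩ := exists_wedge χ F
  have hN' : ∀ x, N * adLinear μ x - adLinear μ x * N = adLinear μ (N x) := fun x => by
    ext y
    have := LinearMap.congr_fun₂ hN x y
    rw [coboundary_apply, LinearMap.zero_apply, LinearMap.zero_apply, sub_eq_zero] at this
    rw [LinearMap.sub_apply, Module.End.mul_apply, ← this, Module.End.mul_apply, add_sub_cancel_right]
  have hF' : ∀ x, F * adLinear μ x - adLinear μ x * F
      = adLinear μ (F x) - χ x • N + χ.smulRight (N x) := fun x => by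
    ext y
    have := hF x y
    rw [coboundary_apply] at this
    simp only [LinearMap.sub_apply, LinearMap.add_apply, Module.End.mul_apply,
      LinearMap.smul_apply, LinearMap.smulRight_apply]
    linear_combination (norm := module) -this
  have hM := hB.isSolvableSpace_sup_twistedDerivation hχB hχN hχF hN' hF' hFN
  obtain ⟨w, hw⟩ := hM.exists_isWeightSystem
  have hle : LinearMap.range (adLinear μ) ≤
      LinearMap.range (adLinear μ) ⊔ ℂ ∙ N ⊔ ℂ ∙ F ⊔ nilRankOne χ :=
    (le_sup_left.trans le_sup_left).trans le_sup_left
  have hFM : F ∈ LinearMap.range (adLinear μ) ⊔ ℂ ∙ N ⊔ ℂ ∙ F ⊔ nilRankOne χ :=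
    Submodule.mem_sup_left (Submodule.mem_sup_right (Submodule.mem_span_singleton_self F))
  obtain ⟨U, hU, hUw⟩ := hw.exists_nhds_apply_eq hχF hφ hle hFM le_sup_right
  have hA := exists_intertwining_of_isOpen_orbit hμ hrigid
    (fun t => hμ.deform (θ := N) hχB hχF hφ hF t) hU
  have hA' := (hA.and hUw).filter_mono (nhdsWithin_le_nhds (s := {0}ᶜ))
  obtain ⟨t, ⟨⟨g, hg, h⟩, ht⟩, ht0 : t ≠ 0⟩ := (hA'.and self_mem_nhdsWithin).exists
  refine ⟨t⁻¹ • ((g : V →L[ℂ] V) x₀ - x₀),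
    (hw.isNilpotent_iff (sub_mem hFM (hle ⟨_, rfl⟩))).2 fun i => ?_⟩
  have := ht g hg h i x₀
  simp [this, hχ₀, ht0]

end Rigid

section KeyClaim

variable {V : Type*} [NormedAddCommGroup V] [NormedSpace ℂ V] [FiniteDimensional ℂ V]
  {μ : V →L[ℂ] V →L[ℂ] V}

theorem IsSolvableLie.coboundary_ad {V : Type*} [AddCommGroup V] [Module ℂ V]
    {B : V →ₗ[ℂ] V →ₗ[ℂ] V} (hB : IsSolvableLie B) (x : V) : coboundary B (B x) = 0 := by
  ext y z
  rw [coboundary_apply, hB.leibniz x y z]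
  simp

theorem apply_aeval_eq_zero {V : Type*} [AddCommGroup V] [Module ℂ V] {X S : Module.End ℂ V}
    (hS : S ∈ Algebra.adjoin ℂ {X}) {χ : V →ₗ[ℂ] ℂ} (hχX : ∀ v, χ (X v) = 0) {x : V}
    (hx : x ≠ 0) (hX : X x = 0) (hSx : S x = 0) (v : V) : χ (S v) = 0 := by
  rw [Algebra.adjoin_singleton_eq_range_aeval] at hS
  obtain ⟨p, rfl⟩ := hS
  have h0 : p.eval 0 = 0 := by
    have : Polynomial.aeval X p x = 0 := hSx
    rw [aeval_apply_of_apply_eq_zero hX] at this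
    exact (smul_eq_zero.1 this).resolve_right hx
  have h1 := aeval_apply_of_intertwining (T := X) (S := (0 : Module.End ℂ ℂ)) (e := χ) hχX p v
  rw [aeval_apply_of_apply_eq_zero (LinearMap.zero_apply _), h0, zero_smul] at h1
  exact h1

theorem IsSolvableLie.exists_jordan_decomposition {V : Type*} [AddCommGroup V] [Module ℂ V]
    [FiniteDimensional ℂ V] {B : V →ₗ[ℂ] V →ₗ[ℂ] V} (hB : IsSolvableLie B) {χ : V →ₗ[ℂ] ℂ}
    (hχB : ∀ x y, χ (B x y) = 0) {x₀ : V} (hx₀ : x₀ ≠ 0) :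
    ∃ S N : Module.End ℂ V, B x₀ = S + N ∧ Commute S N ∧ S.IsSemisimple ∧ IsNilpotent N ∧
      S ∈ Algebra.adjoin ℂ {B x₀} ∧ S x₀ = 0 ∧ N x₀ = 0 ∧ (∀ v, χ (S v) = 0) ∧
      (∀ v, χ (N v) = 0) ∧ bilAct S B = 0 ∧ coboundary B N = 0 := by
  obtain ⟨N, hNX, S, hSX, hNn, hSs, hXeq⟩ :=
    Module.End.exists_isNilpotent_isSemisimple (f := B x₀)
  have hX : B x₀ = S + N := by rw [hXeq, add_comm]
  have hSX' : Commute (B x₀) S := Algebra.commute_of_mem_adjoin_self hSX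
  have hSN : Commute S N :=
    Algebra.commute_of_mem_adjoin_singleton_of_commute hNX hSX'.symm
  have hX₀ : S x₀ + N x₀ = 0 := by
    rw [← LinearMap.add_apply, ← hX, hB.alt]
  have hS₀ : S x₀ = 0 := hSs.apply_eq_zero_of_add hNn hSN hX₀
  have hN₀ : N x₀ = 0 := by rwa [hS₀, zero_add] at hX₀
  have hbS : bilAct S B = 0 := bilAct_eq_zero_of_add hSs hNn hSN (by
    rw [← hX, ← neg_eq_zero]
    exact hB.coboundary_ad x₀)
  refine ⟨S, N, hX, hSN, hSs, hNn, hSX, hS₀, hN₀,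
    apply_aeval_eq_zero hSX (hχB x₀) hx₀ (hB.alt x₀) hS₀,
    apply_aeval_eq_zero hNX (hχB x₀) hx₀ (hB.alt x₀) hN₀, hbS, ?_⟩
  have := hB.coboundary_ad x₀
  rw [hX, map_add] at this
  have h2 : coboundary B S = 0 := neg_eq_zero.2 hbS
  rwa [h2, zero_add] at this

theorem exists_commuting_coboundary_eq_wedge (hμ : IsLieBracket μ)
    (hB : IsSolvableLie (adLinear μ))
    (hrigid : IsOpen {ν : {ν : V →L[ℂ] V →L[ℂ] V // IsLieBracket ν} |
        (ν : V →L[ℂ] V →L[ℂ] V) ∈ transportOrbit μ})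
    {S N : Module.End ℂ V} {χ : V →ₗ[ℂ] ℂ} (hχ : ∀ x, IsNilpotent (adLinear μ x) → χ x = 0)
    (hχB : ∀ x y, χ (adLinear μ x y) = 0) (hSN : Commute S N) (hSs : S.IsSemisimple)
    (hNn : IsNilpotent N) (hχS : ∀ x, χ (S x) = 0) (hχN : ∀ x, χ (N x) = 0)
    (hbS : bilAct S (adLinear μ) = 0) (hcN : coboundary (adLinear μ) N = 0) :
    ∃ F : Module.End ℂ V, (∀ v, χ (F v) = 0) ∧ S * F = F * S ∧
      ∀ x y, coboundary (adLinear μ) F x y = χ x • N y - χ y • N x := by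
  obtain ⟨f, hχf, hf⟩ := exists_coboundary_eq_wedge hμ hB hrigid hχ hχB hNn hχN hcN
  have hbf : bilAct S (coboundary (adLinear μ) f) = 0 := by
    ext x y
    have hc : ∀ x, S (N x) = N (S x) := LinearMap.congr_fun hSN.eq
    rw [bilAct_apply, hf, hf, hf, map_sub, map_smul, map_smul, hc, hc, hχS, hχS]
    simp
  obtain ⟨F, hF, hχF, hSF⟩ := exists_commuting_coboundary hSs hbS hbf hχS rfl hχf
  exact ⟨F, hχF, hSF, fun x y => by rw [hF, hf]⟩

theorem exists_apply_eq_ad_on_ker (hμ : IsLieBracket μ) (hB : IsSolvableLie (adLinear μ))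
    (hrigid : IsOpen {ν : {ν : V →L[ℂ] V →L[ℂ] V // IsLieBracket ν} |
        (ν : V →L[ℂ] V →L[ℂ] V) ∈ transportOrbit μ})
    {S N F : Module.End ℂ V} {χ : V →ₗ[ℂ] ℂ} {x₀ : V} (hχ₀ : χ x₀ = 1)
    (hχB : ∀ x y, χ (adLinear μ x y) = 0) (hX : adLinear μ x₀ = S + N) (hN₀ : N x₀ = 0)
    (hχN : ∀ x, χ (N x) = 0) (hχF : ∀ x, χ (F x) = 0) (hcN : coboundary (adLinear μ) N = 0)
    (hF : ∀ x y, coboundary (adLinear μ) F x y = χ x • N y - χ y • N x)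
    (hSF : S * F = F * S) :
    ∃ z, ∀ y, χ y = 0 → N y = adLinear μ z y := by
  have hNF : F * N - N * F = adLinear μ (F x₀) - N := by
    ext y
    have h1 := hF x₀ y
    have h2 : S (F y) = F (S y) := LinearMap.congr_fun hSF y
    rw [coboundary_apply, hX, hN₀, hχ₀, LinearMap.add_apply, LinearMap.add_apply, map_add, h2] at h1
    rw [LinearMap.sub_apply, LinearMap.sub_apply, Module.End.mul_apply, Module.End.mul_apply]
    linear_combination (norm := module) -h1
  obtain ⟨v, hv⟩ := exists_isNilpotent_sub_ad hμ hB hrigid hχ₀ hχB hχN hχF hcN hF (by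
    rw [hNF]
    exact sub_mem (Submodule.mem_sup_left ⟨_, rfl⟩)
      (Submodule.mem_sup_right (Submodule.mem_span_singleton_self N)))
  have hNv : N * adLinear μ v - adLinear μ v * N = adLinear μ (N v) := by
    ext y
    have := LinearMap.congr_fun₂ hcN v y
    rw [coboundary_apply, LinearMap.zero_apply, LinearMap.zero_apply] at this
    rw [LinearMap.sub_apply, Module.End.mul_apply, Module.End.mul_apply]
    linear_combination (norm := module) -this
  obtain ⟨z, -, hz⟩ := exists_apply_eq_on_ker (B := adLinear μ) (N := N) (χ := χ) (z₁ := F x₀ + N v)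
    (fun x => by rw [LinearMap.sub_apply, map_sub, hχF, hχB, sub_zero]) hv
    (by rw [map_add, hχF, hχN, add_zero])
    (by
      rw [map_add, ← hNv, mul_sub, sub_mul, ← sub_eq_zero, ← sub_eq_zero.2 hNF]
      abel)
    (fun x y hx hy => by
      have h1 := hF x y
      have h2 := LinearMap.congr_fun₂ (hB.coboundary_ad v) x y
      rw [coboundary_apply, hx, hy, zero_smul, zero_smul, sub_zero] at h1
      rw [coboundary_apply, LinearMap.zero_apply, LinearMap.zero_apply] at h2
      rw [LinearMap.sub_apply, LinearMap.sub_apply, LinearMap.sub_apply, map_sub, map_sub,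
        LinearMap.sub_apply]
      linear_combination (norm := module) h2 - h1)
  exact ⟨z, hz⟩

theorem exists_ad_eq_semisimplePart (hμ : IsLieBracket μ) (hB : IsSolvableLie (adLinear μ))
    (hcenter : ∀ x, adLinear μ x = 0 → x = 0)
    (hrigid : IsOpen {ν : {ν : V →L[ℂ] V →L[ℂ] V // IsLieBracket ν} |
        (ν : V →L[ℂ] V →L[ℂ] V) ∈ transportOrbit μ}) (x₀ : V) :
    ∃ u, Module.End.IsSemisimple (adLinear μ u) ∧
      IsNilpotent (adLinear μ x₀ - adLinear μ u) ∧
      adLinear μ u ∈ Algebra.adjoin ℂ {adLinear μ x₀} := by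
  obtain ⟨w, hw⟩ := hB.isSolvableSpace_range.exists_isWeightSystem
  by_cases hnil : IsNilpotent (adLinear μ x₀)
  · refine ⟨0, ?_, ?_, ?_⟩
    · rw [map_zero]; exact Module.End.isSemisimple_zero
    · rwa [map_zero, sub_zero]
    · rw [map_zero]; exact zero_mem _
  obtain ⟨i, hi⟩ := not_forall.1 ((hw.isNilpotent_iff ⟨x₀, rfl⟩).not.1 hnil)
  obtain ⟨χ, hχ'⟩ : ∃ χ : V →ₗ[ℂ] ℂ, ∀ x, χ x = (w i (adLinear μ x₀))⁻¹ * w i (adLinear μ x) :=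
    ⟨(w i (adLinear μ x₀))⁻¹ • w i ∘ₗ adLinear μ, fun _ => rfl⟩
  have hχ₀ : χ x₀ = 1 := by rw [hχ', inv_mul_cancel₀ hi]
  have hχ : ∀ x, IsNilpotent (adLinear μ x) → χ x = 0 := fun x hx => by
    rw [hχ', (hw.isNilpotent_iff ⟨x, rfl⟩).1 hx i, mul_zero]
  have hχB : ∀ x y, χ (adLinear μ x y) = 0 := fun x y => by
    rw [hχ', hB.ad_lie, hw.lie_eq _ ⟨x, rfl⟩ _ ⟨y, rfl⟩ i, mul_zero]
  have hx₀ : x₀ ≠ 0 := fun h => by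
    rw [h, map_zero] at hχ₀
    exact zero_ne_one hχ₀
  obtain ⟨S, N, hX, hSN, hSs, hNn, hSX, hS₀, hN₀, hχS, hχN, hbS, hcN⟩ :=
    hB.exists_jordan_decomposition hχB hx₀
  obtain ⟨F, hχF, hSF, hF⟩ := exists_commuting_coboundary_eq_wedge hμ hB hrigid hχ hχB hSN hSs hNn
    hχS hχN hbS hcN
  obtain ⟨z, hz⟩ := exists_apply_eq_ad_on_ker hμ hB hrigid hχ₀ hχB hX hN₀ hχN hχF hcN hF hSF
  obtain ⟨u, hu⟩ := hB.exists_ad_eq hcenter hX hSN hS₀ hχ₀ hχB hz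
  refine ⟨u, hu ▸ hSs, ?_, hu ▸ hSX⟩
  rwa [hu, hX, add_sub_cancel_left]

end KeyClaim

section Nilradical

variable {V : Type*} [NormedAddCommGroup V] [NormedSpace ℂ V] {μ : V →L[ℂ] V →L[ℂ] V}

theorem bracketSpan_mono {A A' B B' : Submodule ℂ V} (hA : A ≤ A') (hB : B ≤ B') :
    bracketSpan μ A B ≤ bracketSpan μ A' B' :=
  Submodule.span_mono fun _ ⟨x, hx, y, hy, h⟩ => ⟨x, hA hx, y, hB hy, h⟩

theorem apply_mem_bracketSpan {A B : Submodule ℂ V} {x y : V} (hx : x ∈ A) (hy : y ∈ B) :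
    μ x y ∈ bracketSpan μ A B :=
  Submodule.subset_span ⟨x, hx, y, hy, rfl⟩

theorem derivedSeriesμ_succ_le (k : ℕ) : derivedSeriesμ μ (k + 1) ≤ derivedSeriesμ μ k := by
  induction k with
  | zero => exact le_top
  | succ k ih => exact bracketSpan_mono ih ih

theorem IsLieBracket.isSolvableLie (hμ : IsLieBracket μ) (h : IsSolvableμ μ) :
    IsSolvableLie (adLinear μ) where
  alt := hμ.1
  leibniz x y z := by
    have halt : ∀ x, μ x x = 0 := hμ.1
    have hskew : ∀ x y, μ x y = - μ y x := fun x y => by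
      have := halt (x + y)
      simp only [map_add, add_apply, halt, zero_add, add_zero] at this
      exact eq_neg_of_add_eq_zero_right this
    have := hμ.2 x y z
    simp only [adLinear_apply]
    rw [hskew (μ y z), hskew (μ z x), hskew z x, map_neg, neg_neg] at this
    linear_combination (norm := module) -this
  exists_chain := ⟨derivedSeriesμ μ, rfl, h, fun k =>
    ⟨derivedSeriesμ_succ_le k, fun _ hx _ hy => apply_mem_bracketSpan hx hy⟩⟩

theorem IsNilpotentIdealμ.isNilpotent_ad (hμ : IsSolvableLie (adLinear μ)) {I : Submodule ℂ V}
    (hI : IsNilpotentIdealμ μ I) {x : V} (hx : x ∈ I) : IsNilpotent (adLinear μ x) := by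
  obtain ⟨hideal, k, hk⟩ := hI
  have h : ∀ j v, (adLinear μ x ^ (j + 1)) v ∈ lcsμ μ I j := by
    intro j v
    induction j with
    | zero =>
      rw [zero_add, pow_one, hμ.skew]
      exact I.neg_mem (hideal v x hx)
    | succ j ih =>
      rw [pow_succ', Module.End.mul_apply]
      exact apply_mem_bracketSpan hx ih
  refine ⟨k + 1, LinearMap.ext fun v => ?_⟩
  have := h k v
  rwa [hk, Submodule.mem_bot] at this

attribute [local instance] LieRing.ofAssociativeRing in
theorem exists_lcsμ_eq_bot [FiniteDimensional ℂ V] (hμ : IsSolvableLie (adLinear μ))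
    {I : Submodule ℂ V} (hI : ∀ x ∈ I, ∀ y ∈ I, μ x y ∈ I)
    (hnil : ∀ x ∈ I, IsNilpotent (adLinear μ x)) : ∃ k, lcsμ μ I k = ⊥ := by
  let K : LieSubalgebra ℂ (Module.End ℂ V) :=
    { I.map (adLinear μ) with
      lie_mem' := by
        rintro _ _ ⟨x, hx, rfl⟩ ⟨y, hy, rfl⟩
        exact ⟨μ x y, hI x hx y hy, hμ.ad_lie x y⟩ }
  have hK : LieModule.IsNilpotent K V := by
    rw [LieModule.isNilpotent_iff_forall' (R := ℂ)]
    rintro ⟨_, x, hx, rfl⟩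
    exact hnil x hx
  obtain ⟨k, hk⟩ := (LieModule.isNilpotent_iff ℂ K V).1 hK
  have hle : ∀ j, lcsμ μ I j ≤ (LieModule.lowerCentralSeries ℂ K V j).toSubmodule := by
    intro j
    induction j with
    | zero => simp
    | succ j ih =>
      refine Submodule.span_le.2 ?_
      rintro _ ⟨x, hx, y, hy, rfl⟩
      rw [LieModule.lowerCentralSeries_succ]
      exact LieSubmodule.lie_mem_lie (x := (⟨adLinear μ x, x, hx, rfl⟩ : K)) (m := y)
        (LieSubmodule.mem_top _) (ih hy)
  exact ⟨k, le_bot_iff.1 ((hle k).trans (by rw [hk]; exact le_rfl))⟩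

theorem exists_nilradical {V : Type*} [AddCommGroup V] [Module ℂ V] [FiniteDimensional ℂ V]
    {B : V →ₗ[ℂ] V →ₗ[ℂ] V} (hB : IsSolvableLie B) :
    ∃ n : Submodule ℂ V, (∀ x, x ∈ n ↔ IsNilpotent (B x)) ∧ ∀ x y, B x y ∈ n := by
  obtain ⟨w, hw⟩ := hB.isSolvableSpace_range.exists_isWeightSystem
  have h : ∀ x, x ∈ ⨅ i, LinearMap.ker (w i ∘ₗ B) ↔ IsNilpotent (B x) := fun x => by
    rw [hw.isNilpotent_iff ⟨x, rfl⟩, Submodule.mem_iInf]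
    rfl
  refine ⟨_, h, fun x y => ?_⟩
  rw [h, hw.isNilpotent_iff ⟨_, rfl⟩, hB.ad_lie]
  exact hw.lie_eq _ ⟨x, rfl⟩ _ ⟨y, rfl⟩

end Nilradical

section Torus

variable {V : Type*} [AddCommGroup V] [Module ℂ V] {B : V →ₗ[ℂ] V →ₗ[ℂ] V}

/-- An abelian subalgebra consisting of elements with semisimple adjoint action. -/
structure IsTorus (B : V →ₗ[ℂ] V →ₗ[ℂ] V) (a : Submodule ℂ V) : Prop where
  apply_eq_zero : ∀ x ∈ a, ∀ y ∈ a, B x y = 0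
  isSemisimple : ∀ x ∈ a, Module.End.IsSemisimple (B x)

theorem isTorus_bot (B : V →ₗ[ℂ] V →ₗ[ℂ] V) : IsTorus B ⊥ where
  apply_eq_zero x hx y _ := by
    rw [(Submodule.mem_bot ℂ).1 hx, map_zero, LinearMap.zero_apply]
  isSemisimple x hx := by
    rw [(Submodule.mem_bot ℂ).1 hx, map_zero]
    exact Module.End.isSemisimple_zero

theorem IsSolvableLie.commute_ad (hB : IsSolvableLie B) {x y : V} (h : B x y = 0) :
    Commute (B x) (B y) := by
  have := hB.ad_lie x y
  rw [h, map_zero, eq_comm, sub_eq_zero] at this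
  exact this

theorem IsTorus.sup_span_singleton [FiniteDimensional ℂ V] (hB : IsSolvableLie B)
    {a : Submodule ℂ V} (ha : IsTorus B a) {u : V} (hu : Module.End.IsSemisimple (B u))
    (h : ∀ x ∈ a, B u x = 0) : IsTorus B (a ⊔ ℂ ∙ u) where
  apply_eq_zero x hx y hy := by
    obtain ⟨x, hxa, _, hs, rfl⟩ := Submodule.mem_sup.1 hx
    obtain ⟨y, hya, _, ht, rfl⟩ := Submodule.mem_sup.1 hy
    obtain ⟨s, rfl⟩ := Submodule.mem_span_singleton.1 hs
    obtain ⟨t, rfl⟩ := Submodule.mem_span_singleton.1 ht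
    simp [ha.apply_eq_zero x hxa y hya, h y hya, hB.skew x u, h x hxa, hB.alt]
  isSemisimple x hx := by
    obtain ⟨x, hxa, _, hs, rfl⟩ := Submodule.mem_sup.1 hx
    obtain ⟨s, rfl⟩ := Submodule.mem_span_singleton.1 hs
    have hux : B x (s • u) = 0 := by rw [map_smul, hB.skew, h x hxa, neg_zero, smul_zero]
    have hsu : Module.End.IsSemisimple (B (s • u)) := by
      rw [map_smul]
      exact Module.End.IsSemisimple.of_mem_adjoin_singleton hu
        (Subalgebra.smul_mem _ (Algebra.self_mem_adjoin_singleton ℂ _) s)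
    rw [map_add]
    exact (ha.isSemisimple x hxa).add_of_commute (hB.commute_ad hux) hsu

theorem IsTorus.exists_sub_mem_centralizes [FiniteDimensional ℂ V] (hB : IsSolvableLie B)
    {a n : Submodule ℂ V} (ha : IsTorus B a) (hn : ∀ x y, B x y ∈ n) (x : V) :
    ∃ x', x - x' ∈ n ∧ ∀ y ∈ a, B y x' = 0 := by
  suffices H : ∀ s : Finset V, (∀ y ∈ s, y ∈ a) → ∃ x', x - x' ∈ n ∧ ∀ y ∈ s, B y x' = 0 by
    obtain ⟨s, hs⟩ := (IsNoetherian.noetherian a : a.FG)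
    obtain ⟨x', hx', h⟩ := H s fun y hy => hs ▸ Submodule.subset_span hy
    have hle : a ≤ LinearMap.ker (B.flip x') := hs ▸ Submodule.span_le.2 h
    exact ⟨x', hx', fun y hy => hle hy⟩
  classical
  intro s
  induction s using Finset.induction_on with
  | empty => exact fun _ => ⟨x, by simp, by simp⟩
  | insert T s _ ih =>
    intro hs
    obtain ⟨x', hx', h⟩ := ih fun y hy => hs y (Finset.mem_insert_of_mem hy)
    have hT : T ∈ a := hs T (Finset.mem_insert_self T s)
    obtain ⟨p, hp, hTp⟩ := (ha.isSemisimple T hT).exists_projection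
    refine ⟨Polynomial.aeval (B T) p x', ?_, fun y hy => ?_⟩
    · have h1 := aeval_apply_of_intertwining (T := B T) (S := (0 : Module.End ℂ (V ⧸ n)))
        (e := n.mkQ) (fun v => (Submodule.Quotient.mk_eq_zero n).2 (hn T v)) p x'
      rw [aeval_apply_of_apply_eq_zero (LinearMap.zero_apply _), hp, one_smul] at h1
      have h2 : x' - Polynomial.aeval (B T) p x' ∈ n := by
        rw [← Submodule.Quotient.eq]
        exact h1.symm
      simpa using add_mem hx' h2
    · rcases Finset.mem_insert.1 hy with rfl | hy'
      · exact hTp x'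
      · have hc := hB.commute_ad (ha.apply_eq_zero y (hs y hy) T hT)
        rw [aeval_apply_of_intertwining (S := B T) (LinearMap.congr_fun hc.eq), h y hy', map_zero]

theorem exists_isTorus_isCompl [FiniteDimensional ℂ V] (hB : IsSolvableLie B)
    (hcenter : ∀ x, B x = 0 → x = 0) {n : Submodule ℂ V} (hn : ∀ x, x ∈ n ↔ IsNilpotent (B x))
    (hBn : ∀ x y, B x y ∈ n)
    (hjordan : ∀ x, ∃ u, Module.End.IsSemisimple (B u) ∧ IsNilpotent (B x - B u) ∧
      B u ∈ Algebra.adjoin ℂ {B x}) : ∃ a, IsTorus B a ∧ IsCompl n a := by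
  obtain ⟨a, ha, hmax⟩ :=
    (wellFounded_gt (α := Submodule ℂ V)).has_min {a | IsTorus B a} ⟨⊥, isTorus_bot B⟩
  refine ⟨a, ha, disjoint_iff_inf_le.2 fun x hx => ?_, codisjoint_iff_le_sup.2 fun x _ => ?_⟩
  · rw [Submodule.mem_bot]
    exact hcenter x <| Module.End.eq_zero_of_isNilpotent_isSemisimple ((hn x).1 hx.1)
      (ha.isSemisimple x hx.2)
  · obtain ⟨x', hx', h⟩ := ha.exists_sub_mem_centralizes hB hBn x
    obtain ⟨u, hu, hnil, hadj⟩ := hjordan x'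
    have hua : ∀ y ∈ a, B u y = 0 := fun y hy => by
      have hc : Commute (B y) (B u) :=
        Algebra.commute_of_mem_adjoin_singleton_of_commute hadj (hB.commute_ad (h y hy))
      apply hcenter
      rw [hB.ad_lie, hc.eq, sub_self]
    have hmem : u ∈ a := by
      by_contra hu'
      refine hmax _ (ha.sup_span_singleton hB hu hua) (lt_of_le_of_ne le_sup_left fun he => hu' ?_)
      rw [he]
      exact Submodule.mem_sup_right (Submodule.mem_span_singleton_self u)
    have hxu : x' - u ∈ n := by rwa [hn, map_sub]
    rw [show x = (x - x') + (x' - u) + u by abel]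
    exact add_mem (Submodule.mem_sup_left (add_mem hx' hxu)) (Submodule.mem_sup_right hmem)

end Torus

/-- Let `g = (V, μ)` be a finite-dimensional solvable complex Lie algebra with trivial
center whose Lie bracket `μ` is rigid. Then `g` decomposes as a direct sum of subspaces
`g = n ⊕ a`, where `n` is the nilradical (the largest nilpotent ideal) and `a` is an
abelian subalgebra all of whose elements `T` have semisimple `ad T = μ T`. -/
theorem rigid_solvable_decomposition
    (V : Type*) [NormedAddCommGroup V] [NormedSpace ℂ V] [FiniteDimensional ℂ V]
    (μ : V →L[ℂ] V →L[ℂ] V) (hLie : IsLieBracket μ)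
    (hsolv : IsSolvableμ μ)
    (hcenter : ∀ x : V, (∀ y : V, μ x y = 0) → x = 0)
    (hrigid : IsOpen {ν : {ν : V →L[ℂ] V →L[ℂ] V // IsLieBracket ν} |
        (ν : V →L[ℂ] V →L[ℂ] V) ∈ transportOrbit μ}) :
    ∃ n a : Submodule ℂ V,
      IsNilpotentIdealμ μ n ∧
      (∀ I : Submodule ℂ V, IsNilpotentIdealμ μ I → I ≤ n) ∧
      IsSubalg μ a ∧ IsAbelianSub μ a ∧
      (∀ T ∈ a, Module.End.IsSemisimple ((μ T : V →L[ℂ] V) : V →ₗ[ℂ] V)) ∧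
      IsCompl n a := by
  have hB := hLie.isSolvableLie hsolv
  have hcenter' : ∀ x, adLinear μ x = 0 → x = 0 := fun x hx =>
    hcenter x (LinearMap.congr_fun hx)
  obtain ⟨n, hn, hBn⟩ := exists_nilradical hB
  obtain ⟨a, ha, hna⟩ := exists_isTorus_isCompl hB hcenter' hn hBn
    (exists_ad_eq_semisimplePart hLie hB hcenter' hrigid)
  refine ⟨n, a, ⟨fun x y _ => hBn x y, exists_lcsμ_eq_bot hB (fun x _ y _ => hBn x y)
    fun x hx => (hn x).1 hx⟩, fun I hI x hx => (hn x).2 (hI.isNilpotent_ad hB hx),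
    fun x hx y hy => ?_, ha.apply_eq_zero, ha.isSemisimple, hna⟩
  rw [show μ x y = 0 from ha.apply_eq_zero x hx y hy]
  exact a.zero_mem
end

section
/- Fix α, β ∈ ℂ with α + β ≠ 0, and let X₁ be the 4×4 complex matrix with rows (1,1,0,1),(1,1,0,0),(α,β,0,0),(0,0,0,0), an element of the subalgebra h_{α,β} spanned by X₁, X₂, X₃. Then neither the semisimple part X_{1,s} nor the nilpotent part X_{1,n} of the Jordan–Chevalley decomposition X₁ = X_{1,s} + X_{1,n} belongs to h_{α,β}; in particular h_{α,β} is not closed under Jordan–Chevalley decomposition. -/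
open Matrix

/-- The matrix `X₁` of the family `h_{α,β}`. -/
noncomputable def X1 (α β : ℂ) : Matrix (Fin 4) (Fin 4) ℂ :=
  !![1, 1, 0, 1;
     1, 1, 0, 0;
     α, β, 0, 0;
     0, 0, 0, 0]

/-- The matrix `X₂` of the family `h_{α,β}`. -/
noncomputable def X2 (α β : ℂ) : Matrix (Fin 4) (Fin 4) ℂ :=
  !![1,     1,     0, 0;
     1,     1,     0, 1;
     β - 1, α + 1, 0, 0;
     0,     0,     0, 0]

/-- The matrix `X₃` of the family `h_{α,β}`. -/
noncomputable def X3 : Matrix (Fin 4) (Fin 4) ℂ :=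
  !![0, 0, 0, 0;
     0, 0, 0, 0;
     0, 0, 0, 1;
     0, 0, 0, 0]

/-- A complex square matrix is diagonalizable if it is conjugate to a diagonal matrix. -/
def IsDiagonalizable {n : ℕ} (A : Matrix (Fin n) (Fin n) ℂ) : Prop :=
  ∃ P : (Matrix (Fin n) (Fin n) ℂ)ˣ, Matrix.IsDiag ((↑P⁻¹ : Matrix (Fin n) (Fin n) ℂ) * A * (↑P : Matrix (Fin n) (Fin n) ℂ))

/-- A diagonalizable matrix killed by `x ^ 3 * (x - c)` is already killed by `x * (x - c)`. -/
theorem IsDiagonalizable.sq_eq_smul {n : ℕ} {A : Matrix (Fin n) (Fin n) ℂ}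
    (hA : IsDiagonalizable A) {c : ℂ} (h : A ^ 4 = c • A ^ 3) : A ^ 2 = c • A := by
  obtain ⟨P, hP⟩ := hA
  obtain ⟨d, hd⟩ : ∃ d, diagonal d = (↑P⁻¹ : Matrix (Fin n) (Fin n) ℂ) * A * (P : Matrix (Fin n) (Fin n) ℂ) :=
    ⟨_, hP.diagonal_diag⟩
  have hAd : A = (P : Matrix (Fin n) (Fin n) ℂ) * diagonal d * (↑P⁻¹ : Matrix (Fin n) (Fin n) ℂ) := by
    rw [hd]; simp [mul_assoc]
  have hpow (k : ℕ) : A ^ k =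
      (P : Matrix (Fin n) (Fin n) ℂ) * diagonal (d ^ k) * (↑P⁻¹ : Matrix (Fin n) (Fin n) ℂ) := by
    rw [hAd, Units.conj_pow, diagonal_pow]
  have hdiag : diagonal (d ^ 4) = c • diagonal (d ^ 3) := by
    rw [hpow, hpow, ← smul_mul_assoc, ← mul_smul_comm] at h
    exact P.isUnit.mul_left_cancel (P⁻¹.isUnit.mul_right_cancel h)
  have hroot (i : Fin n) : d i ^ 2 = c * d i := by
    have hi : d i ^ 4 = c * d i ^ 3 := by simpa using congr_fun (congr_fun hdiag i) i
    have hz : (d i ^ 2 - c * d i) ^ 3 = 0 := by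
      linear_combination (d i - c) ^ 2 * hi
    exact sub_eq_zero.mp (pow_eq_zero_iff three_ne_zero |>.mp hz)
  have hsq : diagonal (d ^ 2) = c • diagonal d := by
    rw [← diagonal_smul]
    exact congr_arg diagonal (funext hroot)
  rw [hpow, hsq, hAd, mul_smul_comm, smul_mul_assoc]

/-- The matrix `X₁ + c X₃` is never diagonalizable. -/
theorem not_isDiagonalizable_X1_add (α β c : ℂ) :
    ¬ IsDiagonalizable !![1, 1, 0, 1; 1, 1, 0, 0; α, β, 0, c; 0, 0, 0, 0] := by
  intro hS
  set A : Matrix (Fin 4) (Fin 4) ℂ := !![1, 1, 0, 1; 1, 1, 0, 0; α, β, 0, c; 0, 0, 0, 0] with hA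
  have h2 : A ^ 2 = !![2, 2, 0, 1; 2, 2, 0, 1; α + β, α + β, 0, α; 0, 0, 0, 0] := by
    rw [pow_two, hA]
    ext i j
    fin_cases i <;> fin_cases j <;> simp [Matrix.mul_apply, Fin.sum_univ_four] <;> norm_num
  have h3 : A ^ 3 =
      !![4, 4, 0, 2; 4, 4, 0, 2; 2 * (α + β), 2 * (α + β), 0, α + β; 0, 0, 0, 0] := by
    rw [pow_succ, h2, hA]
    ext i j
    fin_cases i <;> fin_cases j <;> simp [Matrix.mul_apply, Fin.sum_univ_four] <;> ring
  have h4 : A ^ 4 = (2 : ℂ) • A ^ 3 := by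
    rw [pow_succ, h3, hA]
    ext i j
    fin_cases i <;> fin_cases j <;> simp [Matrix.mul_apply, Fin.sum_univ_four] <;> ring
  have h := congr_fun (congr_fun (hS.sq_eq_smul h4) 0) 3
  rw [h2, hA] at h
  simp at h

/-- The semisimple part of `X₁` is not in the span of `X₁`, `X₂`, `X₃`. -/
theorem semisimple_part_X1_not_mem (α β : ℂ) (S N : Matrix (Fin 4) (Fin 4) ℂ)
    (hsum : S + N = X1 α β) (hS : IsDiagonalizable S) (hN : IsNilpotent N)
    (hSN : Commute S N) : S ∉ Submodule.span ℂ {X1 α β, X2 α β, X3} := by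
  intro hmem
  obtain ⟨a, b, c, habc⟩ := Submodule.mem_span_triple.mp hmem
  have hcomm : Commute S (X1 α β) := by
    rw [← hsum]
    exact (Commute.refl S).add_right hSN
  have hSmat : S = !![a + b, a + b, 0, a; a + b, a + b, 0, b;
      a * α + b * (β - 1), a * β + b * (α + 1), 0, c; 0, 0, 0, 0] := by
    rw [← habc]
    ext i j
    fin_cases i <;> fin_cases j <;> simp [X1, X2, X3]
  have hb : b = 0 := by
    have h := congr_fun (congr_fun hcomm.eq 2) 3
    simp [hSmat, X1, Matrix.mul_apply, Fin.sum_univ_four] at h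
    linear_combination -h
  have ha : a = 1 := by
    have h := congr_arg trace hsum
    rw [trace_add, (isNilpotent_trace_of_isNilpotent hN).eq_zero] at h
    simp [hSmat, hb, X1, trace, Fin.sum_univ_four] at h
    linear_combination h / 2
  have hS' : S = !![1, 1, 0, 1; 1, 1, 0, 0; α, β, 0, c; 0, 0, 0, 0] := by
    simp [hSmat, ha, hb]
  rw [hS'] at hS
  exact not_isDiagonalizable_X1_add α β c hS

/-- If `α + β ≠ 0`, then neither the semisimple part nor the nilpotent part of the
Jordan–Chevalley decomposition `X₁ = X_{1,s} + X_{1,n}` belongs to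
`h_{α,β} = span {X₁, X₂, X₃}`; in particular `h_{α,β}` is not closed under
Jordan–Chevalley decomposition. -/
theorem jordan_parts_of_X1_not_mem (α β : ℂ) (hαβ : α + β ≠ 0)
    (S N : Matrix (Fin 4) (Fin 4) ℂ)
    (hsum : S + N = X1 α β)
    (hS : IsDiagonalizable S)
    (hN : IsNilpotent N)
    (hSN : Commute S N) :
    S ∉ Submodule.span ℂ {X1 α β, X2 α β, X3} ∧
    N ∉ Submodule.span ℂ {X1 α β, X2 α β, X3} := by
  have hSmem := semisimple_part_X1_not_mem α β S N hsum hS hN hSN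
  refine ⟨hSmem, fun hNmem => hSmem ?_⟩
  rw [eq_sub_of_add_eq hsum]
  exact Submodule.sub_mem _ (Submodule.subset_span (by simp)) hNmem
end

section
/- Fix α, β ∈ ℂ. A matrix X = x₁X₁ + x₂X₂ + x₃X₃ ∈ h_{α,β} is nilpotent if and only if x₁ + x₂ = 0; consequently the set of nilpotent elements of h_{α,β} is the 2-dimensional abelian ideal of h_{α,β} spanned by X₁ − X₂ and X₃. -/
open Matrix

theorem X1_mul_X3 (α β : ℂ) : X1 α β * X3 = 0 := by
  ext i j
  fin_cases i <;> fin_cases j <;> simp [X1, X3, Matrix.mul_apply, Fin.sum_univ_four]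

theorem X2_mul_X3 (α β : ℂ) : X2 α β * X3 = 0 := by
  ext i j
  fin_cases i <;> fin_cases j <;> simp [X2, X3, Matrix.mul_apply, Fin.sum_univ_four]

theorem X3_mul_X1 (α β : ℂ) : X3 * X1 α β = 0 := by
  ext i j
  fin_cases i <;> fin_cases j <;> simp [X1, X3, Matrix.mul_apply, Fin.sum_univ_four]

theorem X3_mul_X2 (α β : ℂ) : X3 * X2 α β = 0 := by
  ext i j
  fin_cases i <;> fin_cases j <;> simp [X2, X3, Matrix.mul_apply, Fin.sum_univ_four]

theorem X3_mul_X3 : X3 * X3 = 0 := by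
  ext i j
  fin_cases i <;> fin_cases j <;> simp [X3, Matrix.mul_apply, Fin.sum_univ_four]

theorem X1_mul_sub (α β : ℂ) : X1 α β * (X1 α β - X2 α β) = (α - β) • X3 := by
  ext i j
  fin_cases i <;> fin_cases j <;>
    simp [X1, X2, X3, Matrix.mul_apply, Fin.sum_univ_four] <;> ring

theorem X2_mul_sub (α β : ℂ) : X2 α β * (X1 α β - X2 α β) = (β - α - 2) • X3 := by
  ext i j
  fin_cases i <;> fin_cases j <;>
    simp [X1, X2, X3, Matrix.mul_apply, Fin.sum_univ_four] <;> ring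

theorem sub_mul_X1 (α β : ℂ) : (X1 α β - X2 α β) * X1 α β = (α - β + 1) • X3 := by
  ext i j
  fin_cases i <;> fin_cases j <;>
    simp [X1, X2, X3, Matrix.mul_apply, Fin.sum_univ_four] <;> ring

theorem sub_mul_X2 (α β : ℂ) : (X1 α β - X2 α β) * X2 α β = -(α - β + 1) • X3 := by
  ext i j
  fin_cases i <;> fin_cases j <;>
    simp [X1, X2, X3, Matrix.mul_apply, Fin.sum_univ_four] <;> ring

theorem sub_mul_X3 (α β : ℂ) : (X1 α β - X2 α β) * X3 = 0 := by
  rw [sub_mul, X1_mul_X3, X2_mul_X3, sub_zero]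

theorem X3_mul_sub (α β : ℂ) : X3 * (X1 α β - X2 α β) = 0 := by
  rw [mul_sub, X3_mul_X1, X3_mul_X2, sub_zero]

theorem sub_mul_sub_self (α β : ℂ) :
    (X1 α β - X2 α β) * (X1 α β - X2 α β) = (2 * (α - β + 1)) • X3 := by
  rw [mul_sub, sub_mul_X1, sub_mul_X2]
  module

theorem isNilpotent_smul_sub_add_smul_X3 (α β a b : ℂ) :
    IsNilpotent (a • (X1 α β - X2 α β) + b • X3) := by
  refine ⟨3, ?_⟩
  simp only [pow_succ, pow_zero, one_mul, add_mul, mul_add, smul_mul_assoc, mul_smul_comm,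
    sub_mul_sub_self, sub_mul_X3, X3_mul_sub, X3_mul_X3, smul_zero, add_zero]

theorem trace_combination (α β x₁ x₂ x₃ : ℂ) :
    (x₁ • X1 α β + x₂ • X2 α β + x₃ • X3).trace = 2 * (x₁ + x₂) := by
  simp [X1, X2, X3, Matrix.trace, Fin.sum_univ_four]
  ring

theorem isNilpotent_combination_iff (α β x₁ x₂ x₃ : ℂ) :
    IsNilpotent (x₁ • X1 α β + x₂ • X2 α β + x₃ • X3) ↔ x₁ + x₂ = 0 := by
  constructor
  · intro h
    have ht := (Matrix.isNilpotent_trace_of_isNilpotent h).eq_zero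
    rw [trace_combination] at ht
    simpa using ht
  · intro h
    obtain rfl : x₂ = -x₁ := (neg_eq_of_add_eq_zero_right h).symm
    convert isNilpotent_smul_sub_add_smul_X3 α β x₁ x₃ using 1
    module

theorem linearIndependent_sub_X3 (α β : ℂ) :
    LinearIndependent ℂ ![X1 α β - X2 α β, X3] := by
  rw [LinearIndependent.pair_iff]
  intro s t h
  have h₁ := congrFun (congrFun h 0) 3
  have h₂ := congrFun (congrFun h 2) 3
  simp [X1, X2, X3] at h₁ h₂
  exact ⟨h₁, h₂⟩

/-- A matrix `X = x₁X₁ + x₂X₂ + x₃X₃ ∈ h_{α,β}` is nilpotent iff `x₁ + x₂ = 0`;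
consequently the set of nilpotent elements of `h_{α,β}` is the 2-dimensional abelian
ideal of `h_{α,β}` spanned by `X₁ − X₂` and `X₃`. -/
theorem nilpotent_elements_of_h (α β : ℂ) :
    (∀ x₁ x₂ x₃ : ℂ,
      IsNilpotent (x₁ • X1 α β + x₂ • X2 α β + x₃ • X3) ↔ x₁ + x₂ = 0) ∧
    {A : Matrix (Fin 4) (Fin 4) ℂ |
        A ∈ Submodule.span ℂ {X1 α β, X2 α β, X3} ∧ IsNilpotent A} =
      ↑(Submodule.span ℂ {X1 α β - X2 α β, X3}) ∧
    Module.finrank ℂ (Submodule.span ℂ {X1 α β - X2 α β, X3}) = 2 ∧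
    (∀ A ∈ Submodule.span ℂ {X1 α β - X2 α β, X3},
      ∀ B ∈ Submodule.span ℂ {X1 α β - X2 α β, X3}, ⁅A, B⁆ = 0) ∧
    (∀ A ∈ Submodule.span ℂ ({X1 α β, X2 α β, X3} : Set (Matrix (Fin 4) (Fin 4) ℂ)),
      ∀ B ∈ Submodule.span ℂ {X1 α β - X2 α β, X3},
        ⁅A, B⁆ ∈ Submodule.span ℂ {X1 α β - X2 α β, X3}) := by
  refine ⟨isNilpotent_combination_iff α β, ?_, ?_, ?_, ?_⟩
  · ext A
    simp only [Set.mem_ofPred_eq, SetLike.mem_coe, Submodule.mem_span_triple,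
      Submodule.mem_span_pair]
    constructor
    · rintro ⟨⟨x₁, x₂, x₃, rfl⟩, h⟩
      rw [isNilpotent_combination_iff] at h
      obtain rfl : x₂ = -x₁ := (neg_eq_of_add_eq_zero_right h).symm
      exact ⟨x₁, x₃, by module⟩
    · rintro ⟨a, b, rfl⟩
      exact ⟨⟨a, -a, b, by module⟩, isNilpotent_smul_sub_add_smul_X3 α β a b⟩
  · have h := finrank_span_eq_card (linearIndependent_sub_X3 α β)
    rwa [Matrix.range_cons_cons_empty, Fintype.card_fin] at h
  · intro A hA B hB
    obtain ⟨a, b, rfl⟩ := Submodule.mem_span_pair.1 hA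
    obtain ⟨c, d, rfl⟩ := Submodule.mem_span_pair.1 hB
    simp only [Ring.lie_def, add_mul, mul_add, smul_mul_assoc, mul_smul_comm,
      sub_mul_sub_self, sub_mul_X3, X3_mul_sub, X3_mul_X3]
    module
  · intro A hA B hB
    obtain ⟨x₁, x₂, x₃, rfl⟩ := Submodule.mem_span_triple.1 hA
    obtain ⟨a, b, rfl⟩ := Submodule.mem_span_pair.1 hB
    refine Submodule.mem_span_pair.2 ⟨0, -(a * (x₁ + x₂)), ?_⟩
    simp only [Ring.lie_def, add_mul, mul_add, smul_mul_assoc, mul_smul_comm, X1_mul_sub,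
      X2_mul_sub, sub_mul_X1, sub_mul_X2, sub_mul_X3, X1_mul_X3, X2_mul_X3, X3_mul_X1,
      X3_mul_X2, X3_mul_sub, X3_mul_X3]
    module
end

section
/- Fix α, β ∈ ℂ and let X₄ be the 4×4 complex matrix with rows (1,1,0,1/2),(1,1,0,1/2),((α+β)/2,(α+β)/2,0,(α+β)/4),(0,0,0,0). Then [X₁,X₄] = [X₂,X₄] = [X₃,X₄] = 0, the span m of X₁, X₂, X₃, X₄ is a 4-dimensional Lie subalgebra of gl(4,ℂ) containing h_{α,β}, and for every X ∈ m both the semisimple part X_s and the nilpotent part X_n of the Jordan–Chevalley decomposition of X belong to m. -/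
open Matrix

/-- The matrix `X₄`. -/
noncomputable def X4 (α β : ℂ) : Matrix (Fin 4) (Fin 4) ℂ :=
  !![1,           1,           0, 1/2;
     1,           1,           0, 1/2;
     (α + β)/2,   (α + β)/2,   0, (α + β)/4;
     0,           0,           0, 0]

theorem IsDiagonalizable.isSemisimple_toLin' {n : ℕ} {A : Matrix (Fin n) (Fin n) ℂ}
    (hA : IsDiagonalizable A) : Module.End.IsSemisimple (Matrix.toLin' A) := by
  obtain ⟨P, hP⟩ := hA
  obtain ⟨d, hd⟩ : ∃ d, (↑P⁻¹ : Matrix (Fin n) (Fin n) ℂ) * A * (↑P : Matrix (Fin n) (Fin n) ℂ) =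
      diagonal d :=
    ⟨_, hP.diagonal_diag.symm⟩
  have hdiag : Module.End.IsSemisimple (Matrix.toLin' (diagonal d)) := by
    classical
    have hsq : Squarefree (∏ μ ∈ Finset.univ.image d, (Polynomial.X - Polynomial.C μ)) :=
      (Polynomial.separable_prod_X_sub_C_iff'.2 fun _ _ _ _ h ↦ h).squarefree
    refine Module.End.isSemisimple_of_squarefree_aeval_eq_zero hsq ?_
    have h1 : Matrix.toLin' (diagonal d) =
        (Matrix.toLinAlgEquiv' : Matrix (Fin n) (Fin n) ℂ ≃ₐ[ℂ] _)
          (Matrix.diagonalAlgHom ℂ d) := rfl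
    rw [h1, Polynomial.aeval_algHom_apply, Polynomial.aeval_algHom_apply]
    suffices h : Polynomial.aeval d (∏ μ ∈ Finset.univ.image d,
        (Polynomial.X - Polynomial.C μ)) = 0 by rw [h, map_zero, map_zero]
    ext i
    rw [Polynomial.aeval_pi_apply₂, map_prod]
    exact Finset.prod_eq_zero (Finset.mem_image_of_mem d (Finset.mem_univ i)) (by simp)
  refine (LinearEquiv.isSemisimple_iff (Matrix.toLin' A) (Matrix.toLin' (diagonal d))
    (Matrix.toLin'OfInv P.mul_inv P.inv_mul) ?_).2 hdiag
  change Matrix.toLin' (↑P⁻¹ : Matrix (Fin n) (Fin n) ℂ) ∘ₗ Matrix.toLin' A =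
    Matrix.toLin' (diagonal d) ∘ₗ Matrix.toLin' (↑P⁻¹ : Matrix (Fin n) (Fin n) ℂ)
  rw [← Matrix.toLin'_mul, ← Matrix.toLin'_mul, ← hd, Units.mul_inv_cancel_right]

theorem mem_span_X_iff {α β : ℂ} {A : Matrix (Fin 4) (Fin 4) ℂ} :
    A ∈ Submodule.span ℂ ({X1 α β, X2 α β, X3, X4 α β} : Set (Matrix (Fin 4) (Fin 4) ℂ)) ↔
      ∃ a b c d : ℂ, A = a • X1 α β + b • X2 α β + c • X3 + d • X4 α β := by
  simp only [Submodule.mem_span_insert, Submodule.mem_span_singleton]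
  constructor
  · rintro ⟨a, _, ⟨b, _, ⟨c, _, ⟨d, rfl⟩, rfl⟩, rfl⟩, rfl⟩
    exact ⟨a, b, c, d, by abel⟩
  · rintro ⟨a, b, c, d, rfl⟩
    exact ⟨a, _, ⟨b, _, ⟨c, _, ⟨d, rfl⟩, rfl⟩, rfl⟩, by abel⟩

theorem commute_X1_X4 (α β : ℂ) : Commute (X1 α β) (X4 α β) := by
  ext i j
  fin_cases i <;> fin_cases j <;> simp [X1, X4] <;> ring

theorem commute_X2_X4 (α β : ℂ) : Commute (X2 α β) (X4 α β) := by
  ext i j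
  fin_cases i <;> fin_cases j <;> simp [X2, X4] <;> ring

theorem commute_X3_X4 (α β : ℂ) : Commute X3 (X4 α β) := by
  ext i j
  fin_cases i <;> fin_cases j <;> simp [X3, X4]

theorem lie_mem_span_X {α β : ℂ} {A B : Matrix (Fin 4) (Fin 4) ℂ}
    (hA : A ∈ Submodule.span ℂ ({X1 α β, X2 α β, X3, X4 α β} : Set (Matrix (Fin 4) (Fin 4) ℂ)))
    (hB : B ∈ Submodule.span ℂ ({X1 α β, X2 α β, X3, X4 α β} : Set (Matrix (Fin 4) (Fin 4) ℂ))) :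
    ⁅A, B⁆ ∈
      Submodule.span ℂ ({X1 α β, X2 α β, X3, X4 α β} : Set (Matrix (Fin 4) (Fin 4) ℂ)) := by
  obtain ⟨a, b, c, d, rfl⟩ := mem_span_X_iff.1 hA
  obtain ⟨a', b', c', d', rfl⟩ := mem_span_X_iff.1 hB
  refine mem_span_X_iff.2 ⟨0, 0, a * b' - b * a', 0, ?_⟩
  ext i j
  fin_cases i <;> fin_cases j <;>
    simp [Ring.lie_def, X1, X2, X3, X4] <;> ring

theorem linearIndependent_X (α β : ℂ) :
    LinearIndependent ℂ ![X1 α β, X2 α β, X3, X4 α β] := by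
  rw [Fintype.linearIndependent_iff]
  intro g hg
  have h (i j : Fin 4) := congrFun (congrFun hg i) j
  have h03 := h 0 3
  have h13 := h 1 3
  have h20 := h 2 0
  have h23 := h 2 3
  simp [Fin.sum_univ_four, X1, X2, X3, X4] at h03 h13 h20 h23
  have g3 : g 3 = 0 := by
    linear_combination 2 * h20 - 2 * α * h03 - 2 * (β - 1) * h13
  have g0 : g 0 = 0 := by linear_combination h03 - g3 / 2
  have g1 : g 1 = 0 := by linear_combination h13 - g3 / 2
  have g2 : g 2 = 0 := by linear_combination h23 - (α + β) / 4 * g3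
  intro i
  fin_cases i
  exacts [g0, g1, g2, g3]

theorem finrank_span_X (α β : ℂ) :
    Module.finrank ℂ (Submodule.span ℂ
      ({X1 α β, X2 α β, X3, X4 α β} : Set (Matrix (Fin 4) (Fin 4) ℂ))) = 4 := by
  have h := finrank_span_eq_card (linearIndependent_X α β)
  have hrange : Set.range ![X1 α β, X2 α β, X3, X4 α β] = {X1 α β, X2 α β, X3, X4 α β} := by
    simp only [Matrix.range_cons, Matrix.range_empty, Set.union_empty, Set.singleton_union]
  rw [← hrange, h, Fintype.card_fin]

theorem X4_mul_self (α β : ℂ) : X4 α β * X4 α β = (2 : ℂ) • X4 α β := by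
  ext i j
  fin_cases i <;> fin_cases j <;>
    simp [X4, Matrix.mul_apply, Fin.sum_univ_four] <;> ring

theorem isSemisimple_toLin'_X4 (α β : ℂ) : Module.End.IsSemisimple (Matrix.toLin' (X4 α β)) := by
  have hsq : Squarefree ((Polynomial.X - Polynomial.C (0 : ℂ)) *
      (Polynomial.X - Polynomial.C (2 : ℂ))) :=
    ((Polynomial.separable_X_sub_C).mul Polynomial.separable_X_sub_C
      (Polynomial.isCoprime_X_sub_C_of_isUnit_sub (by simp))).squarefree
  refine Module.End.isSemisimple_of_squarefree_aeval_eq_zero hsq ?_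
  have h := congrArg Matrix.toLin' (X4_mul_self α β)
  rw [Matrix.toLin'_mul, map_smul] at h
  simp only [map_mul, map_sub, Polynomial.aeval_X, Polynomial.aeval_C, map_zero, sub_zero, mul_sub]
  rw [Module.End.mul_eq_comp, h, sub_eq_zero, Algebra.algebraMap_eq_smul_one, mul_smul_comm,
    mul_one]

theorem isNilpotent_smul_sub_X4 (α β a b c : ℂ) :
    IsNilpotent (a • (X1 α β - X4 α β) + b • (X2 α β - X4 α β) + c • X3) := by
  refine ⟨3, ?_⟩
  rw [pow_three]
  ext i j
  fin_cases i <;> fin_cases j <;> simp [X1, X2, X3, X4, Matrix.mul_apply, Fin.sum_univ_four]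

/-- `X₄` commutes with `X₁, X₂, X₃`; the span `m` of `X₁, X₂, X₃, X₄` is a
4-dimensional Lie subalgebra of `gl(4,ℂ)` containing `h_{α,β}`, and for every
`X ∈ m` both Jordan–Chevalley parts of `X` belong to `m`. -/
theorem m_is_splittable (α β : ℂ) :
    ⁅X1 α β, X4 α β⁆ = 0 ∧ ⁅X2 α β, X4 α β⁆ = 0 ∧ ⁅X3, X4 α β⁆ = 0 ∧
    (∀ A ∈ Submodule.span ℂ ({X1 α β, X2 α β, X3, X4 α β} : Set (Matrix (Fin 4) (Fin 4) ℂ)),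
      ∀ B ∈ Submodule.span ℂ ({X1 α β, X2 α β, X3, X4 α β} : Set (Matrix (Fin 4) (Fin 4) ℂ)),
        ⁅A, B⁆ ∈ Submodule.span ℂ ({X1 α β, X2 α β, X3, X4 α β} : Set (Matrix (Fin 4) (Fin 4) ℂ))) ∧
    Module.finrank ℂ
      (Submodule.span ℂ ({X1 α β, X2 α β, X3, X4 α β} : Set (Matrix (Fin 4) (Fin 4) ℂ))) = 4 ∧
    Submodule.span ℂ ({X1 α β, X2 α β, X3} : Set (Matrix (Fin 4) (Fin 4) ℂ)) ≤
      Submodule.span ℂ ({X1 α β, X2 α β, X3, X4 α β} : Set (Matrix (Fin 4) (Fin 4) ℂ)) ∧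
    (∀ X ∈ Submodule.span ℂ ({X1 α β, X2 α β, X3, X4 α β} : Set (Matrix (Fin 4) (Fin 4) ℂ)),
      ∀ S N : Matrix (Fin 4) (Fin 4) ℂ, S + N = X →
        IsDiagonalizable S → IsNilpotent N → Commute S N →
          S ∈ Submodule.span ℂ ({X1 α β, X2 α β, X3, X4 α β} : Set (Matrix (Fin 4) (Fin 4) ℂ)) ∧
          N ∈ Submodule.span ℂ ({X1 α β, X2 α β, X3, X4 α β} : Set (Matrix (Fin 4) (Fin 4) ℂ))) := by
  refine ⟨sub_eq_zero.2 (commute_X1_X4 α β), sub_eq_zero.2 (commute_X2_X4 α β),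
    sub_eq_zero.2 (commute_X3_X4 α β), fun A hA B hB ↦ lie_mem_span_X hA hB, finrank_span_X α β, Submodule.span_mono (by grind), ?_⟩
  intro X hX S N hSN hS hN hc
  obtain ⟨a, b, c, d, rfl⟩ := mem_span_X_iff.1 hX
  set M := a • (X1 α β - X4 α β) + b • (X2 α β - X4 α β) + c • X3
  have hcomm : Commute M ((a + b + d) • X4 α β) :=
    (((((commute_X1_X4 α β).sub_left (.refl _)).smul_left a).add_left
      (((commute_X2_X4 α β).sub_left (.refl _)).smul_left b)).add_left
      ((commute_X3_X4 α β).smul_left c)).smul_right _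
  have toLin'_nilpotent {A : Matrix (Fin 4) (Fin 4) ℂ} (hA : IsNilpotent A) :
      IsNilpotent (Matrix.toLin' A) := hA.map Matrix.toLinAlgEquiv'
  have toLin'_commute {A B : Matrix (Fin 4) (Fin 4) ℂ} (hAB : Commute A B) :
      Commute (Matrix.toLin' A) (Matrix.toLin' B) := hAB.map Matrix.toLinAlgEquiv'
  obtain ⟨h1, h2⟩ := Module.End.isNilpotent_isSemisimple_unique (toLin'_nilpotent hN)
    hS.isSemisimple_toLin' (toLin'_nilpotent (isNilpotent_smul_sub_X4 α β a b c))
    (s₂ := Matrix.toLin' ((a + b + d) • X4 α β))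
    (by rw [map_smul]; exact Module.End.IsSemisimple_smul _ (isSemisimple_toLin'_X4 α β))
    (toLin'_commute hc.symm) (toLin'_commute hcomm)
    (by rw [← map_add, ← map_add, add_comm N, hSN]; congr 1; module)
  rw [Matrix.toLin'.injective h1, Matrix.toLin'.injective h2]
  exact ⟨mem_span_X_iff.2 ⟨0, 0, 0, a + b + d, by module⟩,
    mem_span_X_iff.2 ⟨a, b, c, -(a + b), by module⟩⟩
end

section
/- There is a neighborhood U of the point (1,1,1) in ℂ³ such that for every (x₁,x₂,x₃) ∈ U, the two equations x₁x₂ + x₁x₃ − 2x₂x₃ = 0 and 2x₁x₂ − 3x₂x₃ + x₃² = 0 hold simultaneously if and only if x₁ = x₂ = x₃. -/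
/-- There is a neighborhood `U` of `(1,1,1)` in `ℂ³` on which the two equations
`x₁x₂ + x₁x₃ − 2x₂x₃ = 0` and `2x₁x₂ − 3x₂x₃ + x₃² = 0` hold simultaneously exactly
when `x₁ = x₂ = x₃`. -/
theorem local_structure_of_variety :
    ∃ U : Set (ℂ × ℂ × ℂ), IsOpen U ∧ (1, 1, 1) ∈ U ∧
      ∀ p ∈ U,
        (p.1 * p.2.1 + p.1 * p.2.2 - 2 * p.2.1 * p.2.2 = 0 ∧
          2 * p.1 * p.2.1 - 3 * p.2.1 * p.2.2 + p.2.2 ^ 2 = 0) ↔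
        (p.1 = p.2.1 ∧ p.2.1 = p.2.2) := by
  refine ⟨{p | p.2.2 ≠ 0 ∧ p.2.1 + p.2.2 ≠ 0}, ?_, by norm_num, ?_⟩
  · exact (isOpen_ne_fun (by fun_prop) (by fun_prop)).inter
      (isOpen_ne_fun (by fun_prop) (by fun_prop))
  · rintro ⟨x, y, z⟩ ⟨hz, hyz⟩
    dsimp only at hz hyz ⊢
    constructor
    · rintro ⟨h₁, h₂⟩
      have hsq : z * (y - z) ^ 2 = 0 := by linear_combination (y + z) * h₂ - 2 * y * h₁
      have hy : y = z := sub_eq_zero.mp (pow_eq_zero_iff two_ne_zero |>.mp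
        ((mul_eq_zero.mp hsq).resolve_left hz))
      subst hy
      exact ⟨mul_right_cancel₀ hyz (by linear_combination h₁), rfl⟩
    · rintro ⟨rfl, rfl⟩
      constructor <;> ring
end

section
/- Let μ be the alternating bilinear map on ℂ¹³ with basis T, X₁, …, X₁₂ defined by μ(X₁,X_i) = X_{i+1} for 2 ≤ i ≤ 11, μ(X₂,X_i) = X_{i+2} for 3 ≤ i ≤ 10, μ(T,X_i) = i·X_i for 1 ≤ i ≤ 12, and all other basis brackets zero. Then (i) μ satisfies the Jacobi identity, so it is a Lie bracket; and (ii) the alternating bilinear map φ defined by φ(X₂,X_i) = (4−i)X_{2+i} for 5 ≤ i ≤ 11, φ(X₃,X_i) = X_{3+i} for 4 ≤ i ≤ 10, and all other basis values zero, is a 2-cocycle of μ (i.e. μ(X,φ(Y,Z)) + μ(Y,φ(Z,X)) + μ(Z,φ(X,Y)) − φ(μ(X,Y),Z) − φ(μ(Y,Z),X) − φ(μ(Z,X),Y) = 0 for all X,Y,Z) which is not a 2-coboundary: there is no linear map f : ℂ¹³ → ℂ¹³ with φ(X,Y) = μ(f(X),Y) + μ(X,f(Y)) − f(μ(X,Y))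 for all X,Y. In particular the second Chevalley–Eilenberg cohomology of this Lie algebra with adjoint coefficients is nonzero. -/
/-- The basis vectors of `ℂ¹³`: `E 0 = T`, `E k = X_k` for `1 ≤ k ≤ 12`, and
`E k = 0` for out-of-range indices. -/
noncomputable def E (k : ℕ) : Fin 13 → ℂ :=
  if h : k < 13 then Pi.single (⟨k, h⟩ : Fin 13) 1 else 0

/-- The coefficient of `E (i + j)` in `μ (E i) (E j)`, for `i < j`. -/
def bracketUpper (i j : ℕ) : ℤ :=
  if i = 0 then j else if i = 1 then 1 else if i = 2 then 1 else 0

/-- The coefficient of `E (i + j)` in `φ (E i) (E j)`, for `i < j`. -/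
def cocycleUpper (i j : ℕ) : ℤ :=
  if i = 2 ∧ 5 ≤ j then 4 - j else if i = 3 then 1 else 0

/-- The skew-symmetric extension of coefficients given above the diagonal. -/
def skewExtend (c : ℕ → ℕ → ℤ) (i j : ℕ) : ℤ :=
  if i < j then c i j else if j < i then -c j i else 0

/-- The coefficient of `E (i + j)` in `μ (E i) (E j)`. -/
def bracketCoeff : ℕ → ℕ → ℤ := skewExtend bracketUpper

/-- The coefficient of `E (i + j)` in `φ (E i) (E j)`. -/
def cocycleCoeff : ℕ → ℕ → ℤ := skewExtend cocycleUpper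

theorem E_eq_zero {k : ℕ} (h : 13 ≤ k) : E k = 0 := by
  simp [E, Nat.not_lt.mpr h]

theorem E_apply {k : ℕ} (i : Fin 13) : E k i = if k = i then 1 else 0 := by
  unfold E
  split_ifs with h hi hi
  · subst hi; simp
  · exact Pi.single_eq_of_ne (fun h' => hi (by rw [h'])) 1
  · omega
  · rfl

theorem E_apply_self {n : ℕ} (hn : n < 13) : E n ⟨n, hn⟩ = 1 := by
  rw [E_apply, if_pos rfl]

theorem eq_sum_smul_E (x : Fin 13 → ℂ) : x = ∑ i : Fin 13, x i • E i := by
  ext j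
  simp [E_apply, Fin.val_inj]

theorem induction_on_E {P : (Fin 13 → ℂ) → Prop} (x : Fin 13 → ℂ)
    (basis : ∀ i < 13, P (E i)) (add : ∀ x y, P x → P y → P (x + y))
    (smul : ∀ (c : ℂ) x, P x → P (c • x)) : P x := by
  rw [eq_sum_smul_E x]
  refine Finset.sum_induction _ P add ?_ fun i _ => smul _ _ (basis i i.2)
  simpa using smul 0 _ (basis 0 (by norm_num))

/-- An alternating map whose values above the diagonal are graded multiples of basis vectors
is graded on all pairs of basis vectors. -/
theorem apply_E_of_lt {B : (Fin 13 → ℂ) →ₗ[ℂ] (Fin 13 → ℂ) →ₗ[ℂ] (Fin 13 → ℂ)}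
    (halt : ∀ x, B x x = 0) {c : ℕ → ℕ → ℤ}
    (h : ∀ i j, i < j → j < 13 → B (E i) (E j) = (c i j : ℂ) • E (i + j)) (i j : ℕ) :
    B (E i) (E j) = (skewExtend c i j : ℂ) • E (i + j) := by
  have hskew : ∀ x y, B x y = -B y x := fun x y => by
    have := halt (x + y)
    simp only [map_add, LinearMap.add_apply, halt, zero_add, add_zero] at this
    exact eq_neg_of_add_eq_zero_right this
  by_cases hi : 13 ≤ i
  · simp [E_eq_zero hi, E_eq_zero (show 13 ≤ i + j by omega)]
  by_cases hj : 13 ≤ j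
  · simp [E_eq_zero hj, E_eq_zero (show 13 ≤ i + j by omega)]
  unfold skewExtend
  split_ifs with h1 h2
  · exact h i j h1 (by omega)
  · rw [hskew, h j i h2 (by omega), add_comm j i]
    simp
  · obtain rfl : i = j := by omega
    simp [halt]

theorem bracketCoeff_jacobi : ∀ i < 13, ∀ j < 13, ∀ k < 13, i + j + k < 13 →
    bracketCoeff i j * bracketCoeff (i + j) k + bracketCoeff j k * bracketCoeff (j + k) i
      + bracketCoeff k i * bracketCoeff (k + i) j = 0 := by
  decide +kernel

theorem cocycleCoeff_cocycle : ∀ i < 13, ∀ j < 13, ∀ k < 13, i + j + k < 13 →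
    cocycleCoeff j k * bracketCoeff i (j + k) + cocycleCoeff k i * bracketCoeff j (k + i)
      + cocycleCoeff i j * bracketCoeff k (i + j) - bracketCoeff i j * cocycleCoeff (i + j) k
      - bracketCoeff j k * cocycleCoeff (j + k) i
      - bracketCoeff k i * cocycleCoeff (k + i) j = 0 := by
  decide +kernel

section Graded

variable {μ φ : (Fin 13 → ℂ) →ₗ[ℂ] (Fin 13 → ℂ) →ₗ[ℂ] (Fin 13 → ℂ)}

theorem jacobi_of_graded (hμ : ∀ i j, μ (E i) (E j) = (bracketCoeff i j : ℂ) • E (i + j))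
    (x y z : Fin 13 → ℂ) : μ (μ x y) z + μ (μ y z) x + μ (μ z x) y = 0 := by
  induction x using induction_on_E with
  | add x x' hx hx' =>
    simp only [map_add, LinearMap.add_apply]
    linear_combination (norm := module) hx + hx'
  | smul c x hx =>
    simp only [map_smul, LinearMap.smul_apply, ← smul_add, hx, smul_zero]
  | basis i hi =>
  induction y using induction_on_E with
  | add x x' hx hx' =>
    simp only [map_add, LinearMap.add_apply]
    linear_combination (norm := module) hx + hx'
  | smul c x hx =>
    simp only [map_smul, LinearMap.smul_apply, ← smul_add, hx, smul_zero]
  | basis j hj =>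
  induction z using induction_on_E with
  | add x x' hx hx' =>
    simp only [map_add, LinearMap.add_apply]
    linear_combination (norm := module) hx + hx'
  | smul c x hx =>
    simp only [map_smul, LinearMap.smul_apply, ← smul_add, hx, smul_zero]
  | basis k hk =>
  simp only [hμ, map_smul, LinearMap.smul_apply, smul_smul,
    show j + k + i = i + j + k by ring, show k + i + j = i + j + k by ring, ← add_smul]
  by_cases h : i + j + k < 13
  · rw [show (_ + _ + _ : ℂ) = 0 from mod_cast bracketCoeff_jacobi i hi j hj k hk h, zero_smul]
  · rw [E_eq_zero (Nat.not_lt.mp h), smul_zero]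

theorem cocycle_of_graded (hμ : ∀ i j, μ (E i) (E j) = (bracketCoeff i j : ℂ) • E (i + j))
    (hφ : ∀ i j, φ (E i) (E j) = (cocycleCoeff i j : ℂ) • E (i + j)) (x y z : Fin 13 → ℂ) :
    μ x (φ y z) + μ y (φ z x) + μ z (φ x y) - φ (μ x y) z - φ (μ y z) x - φ (μ z x) y = 0 := by
  induction x using induction_on_E with
  | add x x' hx hx' =>
    simp only [map_add, LinearMap.add_apply]
    linear_combination (norm := module) hx + hx'
  | smul c x hx =>
    simp only [map_smul, LinearMap.smul_apply, ← smul_add, ← smul_sub, hx, smul_zero]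
  | basis i hi =>
  induction y using induction_on_E with
  | add x x' hx hx' =>
    simp only [map_add, LinearMap.add_apply]
    linear_combination (norm := module) hx + hx'
  | smul c x hx =>
    simp only [map_smul, LinearMap.smul_apply, ← smul_add, ← smul_sub, hx, smul_zero]
  | basis j hj =>
  induction z using induction_on_E with
  | add x x' hx hx' =>
    simp only [map_add, LinearMap.add_apply]
    linear_combination (norm := module) hx + hx'
  | smul c x hx =>
    simp only [map_smul, LinearMap.smul_apply, ← smul_add, ← smul_sub, hx, smul_zero]
  | basis k hk =>
  simp only [hμ, hφ, map_smul, LinearMap.smul_apply, smul_smul,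
    show j + k + i = i + j + k by ring, show k + i + j = i + j + k by ring,
    show i + (j + k) = i + j + k by ring, show j + (k + i) = i + j + k by ring,
    show k + (i + j) = i + j + k by ring, ← add_smul, ← sub_smul]
  by_cases h : i + j + k < 13
  · rw [show (_ + _ + _ - _ - _ - _ : ℂ) = 0 from
      mod_cast cocycleCoeff_cocycle i hi j hj k hk h, zero_smul]
  · rw [E_eq_zero (Nat.not_lt.mp h), smul_zero]

/-- The weight-zero part of a coboundary only involves the diagonal of `f`. -/
theorem coboundary_diagonal (hμ : ∀ i j, μ (E i) (E j) = (bracketCoeff i j : ℂ) • E (i + j))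
    (hφ : ∀ i j, φ (E i) (E j) = (cocycleCoeff i j : ℂ) • E (i + j))
    {f : (Fin 13 → ℂ) →ₗ[ℂ] (Fin 13 → ℂ)}
    (hf : ∀ x y, φ x y = μ (f x) y + μ x (f y) - f (μ x y)) {i j : ℕ} (h : i + j < 13) :
    (cocycleCoeff i j : ℂ) = bracketCoeff i j *
      (f (E i) ⟨i, by omega⟩ + f (E j) ⟨j, by omega⟩ - f (E (i + j)) ⟨i + j, h⟩) := by
  have hl : ∀ x, μ x (E j) ⟨i + j, h⟩ = bracketCoeff i j * x ⟨i, by omega⟩ := fun x => by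
    induction x using induction_on_E with
    | add x y hx hy => simp only [map_add, LinearMap.add_apply, Pi.add_apply, hx, hy]; ring
    | smul c x hx =>
      simp only [map_smul, LinearMap.smul_apply, Pi.smul_apply, smul_eq_mul, hx]; ring
    | basis k hk =>
      rw [hμ, Pi.smul_apply, E_apply, E_apply]
      by_cases hki : k = i <;> simp [hki]
  have hr : ∀ y, μ (E i) y ⟨i + j, h⟩ = bracketCoeff i j * y ⟨j, by omega⟩ := fun y => by
    induction y using induction_on_E with
    | add x y hx hy => simp only [map_add, Pi.add_apply, hx, hy]; ring
    | smul c x hx => simp only [map_smul, Pi.smul_apply, smul_eq_mul, hx]; ring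
    | basis k hk =>
      rw [hμ, Pi.smul_apply, E_apply, E_apply]
      by_cases hkj : k = j <;> simp [hkj]
  have key := congrFun (hf (E i) (E j)) ⟨i + j, h⟩
  simp only [Pi.sub_apply, Pi.add_apply, hl, hr, hφ, hμ, map_smul, Pi.smul_apply, smul_eq_mul,
    E_apply_self] at key
  linear_combination key

theorem not_coboundary_of_graded
    (hμ : ∀ i j, μ (E i) (E j) = (bracketCoeff i j : ℂ) • E (i + j))
    (hφ : ∀ i j, φ (E i) (E j) = (cocycleCoeff i j : ℂ) • E (i + j)) :
    ¬ ∃ f : (Fin 13 → ℂ) →ₗ[ℂ] (Fin 13 → ℂ),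
        ∀ x y, φ x y = μ (f x) y + μ x (f y) - f (μ x y) := by
  rintro ⟨f, hf⟩
  have h13 := coboundary_diagonal hμ hφ hf (i := 1) (j := 3) (by norm_num)
  have h14 := coboundary_diagonal hμ hφ hf (i := 1) (j := 4) (by norm_num)
  have h15 := coboundary_diagonal hμ hφ hf (i := 1) (j := 5) (by norm_num)
  have h16 := coboundary_diagonal hμ hφ hf (i := 1) (j := 6) (by norm_num)
  have h23 := coboundary_diagonal hμ hφ hf (i := 2) (j := 3) (by norm_num)
  have h25 := coboundary_diagonal hμ hφ hf (i := 2) (j := 5) (by norm_num)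
  norm_num [bracketCoeff, cocycleCoeff, skewExtend, bracketUpper, cocycleUpper]
    at h13 h14 h15 h16 h23 h25
  exact one_ne_zero (α := ℂ) (by linear_combination h23 - h25 + h15 + h16 - h13 - h14)

end Graded

/-- Let `μ` be the alternating bilinear map on `ℂ¹³` (basis `T, X₁, …, X₁₂`) with
`μ(X₁,X_i) = X_{i+1}` for `2 ≤ i ≤ 11`, `μ(X₂,X_i) = X_{i+2}` for `3 ≤ i ≤ 10`,
`μ(T,X_i) = i·X_i` for `1 ≤ i ≤ 12`, all other basis brackets zero.  Then (i) `μ`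
satisfies the Jacobi identity, so it is a Lie bracket; and (ii) the alternating
bilinear map `φ` with `φ(X₂,X_i) = (4−i)X_{2+i}` for `5 ≤ i ≤ 11`,
`φ(X₃,X_i) = X_{3+i}` for `4 ≤ i ≤ 10`, all other basis values zero, is a 2-cocycle
of `μ` which is not a 2-coboundary.  In particular `H²(μ,μ) ≠ 0`. -/
theorem dim13_rigid_with_nonzero_H2
    (μ φ : (Fin 13 → ℂ) →ₗ[ℂ] (Fin 13 → ℂ) →ₗ[ℂ] (Fin 13 → ℂ))
    (hμalt : ∀ x, μ x x = 0)
    (hμ1 : ∀ i : ℕ, 2 ≤ i → i ≤ 11 → μ (E 1) (E i) = E (i + 1))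
    (hμ2 : ∀ i : ℕ, 3 ≤ i → i ≤ 10 → μ (E 2) (E i) = E (i + 2))
    (hμT : ∀ i : ℕ, 1 ≤ i → i ≤ 12 → μ (E 0) (E i) = (i : ℂ) • E i)
    (hμ0 : ∀ i j : ℕ, i < j → j ≤ 12 →
      i ≠ 0 →
      ¬(i = 1 ∧ 2 ≤ j ∧ j ≤ 11) →
      ¬(i = 2 ∧ 3 ≤ j ∧ j ≤ 10) →
      μ (E i) (E j) = 0)
    (hφalt : ∀ x, φ x x = 0)
    (hφ2 : ∀ i : ℕ, 5 ≤ i → i ≤ 11 → φ (E 2) (E i) = ((4 : ℂ) - (i : ℂ)) • E (i + 2))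
    (hφ3 : ∀ i : ℕ, 4 ≤ i → i ≤ 10 → φ (E 3) (E i) = E (i + 3))
    (hφ0 : ∀ i j : ℕ, i < j → j ≤ 12 →
      ¬(i = 2 ∧ 5 ≤ j ∧ j ≤ 11) →
      ¬(i = 3 ∧ 4 ≤ j ∧ j ≤ 10) →
      φ (E i) (E j) = 0) :
    (∀ x y z, μ (μ x y) z + μ (μ y z) x + μ (μ z x) y = 0) ∧
    (∀ x y z,
      μ x (φ y z) + μ y (φ z x) + μ z (φ x y)
        - φ (μ x y) z - φ (μ y z) x - φ (μ z x) y = 0) ∧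
    ¬ ∃ f : (Fin 13 → ℂ) →ₗ[ℂ] (Fin 13 → ℂ),
        ∀ x y, φ x y = μ (f x) y + μ x (f y) - f (μ x y) := by
  have hμ : ∀ i j, μ (E i) (E j) = (bracketCoeff i j : ℂ) • E (i + j) := by
    refine apply_E_of_lt hμalt fun i j hij hj => ?_
    obtain rfl | rfl | rfl | hi : i = 0 ∨ i = 1 ∨ i = 2 ∨ 3 ≤ i := by omega
    · simp [bracketUpper, hμT j hij (by omega)]
    · by_cases h : j ≤ 11
      · simp [bracketUpper, hμ1 j hij h, add_comm]
      · rw [hμ0 1 j hij (by omega) (by omega) (by omega) (by omega),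
          E_eq_zero (show 13 ≤ 1 + j by omega), smul_zero]
    · by_cases h : j ≤ 10
      · simp [bracketUpper, hμ2 j hij h, add_comm]
      · rw [hμ0 2 j hij (by omega) (by omega) (by omega) (by omega),
          E_eq_zero (show 13 ≤ 2 + j by omega), smul_zero]
    · rw [hμ0 i j hij (by omega) (by omega) (by omega) (by omega), bracketUpper,
        if_neg (by omega), if_neg (by omega), if_neg (by omega), Int.cast_zero, zero_smul]
  have hφ : ∀ i j, φ (E i) (E j) = (cocycleCoeff i j : ℂ) • E (i + j) := by
    refine apply_E_of_lt hφalt fun i j hij hj => ?_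
    by_cases h2 : i = 2 ∧ 5 ≤ j ∧ j ≤ 11
    · obtain ⟨rfl, h5, h11⟩ := h2
      simp [cocycleUpper, hφ2 j h5 h11, h5, add_comm]
    by_cases h3 : i = 3 ∧ 4 ≤ j ∧ j ≤ 10
    · obtain ⟨rfl, h4, h10⟩ := h3
      simp [cocycleUpper, hφ3 j h4 h10, add_comm]
    rw [hφ0 i j hij (by omega) h2 h3]
    by_cases h : 13 ≤ i + j
    · rw [E_eq_zero h, smul_zero]
    · rw [cocycleUpper, if_neg (by omega), if_neg (by omega), Int.cast_zero, zero_smul]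
  exact ⟨jacobi_of_graded hμ, cocycle_of_graded hμ hφ, not_coboundary_of_graded hμ hφ⟩
end

section
/- Let μ be the Lie bracket on ℂ⁵ with basis T₁, T₂, X₁, X₂, X₃ defined by μ(T₁,X₁) = X₁, μ(T₁,X₃) = X₃, μ(T₂,X₂) = X₂, μ(T₂,X₃) = X₃, μ(X₁,X₂) = X₃, and all other basis brackets zero (this is a solvable Lie algebra whose nilradical is the 3-dimensional Heisenberg algebra spanned by X₁, X₂, X₃). Then μ is rigid: its GL(5,ℂ)-orbit under the transport action is open in the set of Lie brackets on ℂ⁵. -/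
/-- The standard basis of `ℂ⁵`, labelled `T₁ = e 0`, `T₂ = e 1`, `X₁ = e 2`,
`X₂ = e 3`, `X₃ = e 4`. -/
noncomputable def e (i : Fin 5) : Fin 5 → ℂ := Pi.single i 1

open Topology Filter

section Slice

variable {R B Y : Type*} [NormedRing R] [NormedAlgebra ℂ R] [CompleteSpace R]
  [NormedAddCommGroup B] [NormedSpace ℂ B] [NormedAddCommGroup Y] [NormedSpace ℂ Y]

/-- The derivative at `(1, μ)` of `(f, β) ↦ f⁻¹ · β · f`, where `P` is the action on the left and
`Q`, `S` are the actions on the two arguments. -/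
theorem exists_hasStrictFDerivAt_inverse_conj (P Q S : R →L[ℂ] B →L[ℂ] B)
    (hP : ∀ β, P 1 β = β) (hQ : ∀ β, Q 1 β = β) (hS : ∀ β, S 1 β = β) (μ : B) :
    ∃ L : (R × B) →L[ℂ] B,
      HasStrictFDerivAt (fun p : R × B => P (Ring.inverse p.1) (Q p.1 (S p.1 p.2))) L (1, μ) ∧
        ∀ g ω, L (g, ω) = (Q g μ + S g μ - P g μ) + ω := by
  have hf : HasStrictFDerivAt (Prod.fst : R × B → R) (ContinuousLinearMap.fst ℂ R B) (1, μ) :=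
    hasStrictFDerivAt_fst
  have hβ : HasStrictFDerivAt (Prod.snd : R × B → B) (ContinuousLinearMap.snd ℂ R B) (1, μ) :=
    hasStrictFDerivAt_snd
  have hinv := HasStrictFDerivAt.comp (g := Ring.inverse) ((1, μ) : R × B)
    (hasStrictFDerivAt_ringInverse (𝕜 := ℂ) (1 : Rˣ)) hf
  have hP' := P.hasStrictFDerivAt.comp ((1, μ) : R × B) hinv
  have hQ' := Q.hasStrictFDerivAt.comp ((1, μ) : R × B) hf
  have hS' := S.hasStrictFDerivAt.comp ((1, μ) : R × B) hf
  refine ⟨_, hP'.clm_apply (hQ'.clm_apply (hS'.clm_apply hβ)), fun g ω => ?_⟩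
  simp [hP, hQ, hS]
  abel

/-- A slice theorem: if the linearisation at `μ` of the equations `J` has no more solutions than
the infinitesimal conjugates of `μ`, then every point close to `μ` is conjugate, by an element
close to `1`, to a point which is either `μ` or not a zero of `J`. -/
theorem eventually_exists_conj_of_ker_le [FiniteDimensional ℂ B] (P Q S : R →L[ℂ] B →L[ℂ] B)
    (hP : ∀ β, P 1 β = β) (hQ : ∀ β, Q 1 β = β) (hS : ∀ β, S 1 β = β) {μ : B}
    {κ : Type*} [Fintype κ] {J : κ → B → Y} {J' : κ → B →L[ℂ] Y}
    (hJ : ∀ k, HasFDerivAt (J k) (J' k) μ)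
    (hker : ∀ ω, (∀ k, J' k ω = 0) → ∃ g, ω = Q g μ + S g μ - P g μ) :
    ∀ᶠ ν in 𝓝 μ, ∃ (u : Rˣ) (β : B),
      ν = P ((u⁻¹ : Rˣ) : R) (Q u (S u β)) ∧ ((∀ k, J k β = 0) → β = μ) := by
  have : CompleteSpace B := FiniteDimensional.complete ℂ B
  obtain ⟨L, hL, hLapp⟩ := exists_hasStrictFDerivAt_inverse_conj P Q S hP hQ hS μ
  let δ := L.comp (ContinuousLinearMap.inl ℂ R B)
  have hδ : ∀ g, δ g = Q g μ + S g μ - P g μ := fun g => by simp [δ, hLapp]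
  obtain ⟨W, hW⟩ := Submodule.exists_isCompl δ.range
  have hslice : HasStrictFDerivAt (fun w : W => μ + (w : B)) W.subtypeL 0 :=
    W.subtypeL.hasStrictFDerivAt.const_add μ
  have hisol : ∀ᶠ w : W in 𝓝 0, (∀ k, J k (μ + w) = 0) → w = 0 := by
    have hd := HasFDerivAt.comp (g := fun β k => J k β) (0 : W)
      (by simpa only [ZeroMemClass.coe_zero, add_zero] using hasFDerivAt_pi.2 hJ) hslice.hasFDerivAt
    have hinj : ((ContinuousLinearMap.pi J').comp W.subtypeL).toLinearMap.ker = ⊥ := by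
      rw [LinearMap.ker_eq_bot']
      intro w hw
      obtain ⟨g, hg⟩ := hker w (congrFun hw)
      have hmem : (w : B) ∈ δ.range := ⟨g, (hδ g).trans hg.symm⟩
      exact Subtype.ext (Submodule.disjoint_def.1 hW.disjoint _ hmem w.2)
    obtain ⟨K, -, hK⟩ := LinearMap.exists_antilipschitzWith _ hinj
    have hne := hd.eventually_ne (c := 0) ⟨K, hK⟩
    rw [eventually_nhdsWithin_iff] at hne
    filter_upwards [hne] with w hw hJw
    by_contra hw0
    exact hw hw0 (funext hJw)
  have hΦ := HasStrictFDerivAt.comp ((1 : R), (0 : W))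
    (g := fun p : R × B => P (Ring.inverse p.1) (Q p.1 (S p.1 p.2)))
    (f := fun q : R × W => (q.1, μ + (q.2 : B)))
    (by simpa using hL)
    ((hasStrictFDerivAt_fst (𝕜 := ℂ)).prodMk
      (HasStrictFDerivAt.comp ((1 : R), (0 : W)) hslice hasStrictFDerivAt_snd))
  have hmap := hΦ.map_nhds_eq_of_surj (by
    rw [LinearMap.range_eq_top]
    intro β
    obtain ⟨s, ⟨g, rfl⟩, w, hw, hsw⟩ :=
      Submodule.mem_sup.1 (hW.sup_eq_top ▸ Submodule.mem_top : β ∈ δ.range ⊔ W)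
    refine ⟨(g, ⟨w, hw⟩), Eq.trans ?_ hsw⟩
    change L (g, w) = δ g + w
    rw [hLapp, hδ])
  simp only [ZeroMemClass.coe_zero, add_zero, Ring.inverse_one, hP, hQ, hS] at hmap
  rw [← hmap, eventually_map, nhds_prod_eq]
  have hunit : ∀ᶠ f : R in 𝓝 1, IsUnit f := Units.nhds 1
  filter_upwards [hunit.prod_mk hisol] with q ⟨⟨u, hu⟩, hq⟩
  refine ⟨u, μ + q.2, by rw [← hu, Ring.inverse_unit], fun h => by simp [hq h]⟩

theorem exists_hasFDerivAt_add {f g f' g' : B → Y} {μ : B}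
    (hf : ∃ L : B →L[ℂ] Y, HasFDerivAt f L μ ∧ ∀ ω, L ω = f' ω)
    (hg : ∃ L : B →L[ℂ] Y, HasFDerivAt g L μ ∧ ∀ ω, L ω = g' ω) :
    ∃ L : B →L[ℂ] Y, HasFDerivAt (fun β => f β + g β) L μ ∧ ∀ ω, L ω = f' ω + g' ω := by
  obtain ⟨L₁, h₁, e₁⟩ := hf
  obtain ⟨L₂, h₂, e₂⟩ := hg
  exact ⟨L₁ + L₂, h₁.add h₂, fun ω => by simp [e₁, e₂]⟩

theorem hasFDerivAt_clm_apply_clm {F : Type*} [NormedAddCommGroup F] [NormedSpace ℂ F]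
    (c : B →L[ℂ] F →L[ℂ] Y) (u : B →L[ℂ] F) (μ : B) :
    HasFDerivAt (fun β => c β (u β)) ((c μ).comp u + c.flip (u μ)) μ :=
  c.hasFDerivAt.clm_apply u.hasFDerivAt

end Slice

section Rigidity

variable {V : Type*} [NormedAddCommGroup V] [NormedSpace ℂ V]

/-- The bilinear map `(x, y) ↦ g (β x y)`. -/
noncomputable def bilPost : (V →L[ℂ] V) →L[ℂ] (V →L[ℂ] V →L[ℂ] V) →L[ℂ] (V →L[ℂ] V →L[ℂ] V) :=
  (ContinuousLinearMap.compL ℂ V (V →L[ℂ] V) (V →L[ℂ] V)).comp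
    (ContinuousLinearMap.compL ℂ V V V)

/-- The bilinear map `(x, y) ↦ β x (f y)`. -/
noncomputable def bilRight : (V →L[ℂ] V) →L[ℂ] (V →L[ℂ] V →L[ℂ] V) →L[ℂ] (V →L[ℂ] V →L[ℂ] V) :=
  (ContinuousLinearMap.compL ℂ V (V →L[ℂ] V) (V →L[ℂ] V)).comp
    (ContinuousLinearMap.compL ℂ V V V).flip

/-- The bilinear map `(x, y) ↦ β (f x) y`. -/
noncomputable def bilLeft : (V →L[ℂ] V) →L[ℂ] (V →L[ℂ] V →L[ℂ] V) →L[ℂ] (V →L[ℂ] V →L[ℂ] V) :=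
  (ContinuousLinearMap.compL ℂ V V (V →L[ℂ] V)).flip

@[simp]
theorem bilPost_apply (g : V →L[ℂ] V) (β : V →L[ℂ] V →L[ℂ] V) (x y : V) :
    bilPost g β x y = g (β x y) := rfl

@[simp]
theorem bilRight_apply (f : V →L[ℂ] V) (β : V →L[ℂ] V →L[ℂ] V) (x y : V) :
    bilRight f β x y = β x (f y) := rfl

@[simp]
theorem bilLeft_apply (f : V →L[ℂ] V) (β : V →L[ℂ] V →L[ℂ] V) (x y : V) :
    bilLeft f β x y = β (f x) y := rfl

theorem bil_ext {β γ : V →L[ℂ] V →L[ℂ] V} (h : ∀ x y, β x y = γ x y) : β = γ :=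
  ContinuousLinearMap.ext fun x => ContinuousLinearMap.ext fun y => h x y

/-- The cyclic sum occurring in the Jacobi identity. -/
noncomputable def jacobiator (β : V →L[ℂ] V →L[ℂ] V) (x y z : V) : V :=
  β (β x y) z + β (β y z) x + β (β z x) y

/-- The polarisation of `jacobiator` at `μ`: for an alternating `ω`, its vanishing is the
2-cocycle identity. -/
noncomputable def cocycleSum (μ ω : V →L[ℂ] V →L[ℂ] V) (x y z : V) : V :=
  (ω (μ x y) z + μ (ω x y) z) + (ω (μ y z) x + μ (ω y z) x) + (ω (μ z x) y + μ (ω z x) y)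

theorem IsLieBracket.of_conj {β ν : V →L[ℂ] V →L[ℂ] V} (f : V ≃L[ℂ] V)
    (h : ∀ x y, ν x y = f.symm (β (f x) (f y))) (hν : IsLieBracket ν) : IsLieBracket β := by
  have hβ : ∀ x y, β x y = f (ν (f.symm x) (f.symm y)) := fun x y => by simp [h]
  refine ⟨fun x => by simp [hβ, hν.1 (f.symm x)], fun x y z => ?_⟩
  have := congrArg f (hν.2 (f.symm x) (f.symm y) (f.symm z))
  simpa [hβ] using this

theorem IsLieBracket.add_swap {β : V →L[ℂ] V →L[ℂ] V} (h : IsLieBracket β) (x y : V) :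
    β x y + β y x = 0 := by
  have h1 := h.1 (x + y)
  simpa [h.1 x, h.1 y, add_comm] using h1

theorem exists_hasFDerivAt_bil_comp (μ : V →L[ℂ] V →L[ℂ] V) (x y z : V) :
    ∃ L : (V →L[ℂ] V →L[ℂ] V) →L[ℂ] V,
      HasFDerivAt (fun β : V →L[ℂ] V →L[ℂ] V => β (β x y) z) L μ ∧
        ∀ ω, L ω = ω (μ x y) z + μ (ω x y) z :=
  ⟨_, hasFDerivAt_clm_apply_clm
    (ContinuousLinearMap.compL ℂ V (V →L[ℂ] V) V (ContinuousLinearMap.apply ℂ V z))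
    ((ContinuousLinearMap.apply ℂ V y).comp (ContinuousLinearMap.apply ℂ (V →L[ℂ] V) x)) μ,
    fun _ => add_comm _ _⟩

theorem exists_hasFDerivAt_jacobiator (μ : V →L[ℂ] V →L[ℂ] V) (x y z : V) :
    ∃ L : (V →L[ℂ] V →L[ℂ] V) →L[ℂ] V,
      HasFDerivAt (fun β => jacobiator β x y z) L μ ∧ ∀ ω, L ω = cocycleSum μ ω x y z := by
  have h := exists_hasFDerivAt_add (B := V →L[ℂ] V →L[ℂ] V) (Y := V)
    (exists_hasFDerivAt_bil_comp μ x y z) (exists_hasFDerivAt_bil_comp μ y z x)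
  exact exists_hasFDerivAt_add (B := V →L[ℂ] V →L[ℂ] V) (Y := V) h
    (exists_hasFDerivAt_bil_comp μ z x y)

theorem exists_hasFDerivAt_add_swap (μ : V →L[ℂ] V →L[ℂ] V) (x y : V) :
    ∃ L : (V →L[ℂ] V →L[ℂ] V) →L[ℂ] V,
      HasFDerivAt (fun β : V →L[ℂ] V →L[ℂ] V => β x y + β y x) L μ ∧
        ∀ ω, L ω = ω x y + ω y x := by
  let ev := fun u v : V => (ContinuousLinearMap.apply ℂ V v).comp
    (ContinuousLinearMap.apply ℂ (V →L[ℂ] V) u)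
  exact ⟨ev x y + ev y x, (ev x y + ev y x).hasFDerivAt, fun ω => rfl⟩

/-- If every infinitesimal deformation of `μ`, tested on a finite family `b`, is a coboundary,
then all Lie brackets close to `μ` are isomorphic to it. -/
theorem eventually_mem_transportOrbit [FiniteDimensional ℂ V]
    {ι : Type*} [Fintype ι] (b : ι → V) (μ : V →L[ℂ] V →L[ℂ] V)
    (H : ∀ ω : V →L[ℂ] V →L[ℂ] V, (∀ i j, ω (b i) (b j) + ω (b j) (b i) = 0) →
      (∀ i j k, cocycleSum μ ω (b i) (b j) (b k) = 0) →
      ∃ g : V →L[ℂ] V, ∀ x y, ω x y = μ (g x) y + μ x (g y) - g (μ x y)) :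
    ∀ᶠ ν in 𝓝 μ, IsLieBracket ν → ν ∈ transportOrbit μ := by
  have : CompleteSpace V := FiniteDimensional.complete ℂ V
  choose A hA eA using fun i j => exists_hasFDerivAt_add_swap μ (b i) (b j)
  choose J hJ eJ using fun i j k => exists_hasFDerivAt_jacobiator μ (b i) (b j) (b k)
  have key := eventually_exists_conj_of_ker_le bilPost bilRight bilLeft
    (fun β => rfl) (fun β => rfl) (fun β => rfl)
    (κ := (ι × ι) ⊕ (ι × ι × ι))
    (J := Sum.elim (fun p β => β (b p.1) (b p.2) + β (b p.2) (b p.1))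
      (fun p β => jacobiator β (b p.1) (b p.2.1) (b p.2.2)))
    (J' := Sum.elim (fun p => A p.1 p.2) (fun p => J p.1 p.2.1 p.2.2))
    (Sum.rec (fun p => hA p.1 p.2) (fun p => hJ p.1 p.2.1 p.2.2)) (fun ω hω => by
      obtain ⟨g, hg⟩ := H ω
        (fun i j => by rw [← eA]; exact hω (Sum.inl (i, j)))
        (fun i j k => by rw [← eJ]; exact hω (Sum.inr (i, j, k)))
      refine ⟨g, bil_ext fun x y => ?_⟩
      rw [hg, add_comm (μ (g x) y)]
      rfl)
  filter_upwards [key] with ν ⟨u, β, hν, hβ⟩ hLie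
  let f := ContinuousLinearEquiv.unitsEquiv ℂ V u
  have hconj : ∀ x y, ν x y = f.symm (β (f x) (f y)) := fun x y => by
    rw [hν]
    rfl
  have hβLie := hLie.of_conj f hconj
  have hβμ : β = μ := hβ (Sum.rec (fun p => hβLie.add_swap _ _) (fun p => hβLie.2 _ _ _))
  exact ⟨f, hβμ ▸ hconj⟩

/-- A Lie bracket whose infinitesimal deformations, tested on a finite family `b`, are all
coboundaries is rigid. -/
theorem isOpen_transportOrbit [FiniteDimensional ℂ V]
    {ι : Type*} [Fintype ι] (b : ι → V) (μ : V →L[ℂ] V →L[ℂ] V)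
    (H : ∀ ω : V →L[ℂ] V →L[ℂ] V, (∀ i j, ω (b i) (b j) + ω (b j) (b i) = 0) →
      (∀ i j k, cocycleSum μ ω (b i) (b j) (b k) = 0) →
      ∃ g : V →L[ℂ] V, ∀ x y, ω x y = μ (g x) y + μ x (g y) - g (μ x y)) :
    IsOpen {ν : {ν : V →L[ℂ] V →L[ℂ] V // IsLieBracket ν} |
      (ν : V →L[ℂ] V →L[ℂ] V) ∈ transportOrbit μ} := by
  rw [isOpen_iff_mem_nhds]
  rintro ⟨ν₀, hν₀⟩ ⟨f, hf⟩
  let T : (V →L[ℂ] V →L[ℂ] V) →L[ℂ] (V →L[ℂ] V →L[ℂ] V) :=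
    (bilPost (f : V →L[ℂ] V)).comp ((bilRight f.symm).comp (bilLeft f.symm))
  have hT : ∀ ν x y, ν x y = f.symm (T ν (f x) (f y)) := fun ν x y => by simp [T]
  have hT₀ : T ν₀ = μ := by
    exact bil_ext fun x y => by simp [T, hf]
  have hcont : Tendsto (fun ν : {ν : V →L[ℂ] V →L[ℂ] V // IsLieBracket ν} => T ν)
      (𝓝 ⟨ν₀, hν₀⟩) (𝓝 μ) := by
    have := (T.continuous.comp continuous_subtype_val).tendsto
      (⟨ν₀, hν₀⟩ : {ν : V →L[ℂ] V →L[ℂ] V // IsLieBracket ν})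
    rw [← hT₀]
    exact this
  filter_upwards [hcont.eventually (eventually_mem_transportOrbit b μ H)] with ν hν
  obtain ⟨g, hg⟩ := hν (ν.2.of_conj f (hT ν))
  exact ⟨f.trans g, fun x y => by rw [hT, hg]; rfl⟩

end Rigidity

/-- A vector of `ℂ⁵` in terms of the standard basis. -/
theorem eq_sum_smul_e (x : Fin 5 → ℂ) :
    x = x 0 • e 0 + x 1 • e 1 + x 2 • e 2 + x 3 • e 3 + x 4 • e 4 := by
  ext i
  fin_cases i <;> simp [e]

/-- Bilinear maps on `ℂ⁵` agree if they are antisymmetric on the standard basis and agree on the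
pairs of basis vectors in increasing order. -/
theorem bil_ext_of_lt {β γ : (Fin 5 → ℂ) →L[ℂ] (Fin 5 → ℂ) →L[ℂ] (Fin 5 → ℂ)}
    (hβ : ∀ i j, β (e i) (e j) + β (e j) (e i) = 0)
    (hγ : ∀ i j, γ (e i) (e j) + γ (e j) (e i) = 0)
    (h : ∀ i j, i < j → β (e i) (e j) = γ (e i) (e j)) : β = γ := by
  have hall : ∀ i j, β (e i) (e j) = γ (e i) (e j) := by
    intro i j
    rcases lt_trichotomy i j with hij | rfl | hij
    · exact h i j hij
    · rw [self_eq_neg.1 (eq_neg_of_add_eq_zero_left (hβ i i)),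
        self_eq_neg.1 (eq_neg_of_add_eq_zero_left (hγ i i))]
    · rw [eq_neg_of_add_eq_zero_left (hβ i j), eq_neg_of_add_eq_zero_left (hγ i j), h j i hij]
  ext1 x
  ext1 y
  rw [eq_sum_smul_e x, eq_sum_smul_e y]
  simp only [map_add, map_smul, add_apply, smul_apply, hall]

theorem e_apply (i j : Fin 5) : e i j = if j = i then 1 else 0 := Pi.single_apply _ _ _

/-- Coordinates of the bracket of the five-dimensional extension of the Heisenberg algebra. -/
theorem heisenbergExtension_apply
    {μ : (Fin 5 → ℂ) →L[ℂ] (Fin 5 → ℂ) →L[ℂ] (Fin 5 → ℂ)}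
    (hLie : IsLieBracket μ)
    (h1 : μ (e 0) (e 2) = e 2) (h2 : μ (e 0) (e 4) = e 4)
    (h3 : μ (e 1) (e 3) = e 3) (h4 : μ (e 1) (e 4) = e 4)
    (h5 : μ (e 2) (e 3) = e 4)
    (h6 : μ (e 0) (e 1) = 0) (h7 : μ (e 0) (e 3) = 0)
    (h8 : μ (e 1) (e 2) = 0) (h9 : μ (e 2) (e 4) = 0)
    (h10 : μ (e 3) (e 4) = 0) (x y : Fin 5 → ℂ) :
    μ x y = ![0, 0, x 0 * y 2 - x 2 * y 0, x 1 * y 3 - x 3 * y 1,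
      (x 0 + x 1) * y 4 - x 4 * (y 0 + y 1) + (x 2 * y 3 - x 3 * y 2)] := by
  have hswap : ∀ i j, μ (e j) (e i) = -μ (e i) (e j) := fun i j =>
    eq_neg_of_add_eq_zero_left (hLie.add_swap _ _)
  conv_lhs => rw [eq_sum_smul_e x, eq_sum_smul_e y]
  simp only [map_add, map_smul, add_apply, smul_apply, hLie.1 (e _), hswap 0 1, hswap 0 2,
    hswap 0 3, hswap 0 4, hswap 1 2, hswap 1 3, hswap 1 4, hswap 2 3, hswap 2 4, hswap 3 4,
    h1, h2, h3, h4, h5, h6, h7, h8, h9, h10]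
  ext i
  fin_cases i <;> simp [e] <;> ring

set_option maxHeartbeats 1000000 in
/-- Every 2-cocycle of the five-dimensional extension of the Heisenberg algebra is a
coboundary. -/
theorem heisenbergExtension_cocycle_eq_coboundary
    {μ : (Fin 5 → ℂ) →L[ℂ] (Fin 5 → ℂ) →L[ℂ] (Fin 5 → ℂ)}
    (hμ : ∀ x y, μ x y = ![0, 0, x 0 * y 2 - x 2 * y 0, x 1 * y 3 - x 3 * y 1,
      (x 0 + x 1) * y 4 - x 4 * (y 0 + y 1) + (x 2 * y 3 - x 3 * y 2)])
    (ω : (Fin 5 → ℂ) →L[ℂ] (Fin 5 → ℂ) →L[ℂ] (Fin 5 → ℂ))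
    (hA : ∀ i j, ω (e i) (e j) + ω (e j) (e i) = 0)
    (hC : ∀ i j k, cocycleSum μ ω (e i) (e j) (e k) = 0) :
    ∃ g : (Fin 5 → ℂ) →L[ℂ] (Fin 5 → ℂ), ∀ x y, ω x y = μ (g x) y + μ x (g y) - g (μ x y) := by
  let w : Fin 5 → Fin 5 → Fin 5 → ℂ := fun i j k => ω (e i) (e j) k
  have hw : ∀ i j k, ω (e i) (e j) k = w i j k := fun _ _ _ => rfl
  have hswap : ∀ i j k, w j i k = -w i j k := fun i j k =>
    eq_neg_of_add_eq_zero_left (congrFun (hA j i) k)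
  have hself : ∀ i k, w i i k = 0 := fun i k => self_eq_neg.1 (hswap i i k)
  have hexp : ∀ x j k, ω x (e j) k =
      x 0 * w 0 j k + x 1 * w 1 j k + x 2 * w 2 j k + x 3 * w 3 j k + x 4 * w 4 j k := by
    intro x j k
    conv_lhs => rw [eq_sum_smul_e x]
    simp [w]
  have hcoc := fun i j k l => congrFun (hC i j k) l
  simp only [cocycleSum, Pi.add_apply, Pi.zero_apply, hexp] at hcoc
  clear_value w
  have c012 := hcoc 0 1 2
  have c013 := hcoc 0 1 3
  have c014 := hcoc 0 1 4
  have c023 := hcoc 0 2 3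
  have c024 := hcoc 0 2 4
  have c034 := hcoc 0 3 4
  have c123 := hcoc 1 2 3
  have c134 := hcoc 1 3 4
  simp [Fin.forall_fin_succ, hμ, hw, e_apply, hself, hswap 0 1, hswap 0 2, hswap 0 3, hswap 0 4,
    hswap 1 2, hswap 1 3, hswap 1 4, hswap 2 3, hswap 2 4, hswap 3 4]
    at c012 c013 c014 c023 c024 c034 c123 c134
  clear hcoc hexp
  let g : (Fin 5 → ℂ) →L[ℂ] (Fin 5 → ℂ) := LinearMap.toContinuousLinearMap (Matrix.toLin'
    !![w 0 2 2, w 1 2 2, -w 0 2 0, -w 1 3 0, -w 0 4 0;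
      w 0 3 3, w 1 3 3, -w 0 2 1, -w 1 3 1, -w 0 4 1;
      w 0 3 4, w 0 1 2, w 2 3 4, w 0 3 2, -w 1 4 2;
      -w 0 1 3, -w 1 2 4, -w 0 2 3, 0, -w 0 4 3;
      -w 0 1 4, 0, 0, 0, 0])
  have hg : ∀ x, g x =
      ![w 0 2 2 * x 0 + w 1 2 2 * x 1 - w 0 2 0 * x 2 - w 1 3 0 * x 3 - w 0 4 0 * x 4,
        w 0 3 3 * x 0 + w 1 3 3 * x 1 - w 0 2 1 * x 2 - w 1 3 1 * x 3 - w 0 4 1 * x 4,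
        w 0 3 4 * x 0 + w 0 1 2 * x 1 + w 2 3 4 * x 2 + w 0 3 2 * x 3 - w 1 4 2 * x 4,
        -w 0 1 3 * x 0 - w 1 2 4 * x 1 - w 0 2 3 * x 2 - w 0 4 3 * x 4,
        -w 0 1 4 * x 0] := fun x => by
    ext l
    fin_cases l <;> simp [g, Matrix.mulVec, dotProduct, Fin.sum_univ_five] <;> ring
  clear_value g
  have hμA : ∀ x y, μ y x = -μ x y := fun x y => by
    rw [hμ, hμ]
    ext l
    fin_cases l <;> simp <;> ring
  have key : ω = bilLeft g μ + bilRight g μ - bilPost g μ := by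
    refine bil_ext_of_lt hA (fun i j => ?_) (fun i j hij => ?_)
    · simp only [sub_apply, add_apply, bilLeft_apply, bilRight_apply, bilPost_apply,
        hμA (g (e i)) (e j), hμA (g (e j)) (e i), hμA (e i) (e j), map_neg]
      abel
    · ext l
      rw [hw]
      simp only [sub_apply, add_apply, bilLeft_apply, bilRight_apply, bilPost_apply, hμ, hg]
      clear hC hA hμA hμ hg hw
      fin_cases i <;> fin_cases j <;> first | exact absurd hij (by decide) | skip
      all_goals fin_cases l <;> simp [e_apply] <;> grind
  exact ⟨g, fun x y => by rw [key]; simp⟩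

/-- The Lie bracket `μ` on `ℂ⁵` with basis `T₁, T₂, X₁, X₂, X₃` given by
`μ(T₁,X₁) = X₁`, `μ(T₁,X₃) = X₃`, `μ(T₂,X₂) = X₂`, `μ(T₂,X₃) = X₃`,
`μ(X₁,X₂) = X₃` and all other basis brackets zero (a solvable Lie algebra whose
nilradical is the 3-dimensional Heisenberg algebra) is rigid: its `GL(5,ℂ)`-orbit
under the transport action is open in the set of Lie brackets on `ℂ⁵`. -/
theorem rigid_five_dim_heisenberg_extension
    (μ : (Fin 5 → ℂ) →L[ℂ] (Fin 5 → ℂ) →L[ℂ] (Fin 5 → ℂ))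
    (hLie : IsLieBracket μ)
    (h1 : μ (e 0) (e 2) = e 2) (h2 : μ (e 0) (e 4) = e 4)
    (h3 : μ (e 1) (e 3) = e 3) (h4 : μ (e 1) (e 4) = e 4)
    (h5 : μ (e 2) (e 3) = e 4)
    (h6 : μ (e 0) (e 1) = 0) (h7 : μ (e 0) (e 3) = 0)
    (h8 : μ (e 1) (e 2) = 0) (h9 : μ (e 2) (e 4) = 0)
    (h10 : μ (e 3) (e 4) = 0) :
    IsOpen {ν : {ν : (Fin 5 → ℂ) →L[ℂ] (Fin 5 → ℂ) →L[ℂ] (Fin 5 → ℂ) // IsLieBracket ν} |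
        (ν : (Fin 5 → ℂ) →L[ℂ] (Fin 5 → ℂ) →L[ℂ] (Fin 5 → ℂ)) ∈ transportOrbit μ} := by
  have hμ := heisenbergExtension_apply hLie h1 h2 h3 h4 h5 h6 h7 h8 h9 h10
  exact isOpen_transportOrbit e μ fun ω hA hC =>
    heisenbergExtension_cocycle_eq_coboundary hμ ω hA hC
end
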